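/- arXiv:2108.08804 — 4 statements merged into one kernel-verified Lean document; each statement's English description precedes it below -/
import Mathlib

section
/- Let F be a finite family of convex sets in ℝ^d with |F| ≥ 2d, such that the intersection of any 2d sets from F has diameter at least 1. Then the intersection of all members of F has diameter at least (2d)^{-2}. -/
open Set Finset

lemma cone_carath {E : Type*} [AddCommGroup E] [Module ℝ E] [FiniteDimensional ℝ E]
    (t : Finset E) : ∀ (c : E → ℝ), (∀ e ∈ t, 0 ≤ c e) →
    ∃ t' ⊆ t, ∃ c' : E → ℝ, (∀ e ∈ t', 0 ≤ c' e) ∧ ∑ e ∈ t', c' e ≤ ∑ e ∈ t, c e ∧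
      ∑ e ∈ t', c' e • e = ∑ e ∈ t, c e • e ∧ t'.card ≤ Module.finrank ℝ E := by
  classical
  induction t using Finset.strongInduction with
  | H t ih =>
  intro c hc
  by_cases hcard : t.card ≤ Module.finrank ℝ E
  · exact ⟨t, Finset.Subset.refl _, c, hc, le_rfl, rfl, hcard⟩
  push Not at hcard
  obtain ⟨f₀, hf₀, x₀, hx₀, hfx₀⟩ := Module.exists_nontrivial_relation_of_finrank_lt_card hcard
  obtain ⟨f, hf, hsum, x, hx, hfx⟩ : ∃ f : E → ℝ, ∑ e ∈ t, f e • e = 0 ∧ 0 ≤ ∑ e ∈ t, f e ∧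
      ∃ x ∈ t, 0 < f x := by
    have key : ∀ f : E → ℝ, ∑ e ∈ t, f e • e = 0 → 0 ≤ ∑ e ∈ t, f e → f x₀ ≠ 0 →
        ∃ f : E → ℝ, ∑ e ∈ t, f e • e = 0 ∧ 0 ≤ ∑ e ∈ t, f e ∧ ∃ x ∈ t, 0 < f x := by
      intro f h1 h2 h3
      refine ⟨f, h1, h2, ?_⟩
      by_contra! hneg
      have h0 : ∑ e ∈ t, f e = 0 := le_antisymm (Finset.sum_nonpos hneg) h2
      exact h3 ((Finset.sum_eq_zero_iff_of_nonpos hneg).1 h0 x₀ hx₀)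
    rcases le_total 0 (∑ e ∈ t, f₀ e) with h | h
    · exact key f₀ hf₀ h hfx₀
    · refine key (fun e => - f₀ e) ?_ ?_ ?_
      · simp [Finset.sum_neg_distrib, hf₀]
      · simpa [Finset.sum_neg_distrib] using h
      · simpa using hfx₀
  obtain ⟨m, hm, hmin⟩ := Finset.exists_min_image (t.filter (fun e => 0 < f e))
    (fun e => c e / f e) ⟨x, by simp [hx, hfx]⟩
  simp only [Finset.mem_filter, and_imp] at hm hmin
  set s := c m / f m with hs
  have hs0 : 0 ≤ s := div_nonneg (hc m hm.1) hm.2.le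
  have hcm : c m - s * f m = 0 := by
    rw [hs]; field_simp [hm.2.ne']; simp
  obtain ⟨t', ht', c', h1, h2, h3, h4⟩ := ih (t.erase m) (Finset.erase_ssubset hm.1)
    (fun e => c e - s * f e) (by
      intro e he
      have he' := Finset.mem_of_mem_erase he
      rcases lt_or_ge 0 (f e) with h | h
      · have := hmin e he' h
        rw [le_div_iff₀ h] at this
        linarith
      · have := hc e he'
        nlinarith)
  refine ⟨t', ht'.trans (Finset.erase_subset _ _), c', h1, ?_, ?_, h4⟩
  · refine h2.trans ?_
    rw [Finset.sum_erase t (f := fun e => c e - s * f e) hcm, Finset.sum_sub_distrib, ← Finset.mul_sum]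
    nlinarith
  · rw [h3, Finset.sum_erase _ (by rw [hcm, zero_smul])]
    simp only [sub_smul, mul_smul, Finset.sum_sub_distrib, ← Finset.smul_sum, hf]
    simp

lemma closure_hull_rep {d : ℕ} {A : Set (EuclideanSpace ℝ (Fin d))} (hA : IsCompact A)
    {z : EuclideanSpace ℝ (Fin d)} (hz : z ∈ closure (convexHull ℝ A)) :
    ∃ (c : Fin d → ℝ) (w : Fin d → EuclideanSpace ℝ (Fin d)), (∀ i, 0 ≤ c i) ∧
      ∑ i, c i ≤ 1 ∧ (∀ i, w i ∈ A) ∧ z = ∑ i, c i • w i := by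
  classical
  set B : Set (Fin d → ℝ) := {c | (∀ i, 0 ≤ c i) ∧ ∑ i, c i ≤ 1} with hB
  have hBc : IsCompact B := by
    refine (isCompact_univ_pi (fun _ : Fin d => isCompact_Icc (a := (0:ℝ)) (b := 1))).of_isClosed_subset
      ?_ ?_
    · have : B = (⋂ i, {c : Fin d → ℝ | 0 ≤ c i}) ∩ {c | ∑ i, c i ≤ 1} := by
        ext c; simp [hB]
      rw [this]
      refine (isClosed_iInter fun i => isClosed_le (by fun_prop) (by fun_prop)).inter
        (isClosed_le (by fun_prop) (by fun_prop))
    · rintro c ⟨h1, h2⟩ i -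
      exact ⟨h1 i, (Finset.single_le_sum (fun j _ => h1 j) (Finset.mem_univ i)).trans h2⟩
  set T := (fun p : (Fin d → ℝ) × (Fin d → EuclideanSpace ℝ (Fin d)) => ∑ i, p.1 i • p.2 i) ''
    (B ×ˢ (Set.univ.pi fun _ => A)) with hT
  have hTc : IsCompact T := (hBc.prod (isCompact_univ_pi fun _ => hA)).image (by fun_prop)
  have hsub : convexHull ℝ A ⊆ T := by
    intro y hy
    have hne : A.Nonempty := convexHull_nonempty_iff.1 ⟨y, hy⟩
    obtain ⟨a₀, ha₀⟩ := hne
    rw [convexHull_eq_union_convexHull_finite_subsets] at hy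
    simp only [Set.mem_iUnion] at hy
    obtain ⟨t, htA, hy⟩ := hy
    rw [Finset.mem_convexHull'] at hy
    obtain ⟨c, hc0, hc1, hcy⟩ := hy
    obtain ⟨t', ht', c', h1, h2, h3, h4⟩ := cone_carath t c hc0
    rw [finrank_euclideanSpace_fin] at h4
    obtain ⟨φ⟩ : Nonempty (t' ↪ Fin d) := by
      apply Function.Embedding.nonempty_of_card_le; simpa using h4
    have hsumc : ∑ i, Function.extend φ (fun e : t' => c' e) 0 i = ∑ e ∈ t', c' e := by
      rw [← Finset.sum_coe_sort t' c']
      symm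
      refine Finset.sum_of_injOn φ φ.injective.injOn (by simp) ?_ ?_
      · intro i _ hi
        rw [Function.extend_apply']
        · rfl
        · rintro ⟨e, rfl⟩; exact hi (by simp)
      · intro e _; rw [φ.injective.extend_apply]
    refine ⟨⟨Function.extend φ (fun e : t' => c' e) 0,
      Function.extend φ (fun e : t' => (e : EuclideanSpace ℝ (Fin d))) (fun _ => a₀)⟩, ⟨⟨?_, ?_⟩, ?_⟩, ?_⟩
    · intro i
      by_cases hi : ∃ e, φ e = i
      · obtain ⟨e, rfl⟩ := hi
        simp only [φ.injective.extend_apply]; exact h1 _ e.2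
      · simp [Function.extend_apply' _ _ _ hi]
    · simp only; rw [hsumc]; linarith
    · intro i _
      by_cases hi : ∃ e, φ e = i
      · obtain ⟨e, rfl⟩ := hi
        simp only [φ.injective.extend_apply]; exact htA (ht' e.2)
      · simpa [Function.extend_apply' _ _ _ hi] using ha₀
    · simp only
      rw [← hcy, ← h3, ← Finset.sum_coe_sort t' (fun e => c' e • e)]
      symm
      refine Finset.sum_of_injOn φ φ.injective.injOn (by simp) ?_ ?_
      · intro i _ hi
        rw [Function.extend_apply']
        · simp
        · rintro ⟨e, rfl⟩; exact hi (by simp)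
      · intro e _; rw [φ.injective.extend_apply, φ.injective.extend_apply]
  have hzT : z ∈ T := (closure_minimal hsub hTc.isClosed) hz
  obtain ⟨⟨c, w⟩, ⟨⟨h1, h2⟩, h3⟩, rfl⟩ := hzT
  exact ⟨c, w, h1, h2, fun i => h3 i (Set.mem_univ i), rfl⟩

lemma exists_good_basis {d : ℕ} {S : Set (EuclideanSpace ℝ (Fin d))} (hS : IsCompact S)
    (hspan : Submodule.span ℝ S = ⊤) :
    ∃ b : Module.Basis (Fin d) ℝ (EuclideanSpace ℝ (Fin d)), (∀ i, b i ∈ S) ∧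
      ∀ s ∈ S, ∀ i, |b.repr s i| ≤ 1 := by
  classical
  let b₀ := (EuclideanSpace.basisFun (Fin d) ℝ).toBasis
  let b₁ := Module.Basis.ofSpan hspan.ge
  let b₂ : Module.Basis (Fin d) ℝ (EuclideanSpace ℝ (Fin d)) :=
    b₁.reindex (b₁.indexEquiv b₀)
  have hb₂ : ∀ i, b₂ i ∈ S := by
    intro i
    simp only [b₂, Module.Basis.reindex_apply]
    exact Module.Basis.ofSpan_subset hspan.ge ⟨_, rfl⟩
  have hcont : Continuous fun v : Fin d → EuclideanSpace ℝ (Fin d) => |b₀.det v| := by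
    have : Continuous fun v : Fin d → EuclideanSpace ℝ (Fin d) => b₀.det v := by
      simp only [Module.Basis.det_apply]
      refine Continuous.matrix_det ?_
      refine continuous_matrix fun i j => ?_
      simp only [Module.Basis.toMatrix_apply, b₀]
      simp
      fun_prop
    exact this.abs
  obtain ⟨v, hv, hmax⟩ := (isCompact_univ_pi fun _ : Fin d => hS).exists_isMaxOn
    ⟨b₂, fun i _ => hb₂ i⟩ hcont.continuousOn
  have hpos : 0 < |b₀.det v| :=
    lt_of_lt_of_le (abs_pos.2 (b₀.isUnit_det b₂).ne_zero) (hmax (show (b₂ : Fin d → _) ∈ _ from fun i _ => hb₂ i))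
  have hbas := (Module.Basis.is_basis_iff_det b₀ (v := v)).2 (IsUnit.mk0 _ (abs_pos.1 hpos))
  refine ⟨Module.Basis.mk hbas.1 hbas.2.ge, fun i => by simpa using hv i (Set.mem_univ i), ?_⟩
  intro s hs i
  have h := b₀.det_smul_mk_coord_eq_det_update hbas.1 hbas.2.ge i
  have h2 := congrArg (fun f => f s) h
  simp at h2
  have h3 : |b₀.det (Function.update v i s)| ≤ |b₀.det v| := by
    refine hmax ?_
    intro j _
    by_cases hj : j = i
    · subst hj; simpa using hs
    · simpa [hj] using hv j (Set.mem_univ j)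
  rw [← h2, abs_mul] at h3
  exact le_of_mul_le_mul_left (by simpa using h3) hpos

lemma sum_mem_of_convex {d : ℕ} {E : Type*} [AddCommGroup E] [Module ℝ E] {K : Set E}
    (hK : Convex ℝ K) {p : E} (hp : p ∈ K) (b : Fin d → E) (hb : ∀ i, p + b i ∈ K)
    (e : Fin d → ℝ) (he : ∀ i, 0 ≤ e i) (hs : ∑ i, e i ≤ 1) : p + ∑ i, e i • b i ∈ K := by
  have := hK.sum_mem (t := (Finset.univ : Finset (Option (Fin d))))
    (w := fun o => o.elim (1 - ∑ i, e i) e) (z := fun o => o.elim p (fun i => p + b i))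
    (by rintro (_ | i) _
        · simpa using hs
        · exact he i)
    (by rw [Fintype.sum_option]; simp)
    (by rintro (_ | i) _
        · exact hp
        · exact hb i)
  rw [Fintype.sum_option] at this
  convert this using 1
  simp only [Option.elim, smul_add, Finset.sum_add_distrib, ← Finset.sum_smul, sub_smul, one_smul]
  abel

lemma exists_center {d : ℕ} (hd : 1 ≤ d) {K : Set (EuclideanSpace ℝ (Fin d))}
    (hKc : IsCompact K) (hK : Convex ℝ K) (hint : (interior K).Nonempty) :
    ∃ g ∈ interior K, ∀ x ∈ K, g - (1 / (2 * d) : ℝ) • (x - g) ∈ K := by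
  obtain ⟨p, hp⟩ := hint
  have hd' : (1 : ℝ) ≤ d := by exact_mod_cast hd
  have hpK := interior_subset hp
  set S := (fun x => x - p) '' K with hS
  have hSc : IsCompact S := hKc.image (by fun_prop)
  have hspan : Submodule.span ℝ S = ⊤ := by
    apply Submodule.eq_top_of_nonempty_interior'
    refine ⟨0, ?_⟩
    have h1 : S ∈ nhds (0 : EuclideanSpace ℝ (Fin d)) := by
      have h2 : (Homeomorph.subRight p) '' K ∈ nhds ((Homeomorph.subRight p) p) :=
        (Homeomorph.subRight p).isOpenMap.image_mem_nhds (mem_interior_iff_mem_nhds.1 hp)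
      simpa using h2
    exact mem_interior_iff_mem_nhds.2 (Filter.mem_of_superset h1 Submodule.subset_span)
  obtain ⟨b, hbS, hb⟩ := exists_good_basis hSc hspan
  have hbK : ∀ i, p + b i ∈ K := by
    intro i
    obtain ⟨x, hx, hxe⟩ := hbS i
    rw [← hxe]; simpa using hx
  have hmem := sum_mem_of_convex hK hpK b hbK
  refine ⟨p + (1 / (2 * d + 1) : ℝ) • ∑ i, b i, ?_, ?_⟩
  · apply hK.openSegment_interior_self_subset_interior hp
      (hmem (fun _ => (1 / d : ℝ)) (fun _ => by positivity) (by simp; field_simp; rfl))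
    refine ⟨1 - d / (2 * d + 1), d / (2 * d + 1), ?_, by positivity, by ring, ?_⟩
    · rw [sub_pos, div_lt_one (by positivity)]; linarith
    · rw [← Finset.smul_sum, smul_add, smul_smul, ← add_assoc, ← add_smul]
      congr 1
      · simp
      · congr 1; field_simp
  · intro x hx
    have hx' : x = p + ∑ i, b.repr (x - p) i • b i := by
      rw [b.sum_repr]; abel
    have habs := hb (x - p) ⟨x, hx, rfl⟩
    set a := b.repr (x - p) with ha
    have := hmem (fun i => (1 - a i) / (2 * d))
      (fun i => div_nonneg (by have := (abs_le.1 (habs i)).2; linarith) (by positivity))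
      (by
        rw [← Finset.sum_div, div_le_one (by positivity)]
        calc ∑ i, (1 - a i) ≤ ∑ i : Fin d, (2 : ℝ) :=
              Finset.sum_le_sum fun i _ => by have := (abs_le.1 (habs i)).1; linarith
          _ = 2 * d := by simp [mul_comm])
    convert this using 1
    rw [hx']
    simp only [sub_div, sub_smul, Finset.sum_sub_distrib]
    have e1 : ∀ i, (a i / (2 * d)) • b i = (1 / (2 * d) : ℝ) • (a i • b i) := by
      intro i; rw [smul_smul]; congr 1; ring
    simp only [e1, ← Finset.smul_sum]
    match_scalars <;> field_simp <;> ring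

open scoped InnerProductSpace in
lemma core {d : ℕ} (hd : 1 ≤ d) {ι : Type*} [Fintype ι] [Nonempty ι] [DecidableEq ι]
    (C : ι → Set (EuclideanSpace ℝ (Fin d))) (hC : ∀ i, IsCompact (C i))
    (hconv : ∀ i, Convex ℝ (C i)) (hint : (interior (⋂ i, C i)).Nonempty) :
    ∃ (g : EuclideanSpace ℝ (Fin d)) (J : Finset ι), J.card ≤ 2 * d ∧
      ∀ x ∈ ⋂ i ∈ J, C i, g - (1 / (2 * d + 2 * d ^ 2) : ℝ) • (x - g) ∈ ⋂ i, C i := by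
  classical
  have hd' : (1 : ℝ) ≤ d := by exact_mod_cast hd
  have hKc : IsCompact (⋂ i, C i) := by
    inhabit ι
    exact (hC default).of_isClosed_subset (isClosed_iInter fun i => (hC i).isClosed)
      (Set.iInter_subset _ _)
  obtain ⟨g, hg, hgK⟩ := exists_center hd hKc (convex_iInter hconv) hint
  have hgC : ∀ i, g ∈ C i := fun i => Set.mem_iInter.1 (interior_subset hg) i
  -- polars
  let P : ι → Set (EuclideanSpace ℝ (Fin d)) := fun i => {a | ∀ x ∈ C i, ⟪a, x - g⟫_ℝ ≤ 1}
  have bipolar : ∀ i y, (∀ a ∈ P i, ⟪a, y - g⟫_ℝ ≤ 1) → y ∈ C i := by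
    intro i y hy
    by_contra hyC
    obtain ⟨f, u, h1, h2⟩ := geometric_hahn_banach_closed_point (hconv i) (hC i).isClosed hyC
    set a := (InnerProductSpace.toDual ℝ _).symm f with ha
    have hf : ∀ x, f x = ⟪a, x⟫_ℝ := fun x => by simp [ha]
    have hpos : 0 < u - f g := by linarith [h1 g (hgC i)]
    have h3 : ∀ x, ⟪(u - f g)⁻¹ • a, x - g⟫_ℝ = (f x - f g) / (u - f g) := by
      intro x; rw [real_inner_smul_left, inner_sub_right, ← hf, ← hf]; field_simp
    have := hy ((u - f g)⁻¹ • a) (fun x hx => by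
      rw [h3, div_le_one hpos]; linarith [h1 x hx])
    rw [h3, div_le_one hpos] at this
    linarith
  have hPc : ∀ i, IsCompact (P i) := by
    intro i
    apply Metric.isCompact_of_isClosed_isBounded
    · have : P i = ⋂ x ∈ C i, {a | ⟪a, x - g⟫_ℝ ≤ 1} := by ext a; simp [P]
      rw [this]
      exact isClosed_biInter fun x _ => isClosed_le (by fun_prop) (by fun_prop)
    · obtain ⟨r, hr, hball⟩ := Metric.mem_nhds_iff.1 (mem_interior_iff_mem_nhds.1 hg)
      refine (Metric.isBounded_closedBall (x := (0 : EuclideanSpace ℝ (Fin d))) (r := 2 / r)).subset ?_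
      intro a ha
      rw [mem_closedBall_zero_iff]
      by_cases ha0 : a = 0
      · simp [ha0]; positivity
      have hn : 0 < ‖a‖ := norm_pos_iff.2 ha0
      have hx : g + (r / 2 * ‖a‖⁻¹) • a ∈ Metric.ball g r := by
        rw [Metric.mem_ball, dist_eq_norm, add_sub_cancel_left, norm_smul, Real.norm_of_nonneg (by positivity)]
        field_simp; linarith
      have := ha _ (Set.mem_iInter.1 (hball hx) i)
      rw [add_sub_cancel_left, real_inner_smul_right, real_inner_self_eq_norm_sq] at this
      rw [le_div_iff₀ hr]
      field_simp at this
      linarith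
  set A := ⋃ i, P i with hA
  have hAc : IsCompact A := isCompact_iUnion hPc
  have bip : ∀ y, (∀ a ∈ A, ⟪a, y⟫_ℝ ≤ 1) → g + y ∈ ⋂ i, C i := by
    intro y hy
    refine Set.mem_iInter.2 fun i => bipolar i _ fun a ha => ?_
    rw [add_sub_cancel_left]
    exact hy a (Set.mem_iUnion.2 ⟨i, ha⟩)
  have h0A : (0 : EuclideanSpace ℝ (Fin d)) ∈ A := by
    inhabit ι
    exact Set.mem_iUnion.2 ⟨default, fun x _ => by simp⟩
  have hspan : Submodule.span ℝ A = ⊤ := by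
    rw [← Submodule.orthogonal_eq_bot_iff, Submodule.eq_bot_iff]
    intro x hx
    by_contra hx0
    have hxa : ∀ a ∈ A, ⟪a, x⟫_ℝ = 0 := fun a ha =>
      (Submodule.mem_orthogonal _ _).1 hx a (Submodule.subset_span ha)
    obtain ⟨R, hR⟩ := hKc.isBounded.subset_closedBall g
    have hmem : g + ((|R| + 1) * ‖x‖⁻¹) • x ∈ ⋂ i, C i := bip _ fun a ha => by
      rw [real_inner_smul_right, hxa a ha]; simp
    have := hR hmem
    have hn : 0 < ‖x‖ := norm_pos_iff.2 hx0
    rw [Metric.mem_closedBall, dist_eq_norm, add_sub_cancel_left, norm_smul,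
      Real.norm_of_nonneg (by positivity), mul_assoc, inv_mul_cancel₀ hn.ne'] at this
    linarith [le_abs_self R]
  obtain ⟨b, hbA, hb⟩ := exists_good_basis hAc hspan
  set z : EuclideanSpace ℝ (Fin d) := -((1 / (2 * d ^ 2) : ℝ) • ∑ i, b i) with hz
  have hzmem : z ∈ closure (convexHull ℝ A) := by
    by_contra hznot
    obtain ⟨f, u, h1, h2⟩ := geometric_hahn_banach_closed_point
      (convex_convexHull ℝ A).closure isClosed_closure hznot
    set x := (InnerProductSpace.toDual ℝ _).symm f with hx
    have hf : ∀ y, f y = ⟪y, x⟫_ℝ := fun y => by rw [real_inner_comm]; simp [hx]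
    have h1' : ∀ a ∈ A, f a < u := fun a ha => h1 a (subset_closure (subset_convexHull ℝ A ha))
    have hu : 0 < u := by simpa using h1' 0 h0A
    have hxK : g + u⁻¹ • x ∈ ⋂ i, C i := bip _ fun a ha => by
      rw [real_inner_smul_right, ← hf, inv_mul_le_iff₀ hu]; linarith [h1' a ha]
    have hxK' := hgK _ hxK
    rw [add_sub_cancel_left] at hxK'
    have h4 : ∀ i, - f (b i) ≤ 2 * d * u := by
      intro i
      obtain ⟨j, hj⟩ := Set.mem_iUnion.1 (hbA i)
      have := hj _ (Set.mem_iInter.1 hxK' j)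
      rw [sub_sub_cancel_left, inner_neg_right, real_inner_smul_right, real_inner_smul_right, ← hf] at this
      field_simp at this
      linarith
    have h5 : f z = (∑ i, - f (b i)) / (2 * d ^ 2) := by
      rw [hz, map_neg, map_smul, map_sum, Finset.sum_neg_distrib, smul_eq_mul]; ring
    have h6 : ∑ i, - f (b i) ≤ d * (2 * d * u) := by
      calc _ ≤ ∑ i : Fin d, 2 * d * u := Finset.sum_le_sum fun i _ => h4 i
        _ = _ := by simp
    have h7 : f z ≤ u := by
      rw [h5, div_le_iff₀ (by positivity)]; linarith
    linarith
  obtain ⟨c, w, hc0, hc1, hwA, hzw⟩ := closure_hull_rep hAc hzmem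
  choose jb hjb using fun i => Set.mem_iUnion.1 (hbA i)
  choose jw hjw using fun i => Set.mem_iUnion.1 (hwA i)
  refine ⟨g, Finset.univ.image jb ∪ Finset.univ.image jw, ?_, ?_⟩
  · refine (Finset.card_union_le _ _).trans ?_
    have e1 := Finset.card_image_le (s := Finset.univ) (f := jb)
    have e2 := Finset.card_image_le (s := Finset.univ) (f := jw)
    simp only [Finset.card_univ, Fintype.card_fin] at e1 e2
    omega
  · intro x hx
    have hx' : ∀ i ∈ Finset.univ.image jb ∪ Finset.univ.image jw, x ∈ C i := by
      simpa only [Set.mem_iInter] using hx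
    have hxb : ∀ k, ⟪b k, x - g⟫_ℝ ≤ 1 := fun k => hjb k x (hx' _ (by simp))
    have hxw : ∀ k, ⟪w k, x - g⟫_ℝ ≤ 1 := fun k => hjw k x (hx' _ (by simp))
    rw [sub_eq_add_neg]
    refine bip _ fun a ha => ?_
    have hza : ⟪z, x - g⟫_ℝ ≤ 1 := by
      rw [hzw, sum_inner]
      refine le_trans (Finset.sum_le_sum fun i _ => ?_) hc1
      rw [real_inner_smul_left]
      exact mul_le_of_le_one_right (hc0 i) (hxw i)
    have hdec : -a = ∑ i, (1 - b.repr a i) • b i + (2 * d ^ 2 : ℝ) • z := by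
      rw [hz, smul_neg, smul_smul]
      simp only [sub_smul, one_smul, Finset.sum_sub_distrib, b.sum_repr]
      rw [mul_one_div_cancel (by positivity), one_smul]; abel
    have h8 : ⟪-a, x - g⟫_ℝ ≤ 2 * d + 2 * d ^ 2 := by
      rw [hdec, inner_add_left, real_inner_smul_left, sum_inner]
      refine add_le_add ?_ (mul_le_of_le_one_right (by positivity) hza)
      calc _ ≤ ∑ i : Fin d, (2 : ℝ) := Finset.sum_le_sum fun i _ => by
            rw [real_inner_smul_left]
            have := abs_le.1 (hb a ha i)
            nlinarith [hxb i]
        _ = 2 * d := by simp [mul_comm]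
    rw [inner_neg_right, real_inner_smul_right]
    rw [inner_neg_left] at h8
    rw [← mul_neg, one_div, inv_mul_le_iff₀ (by positivity)]
    linarith

/-- **Helly's theorem with diameter** (Bárány–Katchalski–Pach; with the bound of
Almendra-Hernández, Ambrus, and Kendall). If every `2d` members of a finite family of at
least `2d` convex sets in `ℝ^d` have an intersection of diameter at least `1`, then the
intersection of the whole family has diameter at least `(2d)^{-2}`. -/
theorem helly_with_diameter (d n : ℕ) (hd : 1 ≤ d) (hn : 2 * d ≤ n)
    (K : Fin n → Set (EuclideanSpace ℝ (Fin d)))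
    (hconv : ∀ i, Convex ℝ (K i))
    (hdiam : ∀ S : Finset (Fin n), S.card = 2 * d → 1 ≤ EMetric.diam (⋂ i ∈ S, K i)) :
    ((2 * (d : ENNReal)) ^ 2)⁻¹ ≤ EMetric.diam (⋂ i, K i) := by
  classical
  have hd' : (1 : ℝ) ≤ d := by exact_mod_cast hd
  have : Nonempty (Fin n) := ⟨⟨0, by omega⟩⟩
  suffices h : (1 : ENNReal) ≤ (2 * (d : ENNReal)) ^ 2 * EMetric.diam (⋂ i, K i) by
    rwa [ENNReal.inv_le_iff_le_mul]
    · intro _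
      have : d ≠ 0 := by omega
      simp [this]
    · intro h
      exact absurd h (ENNReal.pow_ne_top (ENNReal.mul_ne_top (by simp) (by simp)))
  refine ENNReal.le_of_forall_nnreal_lt fun r hr => ?_
  have hpts : ∀ S : Finset (Fin n), ∃ p q, S.card = 2 * d →
      p ∈ (⋂ i ∈ S, K i) ∧ q ∈ (⋂ i ∈ S, K i) ∧ (r : ℝ) ≤ dist p q := by
    intro S
    by_cases hS : S.card = 2 * d
    · by_contra! hcon
      have : EMetric.diam (⋂ i ∈ S, K i) ≤ r := by
        refine Metric.ediam_le fun x hx y hy => ?_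
        have := (hcon x y).2 hx hy
        rw [edist_dist, ← ENNReal.ofReal_coe_nnreal]
        exact ENNReal.ofReal_le_ofReal this.le
      exact absurd (hr.trans_le (hdiam S hS)) (not_lt.2 this)
    · exact ⟨0, 0, fun h => absurd h hS⟩
  choose p q hpq using hpts
  let V : Fin n → Set (EuclideanSpace ℝ (Fin d)) := fun i =>
    p '' {S | S.card = 2 * d ∧ i ∈ S} ∪ q '' {S | S.card = 2 * d ∧ i ∈ S}
  let C : Fin n → Set (EuclideanSpace ℝ (Fin d)) := fun i => convexHull ℝ (V i)
  have hVf : ∀ i, (V i).Finite := fun i =>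
    ((Set.toFinite _).image p).union ((Set.toFinite _).image q)
  have hCc : ∀ i, IsCompact (C i) := fun i => (hVf i).isCompact_convexHull ℝ
  have hCK : ∀ i, C i ⊆ K i := by
    intro i
    refine convexHull_min ?_ (hconv i)
    rintro x (⟨S, ⟨hS, hi⟩, rfl⟩ | ⟨S, ⟨hS, hi⟩, rfl⟩)
    · exact Set.mem_iInter₂.1 (hpq S hS).1 i hi
    · exact Set.mem_iInter₂.1 (hpq S hS).2.1 i hi
  have hpC : ∀ S : Finset (Fin n), S.card = 2 * d → ∀ i ∈ S, p S ∈ C i := fun S hS i hi =>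
    subset_convexHull ℝ _ (Or.inl ⟨S, ⟨hS, hi⟩, rfl⟩)
  have hqC : ∀ S : Finset (Fin n), S.card = 2 * d → ∀ i ∈ S, q S ∈ C i := fun S hS i hi =>
    subset_convexHull ℝ _ (Or.inr ⟨S, ⟨hS, hi⟩, rfl⟩)
  have hext : ∀ J : Finset (Fin n), J.card ≤ 2 * d → ∃ S, J ⊆ S ∧ S.card = 2 * d := by
    intro J hJ
    obtain ⟨S, h1, -, h2⟩ := Finset.exists_subsuperset_card_eq (Finset.subset_univ J) hJ (by simpa using hn)
    exact ⟨S, h1, h2⟩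
  obtain ⟨x₀, hx₀⟩ : (⋂ i ∈ (Finset.univ : Finset (Fin n)), C i).Nonempty := by
    refine Convex.helly_theorem (𝕜 := ℝ) ?_ (fun i _ => convex_convexHull ℝ _) ?_
    · simp; omega
    · intro I _ hI
      rw [finrank_euclideanSpace_fin] at hI
      obtain ⟨S, hIS, hS⟩ := hext I (by omega)
      exact ⟨p S, Set.mem_iInter₂.2 fun i hi => hpC S hS i (hIS hi)⟩
  have hx₀' : ∀ i, x₀ ∈ C i := by simpa using hx₀
  set ρ : ℝ := (1 / (2 * d + 2 * d ^ 2) : ℝ) * r with hρ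
  have step : ∀ δ : ℝ, 0 < δ → ∃ x y, (∀ i, x ∈ Metric.cthickening δ (C i)) ∧
      (∀ i, y ∈ Metric.cthickening δ (C i)) ∧ ρ ≤ dist x y := by
    intro δ hδ
    obtain ⟨g, J, hJ, hgJ⟩ := core hd (fun i => Metric.cthickening δ (C i))
      (fun i => (hCc i).cthickening) (fun i => (convex_convexHull ℝ _).cthickening δ)
      ⟨x₀, mem_interior_iff_mem_nhds.2 (Filter.mem_of_superset (Metric.closedBall_mem_nhds x₀ hδ)
        (Set.subset_iInter fun i => Metric.closedBall_subset_cthickening (hx₀' i) δ))⟩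
    obtain ⟨S, hJS, hS⟩ := hext J hJ
    have hp := hgJ (p S) (Set.mem_iInter₂.2 fun i hi =>
      Metric.self_subset_cthickening _ (hpC S hS i (hJS hi)))
    have hq := hgJ (q S) (Set.mem_iInter₂.2 fun i hi =>
      Metric.self_subset_cthickening _ (hqC S hS i (hJS hi)))
    refine ⟨_, _, Set.mem_iInter.1 hp, Set.mem_iInter.1 hq, ?_⟩
    rw [dist_sub_left, dist_smul₀, dist_sub_right, Real.norm_of_nonneg (by positivity)]
    exact mul_le_mul_of_nonneg_left (hpq S hS).2.2 (by positivity)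
  let T : ℕ → Set (EuclideanSpace ℝ (Fin d) × EuclideanSpace ℝ (Fin d)) := fun m =>
    {z | (∀ i, z.1 ∈ Metric.cthickening (1 / (m + 1 : ℝ)) (C i)) ∧
      (∀ i, z.2 ∈ Metric.cthickening (1 / (m + 1 : ℝ)) (C i)) ∧ ρ ≤ dist z.1 z.2}
  have hTcl : ∀ m, IsClosed (T m) := by
    intro m
    have : T m = (⋂ i, Prod.fst ⁻¹' (Metric.cthickening (1 / (m + 1 : ℝ)) (C i))) ∩
      ((⋂ i, Prod.snd ⁻¹' (Metric.cthickening (1 / (m + 1 : ℝ)) (C i))) ∩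
        {z | ρ ≤ dist z.1 z.2}) := by
      ext z; simp [T]
    rw [this]
    exact (isClosed_iInter fun i => Metric.isClosed_cthickening.preimage continuous_fst).inter
      ((isClosed_iInter fun i => Metric.isClosed_cthickening.preimage continuous_snd).inter
        (isClosed_le (by fun_prop) (by fun_prop)))
  obtain ⟨⟨x, y⟩, hxy⟩ := IsCompact.nonempty_iInter_of_sequence_nonempty_isCompact_isClosed T
    (by
      rintro m z ⟨h1, h2, h3⟩
      have hle : 1 / ((m + 1 : ℕ) + 1 : ℝ) ≤ 1 / (m + 1 : ℝ) := by
        push_cast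
        exact one_div_le_one_div_of_le (by positivity) (by linarith)
      exact ⟨fun i => Metric.cthickening_mono hle _ (h1 i),
        fun i => Metric.cthickening_mono hle _ (h2 i), h3⟩)
    (by
      intro m
      obtain ⟨x, y, h⟩ := step (1 / (m + 1 : ℝ)) (by positivity)
      exact ⟨(x, y), h⟩)
    (by
      let i₀ : Fin n := Classical.arbitrary _
      have hcp : IsCompact (Metric.cthickening (1 / ((0 : ℕ) + 1 : ℝ)) (C i₀) ×ˢ
          Metric.cthickening (1 / ((0 : ℕ) + 1 : ℝ)) (C i₀)) :=
        (hCc i₀).cthickening.prod (hCc i₀).cthickening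
      exact hcp.of_isClosed_subset (hTcl 0) (fun z hz => ⟨hz.1 i₀, hz.2.1 i₀⟩))
    hTcl
  have hxy' := Set.mem_iInter.1 hxy
  have hlim : ∀ (i : Fin n) (x : EuclideanSpace ℝ (Fin d)),
      (∀ m : ℕ, x ∈ Metric.cthickening (1 / (m + 1 : ℝ)) (C i)) → x ∈ C i := by
    intro i x hx
    rw [← (hCc i).isClosed.closure_eq, Metric.closure_eq_iInter_cthickening]
    refine Set.mem_iInter₂.2 fun ε hε => ?_
    obtain ⟨m, hm⟩ := exists_nat_one_div_lt hε
    exact Metric.cthickening_mono hm.le _ (hx m)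
  have hxK : x ∈ ⋂ i, K i := Set.mem_iInter.2 fun i => hCK i (hlim i x fun m => (hxy' m).1 i)
  have hyK : y ∈ ⋂ i, K i := Set.mem_iInter.2 fun i => hCK i (hlim i y fun m => (hxy' m).2.1 i)
  have hdist : (r : ℝ) ≤ (2 * d) ^ 2 * dist x y := by
    have h1 : ρ ≤ dist x y := (hxy' 0).2.2
    rw [hρ, one_div, inv_mul_le_iff₀ (by positivity)] at h1
    refine h1.trans (mul_le_mul_of_nonneg_right ?_ dist_nonneg)
    nlinarith
  calc (r : ENNReal) = ENNReal.ofReal r := by simp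
    _ ≤ ENNReal.ofReal ((2 * d) ^ 2 * dist x y) := ENNReal.ofReal_le_ofReal hdist
    _ = (2 * (d : ENNReal)) ^ 2 * edist x y := by
        rw [ENNReal.ofReal_mul (by positivity), edist_dist, ENNReal.ofReal_pow (by positivity),
          ENNReal.ofReal_mul (by positivity)]
        simp
    _ ≤ _ := by gcongr; exact Metric.edist_le_ediam_of_mem hxK hyK
end

section
/- Let k and d be positive integers and let F be a finite family of sets in ℝ^d such that every member of F is the union of k pairwise disjoint compact convex sets, and every intersection of members of F is also the union of k pairwise disjoint compact convex sets. If every k(d+1) sets in F have a point in common, then the intersection of all members of F is non-empty. -/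
/-- A set is the union of `k` pairwise disjoint compact convex sets. -/
def IsUnionOfDisjointCompactConvex (d k : ℕ) (A : Set (EuclideanSpace ℝ (Fin d))) : Prop :=
  ∃ C : Fin k → Set (EuclideanSpace ℝ (Fin d)),
    (∀ i, IsCompact (C i)) ∧ (∀ i, Convex ℝ (C i)) ∧
    (∀ i j, i ≠ j → Disjoint (C i) (C j)) ∧ A = ⋃ i, C i

/-- The point `p` minimizes the norm among all points it can see inside `⋂ D`. -/
def AmentaLocMin {d : ℕ} (D : Finset (Set (EuclideanSpace ℝ (Fin d))))
    (p : EuclideanSpace ℝ (Fin d)) : Prop :=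
  ∀ x, (∀ A ∈ D, segment ℝ p x ⊆ A) → ‖p‖ ≤ ‖x‖

theorem amenta_argmin {d : ℕ} (B : Finset (Set (EuclideanSpace ℝ (Fin d))))
    (hcl : ∀ A ∈ B, IsClosed A) (hne : (⋂ A ∈ B, A).Nonempty) :
    ∃ q ∈ (⋂ A ∈ B, A), ∀ x ∈ (⋂ A ∈ B, A), ‖q‖ ≤ ‖x‖ := by
  have hc : IsClosed (⋂ A ∈ B, A) := isClosed_biInter hcl
  obtain ⟨q, hq, hd⟩ := hc.exists_infDist_eq_dist hne 0
  refine ⟨q, hq, fun x hx => ?_⟩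
  have := Metric.infDist_le_dist_of_mem (x := 0) hx
  rw [hd] at this
  simpa using this

/-- A member's component through a point: convex, inside the set, and containing every
segment of the set that starts at the point. -/
theorem amenta_component {d k : ℕ} {A : Set (EuclideanSpace ℝ (Fin d))}
    (hA : IsUnionOfDisjointCompactConvex d k A) {p : EuclideanSpace ℝ (Fin d)} (hp : p ∈ A) :
    ∃ K : Set (EuclideanSpace ℝ (Fin d)), Convex ℝ K ∧ K ⊆ A ∧ p ∈ K ∧
      ∀ x, segment ℝ p x ⊆ A → x ∈ K := by
  obtain ⟨C, hcomp, hconv, hdisj, rfl⟩ := hA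
  obtain ⟨i, hi⟩ := Set.mem_iUnion.1 hp
  refine ⟨C i, hconv i, Set.subset_iUnion C i, hi, fun x hx => ?_⟩
  have hpre : IsPreconnected (segment ℝ p x) := (convex_segment p x).isPreconnected
  rw [isPreconnected_iff_subset_of_disjoint_closed] at hpre
  have h2 : IsClosed (⋃ j ∈ {j | j ≠ i}, C j) :=
    (Set.toFinite {j | j ≠ i}).isClosed_biUnion (fun j _ => (hcomp j).isClosed)
  have hdis : ∀ y, y ∈ C i → y ∈ (⋃ j ∈ {j | j ≠ i}, C j) → False := by
    intro y hy hy'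
    simp only [Set.mem_iUnion] at hy'
    obtain ⟨j, hj, hyj⟩ := hy'
    exact Set.disjoint_left.1 (hdisj j i hj) hyj hy
  have hsub : segment ℝ p x ⊆ C i ∪ ⋃ j ∈ {j | j ≠ i}, C j := by
    intro y hy
    obtain ⟨j, hj⟩ := Set.mem_iUnion.1 (hx hy)
    by_cases hji : j = i
    · left; rw [← hji]; exact hj
    · right
      simp only [Set.mem_iUnion]
      exact ⟨j, hji, hj⟩
  have hemp : segment ℝ p x ∩ (C i ∩ ⋃ j ∈ {j | j ≠ i}, C j) = ∅ := by
    ext y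
    simp only [Set.mem_inter_iff, Set.mem_empty_iff_false, iff_false]
    rintro ⟨_, h, h'⟩
    exact hdis y h h'
  rcases hpre (C i) _ (hcomp i).isClosed h2 hsub hemp with h | h
  · exact h (right_mem_segment ℝ p x)
  · exact (hdis p hi (h (left_mem_segment ℝ p x))).elim

/-- Helly's theorem: at most `d` members suffice to make a minimizer locally minimal. -/
theorem amenta_basis {d k : ℕ} (B : Finset (Set (EuclideanSpace ℝ (Fin d))))
    (hB : ∀ A ∈ B, IsUnionOfDisjointCompactConvex d k A) (p : EuclideanSpace ℝ (Fin d))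
    (hp : p ∈ ⋂ A ∈ B, A) (hmin : ∀ x ∈ ⋂ A ∈ B, A, ‖p‖ ≤ ‖x‖) :
    ∃ D ⊆ B, D.card ≤ d ∧ AmentaLocMin D p := by
  classical
  by_contra hcon
  push Not at hcon
  have hp' : ∀ A ∈ B, p ∈ A := by simpa using hp
  have hK : ∀ A : Set (EuclideanSpace ℝ (Fin d)), ∃ K : Set (EuclideanSpace ℝ (Fin d)),
      A ∈ B → (Convex ℝ K ∧ K ⊆ A ∧ p ∈ K ∧ ∀ x, segment ℝ p x ⊆ A → x ∈ K) := by
    intro A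
    by_cases hA : A ∈ B
    · obtain ⟨K, h⟩ := amenta_component (hB A hA) (hp' A hA)
      exact ⟨K, fun _ => h⟩
    · exact ⟨∅, fun h => (hA h).elim⟩
  choose K hK using hK
  have key := Convex.helly_theorem' (𝕜 := ℝ)
    (F := fun o : Option (Set (EuclideanSpace ℝ (Fin d))) =>
      o.elim (Metric.ball (0 : EuclideanSpace ℝ (Fin d)) ‖p‖) K)
    (s := Finset.insertNone B) ?_ ?_
  · obtain ⟨x, hx⟩ := key
    simp only [Set.mem_iInter] at hx
    have h0 := hx none (by simp)
    simp only [Option.elim_none, mem_ball_zero_iff] at h0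
    refine absurd (hmin x ?_) (not_le.2 h0)
    simp only [Set.mem_iInter]
    intro A hA
    exact (hK A hA).2.1 (hx (some A) (by simpa using hA))
  · rintro (_ | A) hA
    · exact convex_ball _ _
    · exact (hK A (by simpa using hA)).1
  · intro I hI hcard
    rw [finrank_euclideanSpace_fin] at hcard
    by_cases hn : none ∈ I
    · have hDB : Finset.eraseNone I ⊆ B := by
        intro A hA
        have := hI (Finset.mem_eraseNone.1 hA)
        simpa using this
      have hDc : (Finset.eraseNone I).card ≤ d := by
        have := Finset.card_insertNone (Finset.eraseNone I)
        rw [Finset.insertNone_eraseNone, Finset.insert_eq_of_mem hn] at this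
        omega
      have := hcon _ hDB hDc
      unfold AmentaLocMin at this
      push Not at this
      obtain ⟨x, hx, hlt⟩ := this
      refine ⟨x, ?_⟩
      simp only [Set.mem_iInter]
      rintro (_ | A) hA
      · simpa using hlt
      · have hA' := Finset.mem_eraseNone.2 hA
        exact (hK A (hDB hA')).2.2.2 x (hx A hA')
    · refine ⟨p, ?_⟩
      simp only [Set.mem_iInter]
      rintro (_ | A) hA
      · exact (hn hA).elim
      · exact (hK A (by simpa using hI hA)).2.2.1

/-- The greedy removal process. -/
theorem amenta_chain {d k : ℕ} (G : Finset (Set (EuclideanSpace ℝ (Fin d))))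
    (hG : ∀ A ∈ G, IsUnionOfDisjointCompactConvex d k A)
    (hcl : ∀ A ∈ G, IsClosed A)
    (hstart : ∀ i ∈ G, ∃ q, (∀ A ∈ G, A ≠ i → q ∈ A) ∧
      (∀ x, (∀ A ∈ G, A ≠ i → x ∈ A) → ‖q‖ ≤ ‖x‖) ∧ q ∉ i)
    (hcard : k * (d + 1) < G.card) (j : ℕ) (hj : j ≤ k + 1) :
    ∃ (B D : Finset (Set (EuclideanSpace ℝ (Fin d)))) (P : Finset (EuclideanSpace ℝ (Fin d))),
      B ⊆ G ∧ D ⊆ B ∧ B.card + j = G.card ∧ D.card ≤ j * d ∧ P.card = j ∧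
      (∀ p ∈ P, ∀ A ∈ B, p ∈ A) ∧ (∀ p ∈ P, AmentaLocMin D p) ∧
      (∀ i ∈ B, i ∉ D → ∃ q, (∀ A ∈ B, A ≠ i → q ∈ A) ∧
        (∀ x, (∀ A ∈ B, A ≠ i → x ∈ A) → ‖q‖ ≤ ‖x‖) ∧ q ∉ i) := by
  classical
  induction j with
  | zero =>
    refine ⟨G, ∅, ∅, subset_rfl, by simp, by simp, by simp, by simp, by simp, by simp, ?_⟩
    intro i hi _
    exact hstart i hi
  | succ j ih =>
    obtain ⟨B, D, P, hBG, hDB, hBc, hDc, hPc, hPB, hPD, hinv⟩ := ih (by omega)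
    have hlt : D.card < B.card := by
      have h1 : j * d ≤ k * d := Nat.mul_le_mul_right d (by omega)
      have h2 : k * (d + 1) = k * d + k := by ring
      omega
    have hne : (B \ D).Nonempty := by
      rw [Finset.sdiff_nonempty]
      intro h
      exact absurd (Finset.card_le_card h) (by omega)
    have hinv' : ∀ i, ∃ q, i ∈ B \ D → ((∀ A ∈ B, A ≠ i → q ∈ A) ∧
        (∀ x, (∀ A ∈ B, A ≠ i → x ∈ A) → ‖q‖ ≤ ‖x‖) ∧ q ∉ i) := by
      intro i
      by_cases hi : i ∈ B \ D
      · obtain ⟨q, hq⟩ := hinv i (Finset.mem_sdiff.1 hi).1 (Finset.mem_sdiff.1 hi).2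
        exact ⟨q, fun _ => hq⟩
      · exact ⟨0, fun h => (hi h).elim⟩
    choose q hq using hinv'
    obtain ⟨i, hi, hmax⟩ := Finset.exists_max_image (B \ D) (fun i => ‖q i‖) hne
    obtain ⟨hqi1, hqi2, hqi3⟩ := hq i hi
    have hiB := (Finset.mem_sdiff.1 hi).1
    have hiD := (Finset.mem_sdiff.1 hi).2
    have hB'G : B.erase i ⊆ G := (Finset.erase_subset _ _).trans hBG
    obtain ⟨D1, hD1B, hD1c, hD1⟩ := amenta_basis (B.erase i) (fun A hA => hG A (hB'G hA)) (q i)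
      (by
        simp only [Set.mem_iInter]
        intro A hA
        exact hqi1 A (Finset.mem_of_mem_erase hA) (Finset.ne_of_mem_erase hA))
      (by
        intro x hx
        simp only [Set.mem_iInter] at hx
        exact hqi2 x (fun A hA hne => hx A (Finset.mem_erase.2 ⟨hne, hA⟩)))
    have hnP : q i ∉ P := fun h => hqi3 (hPB _ h i hiB)
    refine ⟨B.erase i, D ∪ D1, insert (q i) P, hB'G, ?_, ?_, ?_, ?_, ?_, ?_, ?_⟩
    · refine Finset.union_subset (fun A hA => ?_) hD1B
      exact Finset.mem_erase.2 ⟨fun h => hiD (h ▸ hA), hDB hA⟩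
    · have := Finset.card_erase_add_one hiB
      omega
    · have := Finset.card_union_le D D1
      rw [Nat.succ_mul]
      omega
    · rw [Finset.card_insert_of_notMem hnP, hPc]
    · intro p hp A hA
      rcases Finset.mem_insert.1 hp with rfl | hp
      · exact hqi1 A (Finset.mem_of_mem_erase hA) (Finset.ne_of_mem_erase hA)
      · exact hPB p hp A (Finset.mem_of_mem_erase hA)
    · intro p hp x hx
      rcases Finset.mem_insert.1 hp with rfl | hp
      · exact hD1 x (fun A hA => hx A (Finset.mem_union_right _ hA))
      · exact hPD p hp x (fun A hA => hx A (Finset.mem_union_left _ hA))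
    · intro i' hi' hni'
      have hi'B : i' ∈ B := Finset.mem_of_mem_erase hi'
      have hi'BD : i' ∈ B \ D :=
        Finset.mem_sdiff.2 ⟨hi'B, fun h => hni' (Finset.mem_union_left _ h)⟩
      obtain ⟨h1, h2, h3⟩ := hq i' hi'BD
      have hmem : q i' ∈ ⋂ A ∈ (B.erase i).erase i', A := by
        simp only [Set.mem_iInter]
        intro A hA
        exact h1 A (Finset.mem_of_mem_erase (Finset.mem_of_mem_erase hA))
          (Finset.ne_of_mem_erase hA)
      obtain ⟨r, hr, hrmin⟩ := amenta_argmin ((B.erase i).erase i')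
        (fun A hA => hcl A (hB'G (Finset.mem_of_mem_erase hA))) ⟨_, hmem⟩
      have hr' : ∀ A ∈ B.erase i, A ≠ i' → r ∈ A := by
        intro A hA hne
        simp only [Set.mem_iInter] at hr
        exact hr A (Finset.mem_erase.2 ⟨hne, hA⟩)
      have hrmin' : ∀ x, (∀ A ∈ B.erase i, A ≠ i' → x ∈ A) → ‖r‖ ≤ ‖x‖ := by
        intro x hx
        apply hrmin
        simp only [Set.mem_iInter]
        intro A hA
        exact hx A (Finset.mem_of_mem_erase hA) (Finset.ne_of_mem_erase hA)
      by_cases hri : r ∈ i'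
      · have hle : ‖q i‖ ≤ ‖r‖ := by
          apply hqi2
          intro A hA hne
          by_cases h : A = i'
          · rw [h]; exact hri
          · exact hr' A (Finset.mem_erase.2 ⟨hne, hA⟩) h
        refine ⟨q i', fun A hA hne => h1 A (Finset.mem_of_mem_erase hA) hne, ?_, h3⟩
        intro x hx
        exact ((hmax i' hi'BD).trans hle).trans (hrmin' x hx)
      · exact ⟨r, hr', hrmin', hri⟩

theorem amenta_closed {d k : ℕ} {A : Set (EuclideanSpace ℝ (Fin d))}
    (hA : IsUnionOfDisjointCompactConvex d k A) : IsClosed A := by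
  obtain ⟨C, hcomp, -, -, rfl⟩ := hA
  exact isClosed_iUnion_of_finite (fun i => (hcomp i).isClosed)

/-- **Amenta's theorem** (the Grünbaum–Motzkin conjecture). Let `F` be a finite family of
sets in `ℝ^d`, each a union of `k` pairwise disjoint compact convex sets, such that every
intersection of members of `F` is also such a union. If every `k(d+1)` members of `F`
have a common point, then all members of `F` have a common point. -/
theorem amenta (d k : ℕ) (hd : 1 ≤ d) (hk : 1 ≤ k)
    (F : Finset (Set (EuclideanSpace ℝ (Fin d))))
    (hF : ∀ A ∈ F, IsUnionOfDisjointCompactConvex d k A)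
    (hInt : ∀ G ⊆ F, G.Nonempty →
      IsUnionOfDisjointCompactConvex d k (⋂ A ∈ G, A))
    (hhelly : ∀ G ⊆ F, G.card ≤ k * (d + 1) → (⋂ A ∈ G, A).Nonempty) :
    (⋂ A ∈ F, A).Nonempty := by
  classical
  by_contra hempty
  obtain ⟨G, hGmem, hGmin⟩ := Finset.exists_min_image
    (F.powerset.filter (fun G => ¬ (⋂ A ∈ G, A).Nonempty)) Finset.card
    ⟨F, by simpa using hempty⟩
  obtain ⟨hGF, hGe⟩ := Finset.mem_filter.1 hGmem
  rw [Finset.mem_powerset] at hGF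
  have hcard : k * (d + 1) < G.card := by
    by_contra h
    exact hGe (hhelly G hGF (not_lt.1 h))
  have hU : ∀ A ∈ G, IsUnionOfDisjointCompactConvex d k A := fun A hA => hF A (hGF hA)
  have hcl : ∀ A ∈ G, IsClosed A := fun A hA => amenta_closed (hU A hA)
  have hstart : ∀ i ∈ G, ∃ q, (∀ A ∈ G, A ≠ i → q ∈ A) ∧
      (∀ x, (∀ A ∈ G, A ≠ i → x ∈ A) → ‖q‖ ≤ ‖x‖) ∧ q ∉ i := by
    intro i hi
    have hne : (⋂ A ∈ G.erase i, A).Nonempty := by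
      by_contra h
      have h1 := hGmin (G.erase i) (Finset.mem_filter.2
        ⟨Finset.mem_powerset.2 ((Finset.erase_subset _ _).trans hGF), h⟩)
      have h2 := Finset.card_erase_lt_of_mem hi
      omega
    obtain ⟨q, hq, hqmin⟩ := amenta_argmin (G.erase i)
      (fun A hA => hcl A (Finset.mem_of_mem_erase hA)) hne
    simp only [Set.mem_iInter, Finset.mem_erase, and_imp] at hq hqmin
    refine ⟨q, fun A hA hne => hq A hne hA, fun x hx => hqmin x (fun A hne hA => hx A hA hne), ?_⟩
    intro hqi
    apply hGe
    refine ⟨q, ?_⟩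
    simp only [Set.mem_iInter]
    intro A hA
    by_cases h : A = i
    · rw [h]; exact hqi
    · exact hq A h hA
  obtain ⟨B, D, P, hBG, hDB, hBc, -, hPc, hPB, hPD, -⟩ :=
    amenta_chain G hU hcl hstart hcard (k + 1) le_rfl
  have hBne : B.Nonempty := by
    rw [← Finset.card_pos]
    have h1 : 1 ≤ k * d := Nat.mul_pos hk hd
    have h2 : k * (d + 1) = k * d + k := by ring
    omega
  obtain ⟨C, -, hconv, -, hC⟩ := hInt B (hBG.trans hGF) hBne
  have hPC : ∀ p, ∃ i : Fin k, p ∈ P → p ∈ C i := by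
    intro p
    by_cases hp : p ∈ P
    · have : p ∈ ⋂ A ∈ B, A := by
        simp only [Set.mem_iInter]
        exact hPB p hp
      rw [hC] at this
      obtain ⟨i, hi⟩ := Set.mem_iUnion.1 this
      exact ⟨i, fun _ => hi⟩
    · exact ⟨⟨0, hk⟩, fun h => (hp h).elim⟩
  choose f hf using hPC
  obtain ⟨p, hp, q, hq, hpq, hfpq⟩ := Finset.exists_ne_map_eq_of_card_lt_of_maps_to
    (s := P) (t := (Finset.univ : Finset (Fin k))) (f := f) (by simp [hPc])
    (fun _ _ => by simp)
  have hpC := hf p hp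
  have hqC := hf q hq
  rw [← hfpq] at hqC
  have hseg : ∀ x ∈ C (f p), ∀ y ∈ C (f p), ∀ A ∈ D, segment ℝ x y ⊆ A := by
    intro x hx y hy A hA z hz
    have hz1 : z ∈ C (f p) := (hconv (f p)).segment_subset hx hy hz
    have hz2 : z ∈ ⋂ A ∈ B, A := by
      rw [hC]; exact Set.mem_iUnion.2 ⟨_, hz1⟩
    simp only [Set.mem_iInter] at hz2
    exact hz2 A (hDB hA)
  have heq : ‖p‖ = ‖q‖ := le_antisymm (hPD p hp q (hseg p hpC q hqC))
    (hPD q hq p (hseg q hqC p hpC))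
  have hmid : (1 / 2 : ℝ) • (p + q) ∈ C (f p) := by
    rw [smul_add]
    exact hconv (f p) hpC hqC (by norm_num) (by norm_num) (by norm_num)
  have hlt := (norm_midpoint_lt_iff heq).2 hpq
  exact absurd (hPD p hp _ (hseg p hpC _ hmid)) (not_le.2 hlt)
end

section
/- Let X be a set of n ≥ d+1 points in ℝ^d. Then there exists a point p ∈ ℝ^d that is contained in at least (1/(d+1)^d) · C(n, d+1) of the simplices of X, i.e., the number of (d+1)-element subsets Y ⊆ X with p ∈ conv Y is at least (1/(d+1)^d) · C(n, d+1). -/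
open scoped Classical
open scoped Pointwise

/-- Conic colorful Caratheodory. -/
lemma cone_colorful {V : Type*} [NormedAddCommGroup V] [InnerProductSpace ℝ V] [FiniteDimensional ℝ V]
    {m : ℕ} (hm : Module.finrank ℝ V = m) (C : Fin m → Finset V)
    (a : V)
    (hC : ∀ i, ∀ z : V, 0 < inner ℝ z a → ∃ c ∈ C i, 0 < inner ℝ z c)
    (hne : ∀ i, (C i).Nonempty) :
    ∃ s : Fin m → V, (∀ i, s i ∈ C i) ∧
      ∃ μ : Fin m → ℝ, (∀ i, 0 ≤ μ i) ∧ ∑ i, μ i • s i = a := by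
  -- cone of a partial selection
  let K : (Fin m → V) → Finset (Fin m) → Set V := fun s I =>
    {x | ∃ μ : Fin m → ℝ, (∀ i, 0 ≤ μ i) ∧ (∀ i, i ∉ I → μ i = 0) ∧ ∑ i, μ i • s i = x}
  have hclosed : ∀ (s : Fin m → V) (I : Finset (Fin m)),
      LinearIndependent ℝ (fun i : I => s i) → IsClosed (K s I) := by
    intro s I hli
    let L : (I → ℝ) →ₗ[ℝ] V := Fintype.linearCombination ℝ (fun i : I => s i)
    have hinj : Function.Injective L := by
      exact hli.fintypeLinearCombination_injective
    have hemb := LinearMap.isClosedEmbedding_of_injective (LinearMap.ker_eq_bot.mpr hinj)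
    have hKeq : K s I = L '' (Set.Ici 0) := by
      ext x
      constructor
      · rintro ⟨μ, h0, hI, rfl⟩
        refine ⟨fun i => μ i, fun i => h0 i, ?_⟩
        simp only [L, Fintype.linearCombination_apply]
        rw [Finset.sum_coe_sort I (fun i => μ i • s i)]
        apply Finset.sum_subset (Finset.subset_univ _)
        intro i _ hi
        simp [hI i hi]
      · rintro ⟨ν, h0, rfl⟩
        refine ⟨fun i => if h : i ∈ I then ν ⟨i, h⟩ else 0, ?_, ?_, ?_⟩
        · intro i
          dsimp only
          split_ifs with h
          · exact h0 ⟨i, h⟩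
          · exact le_rfl
        · intro i hi
          simp [hi]
        · simp only [L, Fintype.linearCombination_apply]
          rw [← Finset.sum_subset (Finset.subset_univ I)]
          · rw [← Finset.sum_coe_sort I]
            apply Finset.sum_congr rfl
            intro i _
            simp
          · intro i _ hi
            simp [hi]
    rw [hKeq]
    exact hemb.isClosedMap _ isClosed_Ici
  -- finite set of candidates
  let P : Finset ((Fin m → V) × Finset (Fin m)) :=
    ((Fintype.piFinset C) ×ˢ Finset.univ).filter
      (fun t => LinearIndependent ℝ (fun i : t.2 => t.1 i))
  have hPne : P.Nonempty := by
    choose s hs using hne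
    refine ⟨(s, ∅), ?_⟩
    simp only [P, Finset.mem_filter, Finset.mem_product, Fintype.mem_piFinset, Finset.mem_univ,
      and_true]
    refine ⟨hs, ?_⟩
    exact linearIndependent_empty_type
  obtain ⟨⟨s, I⟩, hsP, hmin⟩ := P.exists_min_image (fun t => Metric.infDist a (K t.1 t.2)) hPne
  simp only [P, Finset.mem_filter, Finset.mem_product, Fintype.mem_piFinset, Finset.mem_univ,
      and_true] at hsP hmin
  obtain ⟨hs, hli⟩ := hsP
  have hKne : (K s I).Nonempty := ⟨0, 0, by simp, by simp, by simp⟩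
  obtain ⟨x, hx, hxd⟩ := (hclosed s I hli).exists_infDist_eq_dist hKne a
  obtain ⟨μ, h0, hI, hsum⟩ := hx
  refine ⟨s, hs, μ, h0, ?_⟩
  rw [hsum]
  by_contra hxa
  set z := a - x with hz
  have hz0 : z ≠ 0 := fun h => hxa (sub_eq_zero.mp h).symm
  -- optimality
  have hopt : ∀ y ∈ K s I, ‖z‖ ≤ ‖a - y‖ := by
    intro y hy
    have := Metric.infDist_le_dist_of_mem (x := a) hy
    rw [hxd, dist_eq_norm, dist_eq_norm] at this
    exact this
  -- perturbation lemma
  have hpert : ∀ w : V, (∃ ε > 0, ∀ t : ℝ, 0 ≤ t → t ≤ ε → ‖z‖ ≤ ‖z - t • w‖) →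
      inner ℝ z w ≤ 0 := by
    rintro w ⟨ε, hε, hw⟩
    by_contra hcon
    push Not at hcon
    have hwpos : 0 < ‖w‖ ^ 2 := by
      have : w ≠ 0 := by
        rintro rfl
        simp at hcon
      positivity
    set t := min ε (inner ℝ z w / ‖w‖ ^ 2) with ht
    have htpos : 0 < t := lt_min hε (by positivity)
    have h1 := hw t htpos.le (min_le_left _ _)
    have h2 : t * ‖w‖ ^ 2 ≤ inner ℝ z w := by
      rw [← le_div_iff₀ hwpos]
      exact min_le_right _ _
    have h3 : ‖z‖ ^ 2 ≤ ‖z - t • w‖ ^ 2 := by gcongr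
    rw [norm_sub_sq_real z, inner_smul_right, norm_smul, mul_pow, Real.norm_eq_abs, sq_abs] at h3
    nlinarith
  -- complementary slackness
  have hslack : ∀ j, μ j ≠ 0 → inner ℝ z (s j) = 0 := by
    intro j hj
    have hjpos : 0 < μ j := lt_of_le_of_ne (h0 j) (Ne.symm hj)
    have hjI : j ∈ I := by
      by_contra h
      exact hj (hI j h)
    have key : ∀ t : ℝ, -μ j ≤ t → ‖z‖ ≤ ‖z - t • s j‖ := by
      intro t ht
      have : x + t • s j ∈ K s I := by
        refine ⟨fun i => μ i + if i = j then t else 0, ?_, ?_, ?_⟩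
        · intro i
          dsimp only
          split_ifs with h
          · subst h; linarith
          · simpa using h0 i
        · intro i hi
          have : i ≠ j := fun h => hi (h ▸ hjI)
          simp [this, hI i hi]
        · simp [add_smul, Finset.sum_add_distrib, hsum, ite_smul]
      have h := hopt _ this
      rwa [← sub_sub, ← hz] at h
    apply le_antisymm
    · exact hpert _ ⟨1, one_pos, fun t h0 _ => key t (by linarith)⟩
    · have := hpert (-s j) ⟨μ j, hjpos, fun t _ h => by
        have := key (-t) (by linarith)
        simpa using this⟩
      rw [inner_neg_right] at this
      linarith
  have hxz : inner ℝ z x = 0 := by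
    rw [← hsum, inner_sum]
    apply Finset.sum_eq_zero
    intro i _
    rw [inner_smul_right]
    by_cases h : μ i = 0
    · simp [h]
    · simp [hslack i h]
  have hza : 0 < inner ℝ z a := by
    have : a = z + x := by simp [hz]
    rw [this, inner_add_right, hxz, add_zero, real_inner_self_eq_norm_sq]
    have : 0 < ‖z‖ := norm_pos_iff.mpr hz0
    positivity
  let J : Finset (Fin m) := Finset.univ.filter (fun i => μ i ≠ 0)
  have hJI : J ⊆ I := by
    intro i hi
    by_contra h
    exact (Finset.mem_filter.mp hi).2 (hI i h)
  have hliJ : LinearIndependent ℝ (fun i : J => s i) :=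
    hli.comp (fun i : J => (⟨i, hJI i.2⟩ : I)) (fun i j h => by
      apply Subtype.ext
      simpa using h)
  -- missing index
  have hmiss : ∃ i, i ∉ J := by
    by_contra hcon
    push Not at hcon
    have hliall : LinearIndependent ℝ s := by
      have := hliJ.comp (fun i : Fin m => (⟨i, hcon i⟩ : J)) (fun i j h => by simpa using h)
      exact this
    have hspan := hliall.span_eq_top_of_card_eq_finrank' (by simp [hm])
    have hzmem : z ∈ Submodule.span ℝ (Set.range s) := by rw [hspan]; trivial
    have hle : Submodule.span ℝ (Set.range s) ≤ LinearMap.ker (innerₛₗ ℝ z) := by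
      rw [Submodule.span_le]
      rintro _ ⟨i, rfl⟩
      have := hslack i (Finset.mem_filter.mp (hcon i)).2
      simpa using this
    have := hle hzmem
    simp at this
    exact hz0 (by simpa using this)
  obtain ⟨i, hiJ⟩ := hmiss
  obtain ⟨c, hcC, hc⟩ := hC i z hza
  let s' := Function.update s i c
  have hs'i : s' i = c := Function.update_self ..
  have hs'j : ∀ j ∈ J, s' j = s j := fun j hj =>
    Function.update_of_ne (by rintro rfl; exact hiJ hj) _ _
  have hs' : ∀ j, s' j ∈ C j := by
    intro j
    by_cases h : j = i
    · subst h; rw [hs'i]; exact hcC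
    · simp only [s']
      rw [Function.update_of_ne h]
      exact hs j
  have hli' : LinearIndependent ℝ (fun j : (insert i J : Finset (Fin m)) => s' j) := by
    have h1 : LinearIndepOn ℝ s' (insert i (J : Set (Fin m))) := by
      rw [linearIndepOn_insert (by simpa using hiJ)]
      constructor
      · have : LinearIndepOn ℝ s (J : Set (Fin m)) := hliJ
        exact this.congr (fun j hj => (hs'j j hj).symm)
      · intro hmem
        have hle : Submodule.span ℝ (s' '' (J : Set (Fin m))) ≤ LinearMap.ker (innerₛₗ ℝ z) := by
          rw [Submodule.span_le]
          rintro _ ⟨j, hj, rfl⟩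
          rw [hs'j j hj]
          have := hslack j (Finset.mem_filter.mp hj).2
          simpa using this
        have := hle hmem
        rw [hs'i] at this
        simp at this
        linarith
    rw [← Finset.coe_insert] at h1
    exact h1
  have hm' := hmin (s', insert i J) ⟨hs', hli'⟩
  simp only at hm'
  rw [hxd, dist_eq_norm, ← hz] at hm'
  have : inner ℝ z c ≤ 0 := by
    apply hpert
    refine ⟨1, one_pos, fun t ht _ => ?_⟩
    have hmem : x + t • c ∈ K s' (insert i J) := by
      have hμi : μ i = 0 := by simpa [J] using hiJ
      refine ⟨fun j => μ j + if j = i then t else 0, ?_, ?_, ?_⟩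
      · intro j
        dsimp only
        split_ifs
        · linarith [h0 j]
        · simpa using h0 j
      · intro j hj
        simp only [Finset.mem_insert, not_or] at hj
        have : μ j = 0 := by simpa [J] using hj.2
        simp [hj.1, this]
      · simp only [add_smul, Finset.sum_add_distrib, ite_smul, zero_smul, Finset.sum_ite_eq',
          Finset.mem_univ, if_true, hs'i]
        congr 1
        rw [← hsum]
        apply Finset.sum_congr rfl
        intro j _
        by_cases h : μ j = 0
        · simp [h]
        · rw [hs'j j (by simpa [J] using h)]
    have h2 := Metric.infDist_le_dist_of_mem (x := a) hmem
    rw [dist_eq_norm, ← sub_sub, ← hz] at h2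
    exact hm'.trans h2
  linarith

/-- Strong colorful Caratheodory in Euclidean space. -/
lemma colorful_euclid {V : Type*} [NormedAddCommGroup V] [InnerProductSpace ℝ V] [FiniteDimensional ℝ V]
    {m : ℕ} (hm : Module.finrank ℝ V = m) (C : Fin m → Finset V)
    (q : V)
    (hC : ∀ i, (0 : V) ∈ convexHull ℝ (C i : Set V)) :
    ∃ s : Fin m → V, (∀ i, s i ∈ C i) ∧
      (0 : V) ∈ convexHull ℝ (insert q (Set.range s)) := by
  have hne : ∀ i, (C i).Nonempty := by
    intro i
    have := convexHull_nonempty_iff.mp ⟨_, hC i⟩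
    simpa using this
  have hPne : (Fintype.piFinset C).Nonempty := Fintype.piFinset_nonempty.mpr hne
  let H : (Fin m → V) → Set V := fun s => convexHull ℝ (insert q (Set.range s))
  obtain ⟨s, hs, hmin⟩ := (Fintype.piFinset C).exists_min_image
    (fun s => Metric.infDist 0 (H s)) hPne
  rw [Fintype.mem_piFinset] at hs
  refine ⟨s, hs, ?_⟩
  have hcl : IsClosed (H s) :=
    ((Set.finite_range s).insert q).isClosed_convexHull ℝ
  have hHne : (H s).Nonempty := ⟨q, subset_convexHull _ _ (Set.mem_insert _ _)⟩
  change (0 : V) ∈ H s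
  rw [hcl.mem_iff_infDist_zero hHne]
  refine le_antisymm ?_ Metric.infDist_nonneg
  have key : ∀ ε : ℝ, 0 < ε → Metric.infDist 0 (H s) ≤ ε * ‖q‖ := by
    intro ε hε
    obtain ⟨s', hs', μ, hμ, hsum⟩ := cone_colorful hm (fun i => (C i).image (fun c => c - ε • q)) (-q)
      (by
        intro i z hz
        by_contra hcon
        push Not at hcon
        have hcon' : ∀ c ∈ C i, inner ℝ z c ≤ ε * inner ℝ z q := by
          intro c hc
          have := hcon _ (Finset.mem_image_of_mem _ hc)
          rw [inner_sub_right, inner_smul_right] at this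
          linarith
        have hconv : Convex ℝ {y : V | inner ℝ z y ≤ ε * inner ℝ z q} :=
          convex_halfSpace_le (f := fun y : V => inner ℝ z y)
            ⟨fun x y => inner_add_right .., fun c x => inner_smul_right ..⟩ _
        have := convexHull_min (s := (C i : Set V)) (fun c hc => hcon' c hc) hconv (hC i)
        replace this : inner ℝ z (0 : V) ≤ ε * inner ℝ z q := this
        rw [inner_zero_right] at this
        rw [inner_neg_right] at hz
        nlinarith)
      (fun i => (hne i).image _)
    have : ∀ i, ∃ c ∈ C i, c - ε • q = s' i := fun i => by simpa using hs' i
    choose u hu hu' using this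
    refine (hmin u (Fintype.mem_piFinset.mpr hu)).trans ?_
    set t := ∑ i, μ i with ht
    have ht0 : 0 ≤ t := Finset.sum_nonneg (fun i _ => hμ i)
    have h1t : 0 < 1 + t := by linarith
    let y : V := (1 + t)⁻¹ • (q + ∑ i, μ i • u i)
    have hy : y ∈ H u := by
      have hconv : Convex ℝ (H u) := convex_convexHull _ _
      have := hconv.sum_mem (t := (Finset.univ : Finset (Option (Fin m))))
        (w := fun o => (1 + t)⁻¹ * o.elim 1 μ) (z := fun o => o.elim q u) ?_ ?_ ?_
      · rw [Fintype.sum_option] at this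
        simp only [Option.elim, mul_one, mul_smul, ← Finset.smul_sum, ← smul_add] at this
        exact this
      · rintro (_ | i) _
        · simp; positivity
        · have := hμ i
          simp; positivity
      · rw [Fintype.sum_option]
        simp only [Option.elim, ← Finset.mul_sum, ← ht]
        field_simp
      · rintro (_ | i) _
        · exact subset_convexHull _ _ (Set.mem_insert _ _)
        · exact subset_convexHull _ _ (Set.mem_insert_of_mem _ ⟨i, rfl⟩)
    have hyeq : y = (ε * (t / (1 + t))) • q := by
      have : ∑ i, μ i • u i = -q + (ε * t) • q := by
        rw [← hsum, ht, Finset.mul_sum, Finset.sum_smul, ← Finset.sum_add_distrib]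
        apply Finset.sum_congr rfl
        intro i _
        rw [← hu' i]
        module
      simp only [y]
      rw [this, add_neg_cancel_left, smul_smul]
      congr 1
      field_simp
    refine (Metric.infDist_le_dist_of_mem hy).trans ?_
    rw [dist_zero_left, hyeq, norm_smul, Real.norm_eq_abs]
    have h1 : t / (1 + t) ≤ 1 := by
      rw [div_le_one h1t]; linarith
    have h2 : 0 ≤ t / (1 + t) := by positivity
    rw [abs_of_nonneg (by positivity)]
    gcongr
    nlinarith
  by_contra hcon
  push Not at hcon
  set D := Metric.infDist 0 (H s)
  have := key (D / (2 * (‖q‖ + 1))) (by positivity)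
  have hq := norm_nonneg q
  rw [div_mul_eq_mul_div, le_div_iff₀ (by positivity)] at this
  nlinarith

/-- Strong colorful Caratheodory in a finite-dimensional space, with weights. -/
lemma colorful_gen {V : Type*} [AddCommGroup V] [Module ℝ V] [FiniteDimensional ℝ V] {m : ℕ}
    (hm : Module.finrank ℝ V = m) (C : Fin m → Finset V) (q : V)
    (hC : ∀ i, (0 : V) ∈ convexHull ℝ (C i : Set V)) :
    ∃ s : Fin m → V, (∀ i, s i ∈ C i) ∧ (0 : V) ∈ convexHull ℝ (insert q (Set.range s)) := by
  let e : V ≃ₗ[ℝ] EuclideanSpace ℝ (Fin m) := LinearEquiv.ofFinrankEq _ _ (by simp [hm])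
  obtain ⟨s, hs, h0⟩ := colorful_euclid (V := EuclideanSpace ℝ (Fin m)) (by simp) (fun i => (C i).image e) (e q) (by
    intro i
    rw [Finset.coe_image]
    have := e.toLinearMap.image_convexHull (C i : Set V)
    simp only [LinearEquiv.coe_coe] at this
    rw [← this]
    exact ⟨0, hC i, by simp⟩)
  have : ∀ i, ∃ c ∈ C i, e c = s i := fun i => by simpa using hs i
  choose u hu hu' using this
  refine ⟨u, hu, ?_⟩
  have himg : insert (e q) (Set.range s) = e '' (insert q (Set.range u)) := by
    rw [Set.image_insert_eq, ← Set.range_comp]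
    congr 2
    ext1 i
    exact (hu' i).symm
  rw [himg] at h0
  have := e.toLinearMap.image_convexHull (insert q (Set.range u))
  simp only [LinearEquiv.coe_coe] at this
  rw [← this] at h0
  obtain ⟨y, hy, hy0⟩ := h0
  have : y = 0 := by simpa using hy0
  rwa [this] at hy

lemma exists_weights {V ι : Type*} [AddCommGroup V] [Module ℝ V] [Fintype ι] (f : ι → V) (x : V)
    (hx : x ∈ convexHull ℝ (Set.range f)) :
    ∃ w : ι → ℝ, (∀ i, 0 ≤ w i) ∧ ∑ i, w i = 1 ∧ ∑ i, w i • f i = x := by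
  let L : (ι → ℝ) →ₗ[ℝ] V := Fintype.linearCombination ℝ f
  have hconv : Convex ℝ (L '' stdSimplex ℝ ι) := (convex_stdSimplex ℝ ι).linear_image L
  have hsub : Set.range f ⊆ L '' stdSimplex ℝ ι := by
    rintro _ ⟨i, rfl⟩
    refine ⟨Pi.single i 1, single_mem_stdSimplex ℝ i, ?_⟩
    simp [L, Fintype.linearCombination_apply_single]
  obtain ⟨w, hw, rfl⟩ := convexHull_min hsub hconv hx
  exact ⟨w, hw.1, hw.2, by simp [L, Fintype.linearCombination_apply]⟩

/-- The Sarkaria vectors. -/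
def sark {E : Type*} [AddCommGroup E] {k : ℕ} (x : E) : Option (Fin k) → (Fin k → E)
  | none => fun _ => -x
  | some j => Pi.single j x

lemma sark_sum {E : Type*} [AddCommGroup E] {k : ℕ} (x : E) :
    ∑ c : Option (Fin k), sark x c = 0 := by
  rw [Fintype.sum_option]
  ext j
  simp [sark, Finset.sum_apply, Pi.single_apply]

/-- **Tverberg's theorem**. -/
lemma tverberg {E : Type*} [AddCommGroup E] [Module ℝ E] [FiniteDimensional ℝ E] {d : ℕ}
    (hd : Module.finrank ℝ E = d) (k : ℕ) (X : Finset E) (hX : k * (d + 1) + 1 ≤ X.card) :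
    ∃ (col : E → Option (Fin k)) (p : E), ∀ c,
      p ∈ convexHull ℝ ((X.filter (fun x => col x = c) : Finset E) : Set E) := by
  set N := k * (d + 1) with hN
  have hfin : Module.finrank ℝ (Fin k → E × ℝ) = N := by
    rw [Module.finrank_pi_fintype]
    simp [hd, hN]
  -- an enumeration
  have hcard : Fintype.card (Option (Fin N)) ≤ Fintype.card X := by simpa using hX
  obtain ⟨g⟩ := Function.Embedding.nonempty_of_card_le hcard
  let h : Option (Fin N) → E × ℝ := fun o => ((g o : E), 1)
  obtain ⟨s, hs, h0⟩ := colorful_gen hfin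
    (fun i => Finset.univ.image (sark (k := k) (h (some i)))) (sark (h none) none) (by
      intro i
      have hconv := convex_convexHull ℝ
        ((Finset.univ.image (sark (k := k) (h (some i))) : Finset _) : Set (Fin k → E × ℝ))
      have := hconv.sum_mem (t := (Finset.univ : Finset (Option (Fin k))))
        (w := fun _ => (1 / ((k : ℝ) + 1))) (z := sark (h (some i))) ?_ ?_ ?_
      · rwa [← Finset.smul_sum, sark_sum, smul_zero] at this
      · intro _ _; positivity
      · simp
        field_simp
      · intro c _
        apply subset_convexHull
        simp)
  have : ∀ i, ∃ c, sark (h (some i)) c = s i := fun i => by simpa using hs i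
  choose j hj using this
  let J : Option (Fin N) → Option (Fin k) := fun o => o.elim none j
  have hrange : insert (sark (h none) none) (Set.range s) =
      Set.range (fun o => sark (h o) (J o)) := by
    ext y
    constructor
    · rintro (rfl | ⟨i, rfl⟩)
      · exact ⟨none, rfl⟩
      · exact ⟨some i, hj i⟩
    · rintro ⟨_ | i, rfl⟩
      · exact Set.mem_insert _ _
      · exact Set.mem_insert_of_mem _ ⟨i, (hj i).symm⟩
  rw [hrange] at h0
  obtain ⟨w, hw0, hw1, hw⟩ := exists_weights _ _ h0
  -- all the colour sums agree
  let S : Option (Fin k) → E × ℝ := fun c => ∑ o with J o = c, w o • h o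
  have hS : ∀ c, S c = S none := by
    rintro (_ | c)
    · rfl
    have hc := congrFun hw c
    simp only [Finset.sum_apply, Pi.smul_apply, Pi.zero_apply] at hc
    have : ∀ o, w o • sark (h o) (J o) c =
        (if J o = some c then w o • h o else 0) - (if J o = none then w o • h o else 0) := by
      intro o
      rcases J o with _ | b
      · simp [sark]
      · by_cases hb : b = c
        · subst hb; simp [sark]
        · simp [sark, hb, Ne.symm hb]
    simp only [this, Finset.sum_sub_distrib, ← Finset.sum_filter] at hc
    exact sub_eq_zero.mp hc
  have hS2 : ∀ c, (S c).2 = ∑ o with J o = c, w o := by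
    intro c
    simp [S, h, Prod.snd_sum]
  have hS1 : ∀ c, (S c).1 = ∑ o with J o = c, w o • (g o : E) := by
    intro c
    simp [S, h, Prod.fst_sum]
  have htot : ((k : ℝ) + 1) * (S none).2 = 1 := by
    have : ∑ c, (S c).2 = 1 := by
      simp only [hS2]
      rw [← hw1]
      exact Finset.sum_fiberwise _ _ _
    simp only [hS, Finset.sum_const, Finset.card_univ, Fintype.card_option, Fintype.card_fin,
      nsmul_eq_mul] at this
    push_cast at this
    exact this
  let col : E → Option (Fin k) := fun x => if hx : ∃ o, (g o : E) = x then J hx.choose else none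
  have hcol : ∀ o, col (g o) = J o := by
    intro o
    have hx : ∃ o', (g o' : E) = g o := ⟨o, rfl⟩
    simp only [col, dif_pos hx]
    congr 1
    exact g.injective (Subtype.ext hx.choose_spec)
  refine ⟨col, ((k : ℝ) + 1) • (S none).1, fun c => ?_⟩
  rw [← hS c, hS1, Finset.smul_sum]
  simp only [smul_smul]
  apply (convex_convexHull ℝ _).sum_mem
  · intro o _
    have := hw0 o
    positivity
  · rw [← Finset.mul_sum, ← hS2, hS c, htot]
  · intro o ho
    apply subset_convexHull
    simp only [Finset.mem_filter, Finset.mem_univ, true_and] at ho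
    simp [hcol, ho]


lemma arith (e r n : ℕ) (hr : (e + 3) ^ (e + 2) ≤ r) (hn : n ≤ r * (e + 3)) :
    (n - 1).choose (e + 2) ≤
      (e + 3) ^ (e + 2) * (r.choose (e + 2) + (r - 2) * (r - 1).choose e) := by
  have hr2 : (e + 3) ^ 2 ≤ r := le_trans (Nat.pow_le_pow_right (by omega) (by omega)) hr
  obtain ⟨t, rfl⟩ : ∃ t, r = t + e + 2 := ⟨r - (e + 2), by nlinarith [Nat.sub_add_cancel (show e + 2 ≤ r by nlinarith)]⟩
  set R := t + e + 2 with hR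
  have hkey : R ^ (e + 2) ≤
      (e + 2).factorial * (R.choose (e + 2) + (R - 2) * (R - 1).choose e) := by
    have h1 : (e + 2).factorial * R.choose (e + 2) =
        R * (t + 1) * (R - 1).descFactorial e := by
      rw [← Nat.descFactorial_eq_factorial_mul_choose, hR,
        show t + e + 2 = (t + e + 1) + 1 from rfl, Nat.succ_descFactorial_succ,
        Nat.descFactorial_succ, show t + e + 1 - e = t + 1 by omega]
      simp only [Nat.add_sub_cancel]
      ring
    have h2 : (e + 2).factorial * (R - 1).choose e =
        (e + 2) * (e + 1) * (R - 1).descFactorial e := by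
      rw [Nat.descFactorial_eq_factorial_mul_choose, Nat.factorial_succ, Nat.factorial_succ]
      ring
    have h3 : (t + 2) ^ e ≤ (R - 1).descFactorial e := by
      have := Nat.pow_sub_le_descFactorial (R - 1) e
      rwa [show R - 1 + 1 - e = t + 2 by omega] at this
    have h4 : (R : ℝ) ^ e * (R - e ^ 2) ≤ R * (t + 2 : ℝ) ^ e := by
      have hRpos : (0 : ℝ) < R := by positivity
      have hb := one_add_mul_le_pow (a := -(e / R : ℝ)) (by
        have : (e : ℝ) / R ≤ 1 := by
          rw [div_le_one hRpos]; rw [hR]; push_cast; linarith [(Nat.cast_nonneg t : (0:ℝ) ≤ t)]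
        linarith) e
      have hb2 : (R : ℝ) * (1 + e * -(e / R : ℝ)) = R - e ^ 2 := by
        field_simp
        ring
      have hb3 : (R : ℝ) ^ e * (1 + -(e / R : ℝ)) ^ e = (t + 2 : ℝ) ^ e := by
        rw [← mul_pow]
        congr 1
        field_simp
        rw [hR]; push_cast; ring
      rw [← hb2, ← hb3]
      have : 0 < (R : ℝ) ^ e := by positivity
      calc (R : ℝ) ^ e * (R * (1 + e * -(e / R : ℝ)))
          = R * ((R : ℝ) ^ e * (1 + e * -(e / R : ℝ))) := by ring
        _ ≤ _ := by gcongr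
    have h5 : (R : ℝ) ^ 3 ≤ (R - e ^ 2) * (R * (t + 1) + (e + 2) * (e + 1) * (R - 2)) := by
      have ht : (t : ℝ) = R - e - 2 := by rw [hR]; push_cast; ring
      rw [ht]
      have hbig : ((e : ℝ) ^ 2 * (e + 1) ^ 2 + 2 * (e + 1) * (e + 2)) ≤ R * (2 * e + 1) := by
        rcases Nat.eq_zero_or_pos e with he | he
        · subst he
          have : (9 : ℝ) ≤ R := by exact_mod_cast hr2
          simp; linarith
        · have h33 : (e + 3) ^ 3 ≤ R := le_trans (Nat.pow_le_pow_right (by omega) (by omega)) hr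
          have h33' : ((e : ℝ) + 3) ^ 3 ≤ R := by exact_mod_cast h33
          have he0 : (0 : ℝ) ≤ e := Nat.cast_nonneg e
          calc _ ≤ ((e : ℝ) + 3) ^ 3 * (2 * e + 1) := by
                have : 0 ≤ (e:ℝ)^4 ∧ 0 ≤ (e:ℝ)^3 ∧ 0 ≤ (e:ℝ)^2 := ⟨by positivity, by positivity, by positivity⟩
                nlinarith
            _ ≤ _ := by gcongr
      have hRpos : (0 : ℝ) ≤ R := Nat.cast_nonneg _
      have he0 : (0 : ℝ) ≤ e := Nat.cast_nonneg e
      have hx := mul_le_mul_of_nonneg_left hbig hRpos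
      have hy : 0 ≤ (e : ℝ) ^ 2 * (2 * (e + 1) * (e + 2)) := by positivity
      nlinarith
    have h6 : R ^ (e + 2) ≤ (t + 2) ^ e * (R * (t + 1) + (e + 2) * (e + 1) * (R - 2)) := by
      have hcast : ((R - 2 : ℕ) : ℝ) = R - 2 := by
        rw [Nat.cast_sub (by omega)]; norm_num
      have hRpos : (0 : ℝ) < R := by positivity
      have hR2 : (0 : ℝ) ≤ R - 2 := by rw [← hcast]; positivity
      have : (R : ℝ) ^ (e + 2) ≤ (t + 2 : ℝ) ^ e * (R * (t + 1) + (e + 2) * (e + 1) * (R - 2)) := by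
        have hQ : (0 : ℝ) ≤ R * (t + 1) + (e + 2) * (e + 1) * (R - 2) := by positivity
        have ha := mul_le_mul_of_nonneg_right h4 hQ
        have hb := mul_le_mul_of_nonneg_left h5 (show (0 : ℝ) ≤ (R : ℝ) ^ e by positivity)
        refine le_of_mul_le_mul_left ?_ hRpos
        calc (R : ℝ) * R ^ (e + 2) = R ^ e * R ^ 3 := by ring
          _ ≤ _ := hb
          _ = (R : ℝ) ^ e * (R - e ^ 2) * (R * (t + 1) + (e + 2) * (e + 1) * (R - 2)) := by ring
          _ ≤ _ := ha
          _ = _ := by ring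
      rw [← hcast] at this
      exact_mod_cast this
    calc R ^ (e + 2) ≤ _ := h6
      _ ≤ (R - 1).descFactorial e * (R * (t + 1) + (e + 2) * (e + 1) * (R - 2)) := by gcongr
      _ = (e + 2).factorial * R.choose (e + 2) +
          (R - 2) * ((e + 2).factorial * (R - 1).choose e) := by rw [h1, h2]; ring
      _ = _ := by ring
  refine le_of_mul_le_mul_left ?_ (Nat.factorial_pos (e + 2))
  rw [← Nat.descFactorial_eq_factorial_mul_choose]
  calc (n - 1).descFactorial (e + 2) ≤ (n - 1) ^ (e + 2) := Nat.descFactorial_le_pow _ _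
    _ ≤ (R * (e + 3)) ^ (e + 2) := by gcongr; omega
    _ = (e + 3) ^ (e + 2) * R ^ (e + 2) := by rw [mul_pow]; ring
    _ ≤ _ := Nat.mul_le_mul_left _ hkey
    _ = _ := by ring

lemma exists_fun_of_multiset {γ : Type*} (M : Multiset γ) {d : ℕ} (hM : Multiset.card M = d) :
    ∃ f : Fin d → γ, (Finset.univ : Finset (Fin d)).val.map f = M := by
  obtain ⟨l, rfl⟩ : ∃ l : List γ, (l : Multiset γ) = M := ⟨M.toList, M.coe_toList⟩
  rw [Multiset.coe_card] at hM
  subst hM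
  refine ⟨l.get, ?_⟩
  rw [Fin.univ_val_map]
  simp

/-- A simplex through `q` containing `p` with a prescribed colour profile. -/
lemma exists_profile {d : ℕ} {γ : Type*} [Fintype γ] [DecidableEq γ]
    (X : Finset (EuclideanSpace ℝ (Fin d)))
    (col : EuclideanSpace ℝ (Fin d) → γ) (p : EuclideanSpace ℝ (Fin d))
    (hp : ∀ c, p ∈ convexHull ℝ
      ((X.filter (fun x => col x = c) : Finset _) : Set (EuclideanSpace ℝ (Fin d))))
    (q : EuclideanSpace ℝ (Fin d)) (hq : q ∈ X) (M : Multiset γ) (hM : Multiset.card M = d)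
    (hle : ∀ c, (col q ::ₘ M).count c ≤ (X.filter (fun x => col x = c)).card) :
    ∃ Y ∈ X.powersetCard (d + 1), q ∈ Y ∧
      p ∈ convexHull ℝ (Y : Set (EuclideanSpace ℝ (Fin d))) ∧ Y.val.map col = col q ::ₘ M := by
  obtain ⟨f, hf⟩ := exists_fun_of_multiset M hM
  obtain ⟨s, hs, h0⟩ := colorful_gen (V := EuclideanSpace ℝ (Fin d)) (by simp)
    (fun i => (X.filter (fun x => col x = f i)).image (fun x => -p + x)) (-p + q) (by
      intro i
      rw [Finset.coe_image]
      have := convexHull_vadd (𝕜 := ℝ) (-p)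
        ((X.filter (fun x => col x = f i) : Finset _) : Set (EuclideanSpace ℝ (Fin d)))
      have h2 : (-p +ᵥ p : EuclideanSpace ℝ (Fin d)) ∈ -p +ᵥ convexHull ℝ
        ((X.filter (fun x => col x = f i) : Finset _) : Set (EuclideanSpace ℝ (Fin d))) :=
          Set.vadd_mem_vadd_set (hp (f i))
      rw [← this] at h2
      simpa [← Set.image_vadd] using h2)
  have : ∀ i, ∃ x, (x ∈ X ∧ col x = f i) ∧ -p + x = s i := fun i => by
    obtain ⟨x, hx, hx'⟩ := Finset.mem_image.mp (hs i)
    exact ⟨x, Finset.mem_filter.mp hx, hx'⟩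
  choose u hu hu' using this
  let Z : Finset (EuclideanSpace ℝ (Fin d)) := insert q (Finset.univ.image u)
  have hZX : Z ⊆ X := by
    intro x hx
    rcases Finset.mem_insert.mp hx with rfl | hx
    · exact hq
    · obtain ⟨i, _, rfl⟩ := Finset.mem_image.mp hx
      exact (hu i).1
  have hpZ : p ∈ convexHull ℝ (Z : Set (EuclideanSpace ℝ (Fin d))) := by
    have himg : insert (-p + q) (Set.range s) = -p +ᵥ (Z : Set (EuclideanSpace ℝ (Fin d))) := by
      simp only [Z, Finset.coe_insert, Finset.coe_image, Finset.coe_univ, Set.image_univ,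
        ← Set.image_vadd, Set.image_insert_eq, ← Set.range_comp]
      congr 2
      ext1 i
      exact (hu' i).symm
    rw [himg, convexHull_vadd] at h0
    obtain ⟨y, hy, hy0⟩ := h0
    have : y = p := by
      have h3 : -p + y = 0 := hy0
      exact (neg_add_eq_zero.mp h3).symm
    rwa [this] at hy
  have hcount : ∀ c, (Z.filter (fun x => col x = c)).card ≤ (col q ::ₘ M).count c := by
    intro c
    rw [← hf, Multiset.count_cons, Multiset.count_map]
    have hsub : Z.filter (fun x => col x = c) ⊆
        (if c = col q then {q} else ∅) ∪ (Finset.univ.filter (fun i => c = f i)).image u := by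
      intro x hx
      obtain ⟨hx, hxc⟩ := Finset.mem_filter.mp hx
      rcases Finset.mem_insert.mp hx with rfl | hx
      · simp [hxc]
      · obtain ⟨i, _, rfl⟩ := Finset.mem_image.mp hx
        apply Finset.mem_union_right
        apply Finset.mem_image_of_mem
        simp [← hxc, (hu i).2]
    refine (Finset.card_le_card hsub).trans ((Finset.card_union_le _ _).trans ?_)
    rw [add_comm]
    apply add_le_add
    · exact Finset.card_image_le
    · split_ifs <;> simp
  have hex : ∀ c, ∃ W, Z.filter (fun x => col x = c) ⊆ W ∧ W ⊆ X.filter (fun x => col x = c) ∧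
      W.card = (col q ::ₘ M).count c := fun c =>
    Finset.exists_subsuperset_card_eq (Finset.filter_subset_filter _ hZX) (hcount c) (hle c)
  choose W hZW hWX hWc using hex
  let Y : Finset (EuclideanSpace ℝ (Fin d)) := Finset.univ.biUnion W
  have hYc : ∀ c, Y.filter (fun x => col x = c) = W c := by
    intro c
    ext x
    simp only [Y, Finset.mem_filter, Finset.mem_biUnion, Finset.mem_univ, true_and]
    constructor
    · rintro ⟨⟨c', hx⟩, hxc⟩
      have := (Finset.mem_filter.mp (hWX c' hx)).2
      rw [← hxc, this]
      exact hx
    · intro hx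
      exact ⟨⟨c, hx⟩, (Finset.mem_filter.mp (hWX c hx)).2⟩
  have hprof : Y.val.map col = col q ::ₘ M := by
    ext c
    rw [← hWc c, ← hYc c, Multiset.count_map]
    simp only [Finset.card_def, Finset.filter_val]
    congr 1
    apply Multiset.filter_congr
    intro x _
    exact eq_comm
  have hZY : Z ⊆ Y := by
    intro x hx
    simp only [Y, Finset.mem_biUnion, Finset.mem_univ, true_and]
    exact ⟨col x, hZW _ (Finset.mem_filter.mpr ⟨hx, rfl⟩)⟩
  refine ⟨Y, ?_, hZY (Finset.mem_insert_self _ _), ?_, hprof⟩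
  · rw [Finset.mem_powersetCard]
    constructor
    · intro x hx
      simp only [Y, Finset.mem_biUnion, Finset.mem_univ, true_and] at hx
      obtain ⟨c, hx⟩ := hx
      exact (Finset.mem_filter.mp (hWX c hx)).1
    · have := congrArg Multiset.card hprof
      rw [Multiset.card_map, Multiset.card_cons, hM] at this
      exact this
  · exact convexHull_mono (by exact_mod_cast hZY) hpZ

/-- Counting profiles bounds the number of good simplices through `q`. -/
lemma card_profiles_le {d : ℕ} {γ : Type*} [Fintype γ] [DecidableEq γ]
    (X : Finset (EuclideanSpace ℝ (Fin d)))
    (col : EuclideanSpace ℝ (Fin d) → γ) (p : EuclideanSpace ℝ (Fin d))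
    (hp : ∀ c, p ∈ convexHull ℝ
      ((X.filter (fun x => col x = c) : Finset _) : Set (EuclideanSpace ℝ (Fin d))))
    (q : EuclideanSpace ℝ (Fin d)) (hq : q ∈ X) (K : Finset (Multiset γ))
    (hK : ∀ M ∈ K, Multiset.card M = d ∧
      ∀ c, (col q ::ₘ M).count c ≤ (X.filter (fun x => col x = c)).card) :
    K.card ≤ (((X.powersetCard (d + 1)).filter
          (fun Y : Finset (EuclideanSpace ℝ (Fin d)) => p ∈ convexHull ℝ (Y : Set (EuclideanSpace ℝ (Fin d))))).filter
            (fun Y => q ∈ Y)).card := by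
  have : ∀ M : Multiset γ, ∃ Y, M ∈ K → (Y ∈ X.powersetCard (d + 1) ∧ q ∈ Y ∧
      p ∈ convexHull ℝ (Y : Set (EuclideanSpace ℝ (Fin d))) ∧ Y.val.map col = col q ::ₘ M) := by
    intro M
    by_cases h : M ∈ K
    · obtain ⟨Y, h1, h2⟩ := exists_profile X col p hp q hq M (hK M h).1 (hK M h).2
      exact ⟨Y, fun _ => ⟨h1, h2⟩⟩
    · exact ⟨∅, fun h' => absurd h' h⟩
  choose F hF using this
  apply Finset.card_le_card_of_injOn F
  · intro M hM
    obtain ⟨h1, h2, h3, _⟩ := hF M hM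
    exact Finset.mem_coe.mpr (Finset.mem_filter.mpr ⟨Finset.mem_filter.mpr ⟨h1, h3⟩, h2⟩)
  · intro M hM M' hM' h
    have h1 := (hF M hM).2.2.2
    have h2 := (hF M' hM').2.2.2
    rw [h, h2] at h1
    exact ((Multiset.cons_inj_right _).mp h1).symm

/-- Number of simplices containing a point of `X`. -/
lemma card_through {α : Type*} [DecidableEq α] (X : Finset α) (q : α) (hq : q ∈ X) (d : ℕ) :
    ((X.powersetCard (d + 1)).filter (fun Y => q ∈ Y)).card = (X.card - 1).choose d := by
  rw [← Finset.card_erase_of_mem hq, ← Finset.card_powersetCard]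
  symm
  apply Finset.card_bij (fun Y _ => insert q Y)
  · intro Y hY
    obtain ⟨h1, h2⟩ := Finset.mem_powersetCard.mp hY
    have hqY : q ∉ Y := fun h => Finset.notMem_erase q X (h1 h)
    simp only [Finset.mem_filter, Finset.mem_powersetCard, Finset.mem_insert_self, and_true]
    refine ⟨Finset.insert_subset hq (h1.trans (Finset.erase_subset _ _)), ?_⟩
    rw [Finset.card_insert_of_notMem hqY, h2]
  · intro Y hY Y' hY' h
    have h1 : q ∉ Y := fun h => Finset.notMem_erase q X ((Finset.mem_powersetCard.mp hY).1 h)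
    have h2 : q ∉ Y' := fun h => Finset.notMem_erase q X ((Finset.mem_powersetCard.mp hY').1 h)
    rw [← Finset.erase_insert h1, h, Finset.erase_insert h2]
  · intro Y hY
    simp only [Finset.mem_filter, Finset.mem_powersetCard] at hY
    refine ⟨Y.erase q, ?_, Finset.insert_erase hY.2⟩
    rw [Finset.mem_powersetCard]
    refine ⟨Finset.erase_subset_erase _ hY.1.1, ?_⟩
    rw [Finset.card_erase_of_mem hY.2, hY.1.2]
    rfl

/-- Enough profiles, dimension at least two. -/
lemma card_profile_family {γ : Type*} [Fintype γ] [DecidableEq γ] (e : ℕ) (sz : γ → ℕ) (c₀ : γ)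
    (h1 : ∀ c, 1 ≤ sz c) (h0 : 2 ≤ sz c₀) (hone : ∀ c c', sz c = 1 → sz c' = 1 → c = c') :
    ∃ K : Finset (Multiset γ), (∀ M ∈ K, Multiset.card M = e + 2 ∧
      ∀ c, (c₀ ::ₘ M).count c ≤ sz c) ∧
      (Fintype.card γ).choose (e + 2) + (Fintype.card γ - 2) * (Fintype.card γ - 1).choose e
        ≤ K.card := by
  let D : Finset γ := Finset.univ.filter (fun c => 2 ≤ sz c ∧ c ≠ c₀)
  have hD : Fintype.card γ - 2 ≤ D.card := by
    have hc : Dᶜ.card ≤ 2 := by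
      have : Dᶜ ⊆ insert c₀ (Finset.univ.filter (fun c => sz c = 1)) := by
        intro c hc
        simp only [D, Finset.mem_compl, Finset.mem_filter, Finset.mem_univ, true_and,
          not_and_or, not_not, not_le] at hc
        simp only [Finset.mem_insert, Finset.mem_filter, Finset.mem_univ, true_and]
        rcases hc with hc | hc
        · right; have := h1 c; omega
        · left; exact hc
      refine (Finset.card_le_card this).trans ((Finset.card_insert_le _ _).trans ?_)
      have : (Finset.univ.filter (fun c => sz c = 1)).card ≤ 1 := by
        rw [Finset.card_le_one]
        intro a ha b hb
        exact hone a b (Finset.mem_filter.mp ha).2 (Finset.mem_filter.mp hb).2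
      omega
    have := Finset.card_compl_add_card D
    omega
  let K1 : Finset (Multiset γ) := (Finset.powersetCard (e + 2) Finset.univ).image Finset.val
  let T : Finset (Σ _ : γ, Finset γ) := D.sigma (fun c => Finset.powersetCard e (Finset.univ.erase c))
  let F : (Σ _ : γ, Finset γ) → Multiset γ := fun x => x.1 ::ₘ x.1 ::ₘ x.2.val
  have hT : ∀ x ∈ T, (2 ≤ sz x.1 ∧ x.1 ≠ c₀) ∧ x.1 ∉ x.2 ∧ x.2.card = e := by
    intro x hx
    simp only [T, D, Finset.mem_sigma, Finset.mem_filter, Finset.mem_univ, true_and,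
      Finset.mem_powersetCard] at hx
    exact ⟨hx.1, fun h => Finset.notMem_erase _ _ (hx.2.1 h), hx.2.2⟩
  have hcnt : ∀ (S : Finset γ) (c : γ), S.val.count c = if c ∈ S then 1 else 0 := by
    intro S c
    rw [Multiset.count_eq_of_nodup S.nodup]
    rfl
  have hFcnt : ∀ x ∈ T, ∀ c, 2 ≤ (F x).count c ↔ c = x.1 := by
    intro x hx c
    have := (hT x hx).2.1
    simp only [F, Multiset.count_cons, hcnt]
    by_cases h : c = x.1
    · subst h; simp
    · simp only [h, if_false, iff_false]
      split_ifs <;> omega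
  have hK1card : K1.card = (Fintype.card γ).choose (e + 2) := by
    rw [Finset.card_image_of_injective _ Finset.val_injective, Finset.card_powersetCard,
      Finset.card_univ]
  have hFinj : Set.InjOn F T := by
    rintro ⟨a, A⟩ hx ⟨b, B⟩ hy hxy
    have hab : a = b := by
      have h3 := (hFcnt _ hx a).mpr rfl
      rw [hxy] at h3
      exact (hFcnt _ hy a).mp h3
    subst hab
    simp only [F, Multiset.cons_inj_right] at hxy
    rw [Finset.val_injective hxy]
  have hK2card : (T.image F).card = D.card * (Fintype.card γ - 1).choose e := by
    rw [Finset.card_image_of_injOn hFinj, Finset.card_sigma]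
    simp [Finset.card_erase_of_mem]
  have hdisj : Disjoint K1 (T.image F) := by
    rw [Finset.disjoint_left]
    intro M h1 h2
    obtain ⟨S, _, rfl⟩ := Finset.mem_image.mp h1
    obtain ⟨x, hx, hxS⟩ := Finset.mem_image.mp h2
    have := (hFcnt x hx x.1).mpr rfl
    rw [hxS, hcnt] at this
    split_ifs at this <;> omega
  refine ⟨K1 ∪ T.image F, ?_, ?_⟩
  · intro M hM
    rcases Finset.mem_union.mp hM with hM | hM
    · obtain ⟨S, hS, rfl⟩ := Finset.mem_image.mp hM
      refine ⟨(Finset.mem_powersetCard.mp hS).2, fun c => ?_⟩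
      rw [Multiset.count_cons, hcnt]
      by_cases h : c = c₀
      · subst h; split_ifs <;> simp at * <;> omega
      · have := h1 c
        simp only [h, if_false]
        split_ifs <;> omega
    · obtain ⟨x, hx, rfl⟩ := Finset.mem_image.mp hM
      obtain ⟨⟨hx1, hx2⟩, hx3, hx4⟩ := hT x hx
      refine ⟨by simp [F, hx4], fun c => ?_⟩
      simp only [F, Multiset.count_cons, hcnt]
      by_cases h : c = x.1
      · subst h
        simp [hx3, hx2, hx1]
      · by_cases h' : c = c₀
        · subst h'
          simp only [h, if_false, if_true]
          split_ifs <;> omega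
        · have := h1 c
          simp only [h, h', if_false]
          split_ifs <;> omega
  · rw [Finset.card_union_of_disjoint hdisj, hK1card, hK2card]
    gcongr

/-- Averaging over the vertices. -/
lemma covering_of_local {d : ℕ} (X : Finset (EuclideanSpace ℝ (Fin d))) (hX : d + 1 ≤ X.card)
    (p : EuclideanSpace ℝ (Fin d))
    (h : ∀ q ∈ X, (X.card - 1).choose d ≤ (d + 1) ^ d *
      (((X.powersetCard (d + 1)).filter
          (fun Y : Finset (EuclideanSpace ℝ (Fin d)) => p ∈ convexHull ℝ (Y : Set (EuclideanSpace ℝ (Fin d))))).filter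
            (fun Y => q ∈ Y)).card) :
    X.card.choose (d + 1) ≤ (d + 1) ^ d * ((X.powersetCard (d + 1)).filter
          (fun Y : Finset (EuclideanSpace ℝ (Fin d)) => p ∈ convexHull ℝ (Y : Set (EuclideanSpace ℝ (Fin d))))).card := by
  set G := (X.powersetCard (d + 1)).filter
          (fun Y : Finset (EuclideanSpace ℝ (Fin d)) => p ∈ convexHull ℝ (Y : Set (EuclideanSpace ℝ (Fin d)))) with hG
  have hdc : ∑ q ∈ X, (G.filter (fun Y => q ∈ Y)).card = (d + 1) * G.card := by
    have h1 := Finset.sum_card_bipartiteAbove_eq_sum_card_bipartiteBelow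
      (s := X) (t := G) (fun q Y => q ∈ Y)
    simp only [Finset.bipartiteAbove, Finset.bipartiteBelow] at h1
    rw [h1]
    have : ∀ Y ∈ G, (X.filter (fun q => q ∈ Y)).card = d + 1 := by
      intro Y hY
      obtain ⟨h2, h3⟩ := Finset.mem_powersetCard.mp (Finset.mem_filter.mp hY).1
      rw [Finset.filter_mem_eq_inter, Finset.inter_eq_right.mpr h2, h3]
    rw [Finset.sum_congr rfl this, Finset.sum_const, smul_eq_mul, mul_comm]
  have hsum := Finset.sum_le_sum h
  rw [← Finset.mul_sum, hdc, Finset.sum_const, smul_eq_mul] at hsum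
  have hch : X.card * (X.card - 1).choose d = X.card.choose (d + 1) * (d + 1) := by
    have := Nat.add_one_mul_choose_eq (X.card - 1) d
    rwa [Nat.sub_add_cancel (by omega)] at this
  rw [hch] at hsum
  refine le_of_mul_le_mul_right ?_ (Nat.succ_pos d)
  calc _ ≤ _ := hsum
    _ = _ := by rw [Nat.succ_eq_add_one]; ring

lemma covering_nat (d : ℕ) (hd : 1 ≤ d)
    (X : Finset (EuclideanSpace ℝ (Fin d))) (hX : d + 1 ≤ X.card) :
    ∃ p : EuclideanSpace ℝ (Fin d),
      X.card.choose (d + 1) ≤ (d + 1) ^ d * ((X.powersetCard (d + 1)).filter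
          (fun Y : Finset (EuclideanSpace ℝ (Fin d)) => p ∈ convexHull ℝ (Y : Set (EuclideanSpace ℝ (Fin d))))).card := by
  have hmem : ∀ q ∈ X, (X.card - 1).choose d ≤
      (((X.powersetCard (d + 1)).filter
          (fun Y : Finset (EuclideanSpace ℝ (Fin d)) => q ∈ convexHull ℝ (Y : Set (EuclideanSpace ℝ (Fin d))))).filter
            (fun Y => q ∈ Y)).card := by
    intro q hq
    rw [← card_through X q hq d]
    apply Finset.card_le_card
    intro Y hY
    obtain ⟨h1, h2⟩ := Finset.mem_filter.mp hY
    exact Finset.mem_filter.mpr ⟨Finset.mem_filter.mpr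
      ⟨h1, subset_convexHull _ _ (by exact_mod_cast h2)⟩, h2⟩
  by_cases hsmall : X.card ≤ (d + 1) ^ (d + 1)
  · -- few points: take a point of `X`
    obtain ⟨q, hq⟩ : X.Nonempty := Finset.card_pos.mp (by omega)
    refine ⟨q, ?_⟩
    have h1 := (hmem q hq).trans (Finset.card_filter_le _ _)
    have hch : X.card * (X.card - 1).choose d = X.card.choose (d + 1) * (d + 1) := by
      have := Nat.add_one_mul_choose_eq (X.card - 1) d
      rwa [Nat.sub_add_cancel (by omega)] at this
    refine le_trans ?_ (Nat.mul_le_mul_left _ h1)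
    refine le_of_mul_le_mul_right ?_ (Nat.succ_pos d)
    calc _ = X.card * (X.card - 1).choose d := hch.symm
      _ ≤ (d + 1) ^ (d + 1) * (X.card - 1).choose d := by gcongr
      _ = _ := by rw [Nat.succ_eq_add_one]; ring
  · push Not at hsmall
    set n := X.card with hn
    set k := (n - 1) / (d + 1) with hk
    have hk1 : k * (d + 1) ≤ n - 1 := Nat.div_mul_le_self _ _
    have hk2 : n - 1 < (k + 1) * (d + 1) := by
      have := Nat.lt_div_mul_add (a := n - 1) (b := d + 1) (by omega)
      rw [add_mul, one_mul]
      exact this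
    obtain ⟨col, p, hp⟩ := tverberg (d := d) (by simp) k X (by omega)
    refine ⟨p, covering_of_local X hX p ?_⟩
    intro q hq
    by_cases hpq : q = p
    · subst hpq
      exact (hmem q hq).trans (Nat.le_mul_of_pos_left _ (by positivity))
    let sz : Option (Fin k) → ℕ := fun c => (X.filter (fun x => col x = c)).card
    have h1 : ∀ c, 1 ≤ sz c := by
      intro c
      have := convexHull_nonempty_iff.mp ⟨_, hp c⟩
      exact Finset.card_pos.mpr (by exact_mod_cast this)
    have hsz1 : ∀ c, sz c = 1 → X.filter (fun x => col x = c) = {p} := by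
      intro c hc
      obtain ⟨x, hx⟩ := Finset.card_eq_one.mp hc
      have := hp c
      rw [hx] at this
      simp at this
      rw [hx, this]
    have h0 : 2 ≤ sz (col q) := by
      by_contra hcon
      have h2 := hsz1 (col q) (by have := h1 (col q); omega)
      have : q ∈ X.filter (fun x => col x = col q) := by simp [hq]
      rw [h2] at this
      exact hpq (by simpa using this)
    have hone : ∀ c c', sz c = 1 → sz c' = 1 → c = c' := by
      intro c c' hc hc'
      have e1 : p ∈ X.filter (fun x => col x = c) := by rw [hsz1 c hc]; simp
      have e2 : p ∈ X.filter (fun x => col x = c') := by rw [hsz1 c' hc']; simp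
      rw [← (Finset.mem_filter.mp e1).2, ← (Finset.mem_filter.mp e2).2]
    obtain hd1 | ⟨e, rfl⟩ : d = 1 ∨ ∃ e, d = e + 2 := by
      rcases d with _ | _ | e
      · omega
      · left; rfl
      · right; exact ⟨e, rfl⟩
    · subst hd1
      let K : Finset (Multiset (Option (Fin k))) := Finset.univ.image (fun c => {c})
      have hKc : K.card = k + 1 := by
        rw [Finset.card_image_of_injective _ (fun a b h => Multiset.singleton_inj.mp h)]
        simp
      have := card_profiles_le X col p hp q hq K (by
        intro M hM
        obtain ⟨c', _, rfl⟩ := Finset.mem_image.mp hM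
        refine ⟨by simp, fun c => ?_⟩
        rw [Multiset.count_cons, Multiset.count_singleton]
        change _ ≤ sz c
        have := h1 c
        by_cases h : c = col q
        · subst h; split_ifs <;> omega
        · simp only [h, if_false]
          split_ifs <;> omega)
      rw [hKc] at this
      simp only [Nat.choose_one_right]
      omega
    · obtain ⟨K, hK, hKc⟩ := card_profile_family e sz (col q) h1 h0 hone
      have hle := card_profiles_le X col p hp q hq K hK
      simp only [Fintype.card_option, Fintype.card_fin] at hKc
      have hr : (e + 3) ^ (e + 2) ≤ k + 1 := by
        have : (e + 3) ^ (e + 2) * (e + 3) ≤ (k + 1) * (e + 3) := by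
          rw [← pow_succ]
          have h3 : (e + 3) ^ (e + 2 + 1) < n := hsmall
          have h4 : n - 1 < (k + 1) * (e + 3) := hk2
          omega
        exact le_of_mul_le_mul_right this (by omega)
      have har := arith e (k + 1) n hr (by
        have h4 : n - 1 < (k + 1) * (e + 3) := hk2
        omega)
      exact har.trans (Nat.mul_le_mul_left _ (hKc.trans hle))

/-- **The covering number theorem** (first selection lemma). For every set `X` of
`n ≥ d+1` points in `ℝ^d` there is a point contained in at least
`(1/(d+1)^d) · C(n, d+1)` of the simplices spanned by `(d+1)`-element subsets of `X`. -/
theorem covering_number (d : ℕ) (hd : 1 ≤ d)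
    (X : Finset (EuclideanSpace ℝ (Fin d))) (hX : d + 1 ≤ X.card) :
    ∃ p : EuclideanSpace ℝ (Fin d),
      (1 / ((d : ℝ) + 1) ^ d) * (X.card.choose (d + 1) : ℝ) ≤
        (((X.powersetCard (d + 1)).filter
          (fun Y => p ∈ convexHull ℝ (Y : Set (EuclideanSpace ℝ (Fin d))))).card : ℝ) := by
  obtain ⟨p, hp⟩ := covering_nat d hd X hX
  refine ⟨p, ?_⟩
  rw [one_div, inv_mul_le_iff₀ (by positivity)]
  have h : (X.card.choose (d + 1) : ℝ) ≤ ((d : ℝ) + 1) ^ d *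
      (((X.powersetCard (d + 1)).filter
          (fun Y : Finset (EuclideanSpace ℝ (Fin d)) =>
            p ∈ convexHull ℝ (Y : Set (EuclideanSpace ℝ (Fin d))))).card : ℝ) := by
    exact_mod_cast hp
  refine h.trans ?_
  gcongr ?_ * ?_
  rw [Nat.cast_le]
  apply Finset.card_le_card_of_injOn
    (fun Y : Finset (EuclideanSpace ℝ (Fin d)) => (Y : Set (EuclideanSpace ℝ (Fin d))))
  · intro Y hY
    obtain ⟨h1, h2⟩ := Finset.mem_filter.mp (Finset.mem_coe.mp hY)
    refine Finset.mem_coe.mpr (Finset.mem_filter.mpr ⟨?_, h2⟩)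
    exact Finset.mem_sup.mpr ⟨Y, h1, Finset.mem_singleton.mpr rfl⟩
  · exact Finset.coe_injective.injOn
end

section
/- For every d ≥ 1 there is a constant c(d) > 0 with the following property: if C_1, ..., C_{d+1} are finite sets in ℝ^d, each of size n, then there exist a point p ∈ ℝ^d and subsets D_i ⊆ C_i for i = 1, ..., d+1, each of size at least c(d)·n, such that for every choice of points x_1 ∈ D_1, x_2 ∈ D_2, ..., x_{d+1} ∈ D_{d+1} the point p lies in conv{x_1, ..., x_{d+1}}. -/
namespace PachAux

open MeasureTheory

theorem det_pos_of_small {d : ℕ} (A : EuclideanSpace ℝ (Fin d) →L[ℝ] EuclideanSpace ℝ (Fin d))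
    (t : ℝ) (ht : 0 ≤ t) (h : t * ‖A‖ < 1) :
    0 < (ContinuousLinearMap.id ℝ _ + t • A).det := by
  have hne : ∀ s ∈ Set.Icc 0 t, (ContinuousLinearMap.id ℝ (EuclideanSpace ℝ (Fin d)) + s • A).det ≠ 0 := by
    intro s hs
    have hu : IsUnit (1 - (-(s • A))) := by
      apply isUnit_one_sub_of_norm_lt_one
      rw [norm_neg, norm_smul, Real.norm_eq_abs, abs_of_nonneg hs.1]
      exact lt_of_le_of_lt (mul_le_mul_of_nonneg_right hs.2 (norm_nonneg _)) h
    rw [sub_neg_eq_add] at hu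
    obtain ⟨u, hu⟩ := hu
    have h1 := u.mul_inv
    have h2 : u.val.det * u⁻¹.val.det = 1 := by
      change LinearMap.det _ * LinearMap.det _ = 1
      rw [← LinearMap.det_comp]
      have h4 := congrArg (fun T : EuclideanSpace ℝ (Fin d) →L[ℝ] EuclideanSpace ℝ (Fin d) =>
        LinearMap.det T.toLinearMap) h1
      exact h4.trans LinearMap.det_id
    intro h3
    change (1 + s • A).det = 0 at h3
    rw [← hu] at h3
    rw [h3, zero_mul] at h2
    exact zero_ne_one h2
  by_contra hcon
  push Not at hcon
  have hc : ContinuousOn (fun s : ℝ => (ContinuousLinearMap.id ℝ (EuclideanSpace ℝ (Fin d)) + s • A).det) (Set.Icc 0 t) := by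
    apply Continuous.continuousOn
    apply ContinuousLinearMap.continuous_det.comp
    fun_prop
  have h0 : (ContinuousLinearMap.id ℝ (EuclideanSpace ℝ (Fin d)) + (0:ℝ) • A).det = 1 := by
    simp [ContinuousLinearMap.det]
  have := intermediate_value_Icc' ht hc
  obtain ⟨s, hs, h⟩ := this (Set.mem_Icc.mpr ⟨hcon, by simp only [h0]; exact zero_le_one⟩)
  exact hne s hs h

theorem change_small {d : ℕ} (G : EuclideanSpace ℝ (Fin d) → EuclideanSpace ℝ (Fin d))
    (hG : ContDiff ℝ 1 G) (r : ℝ) (hr : ∀ y, r < ‖y‖ → G y = 0) (L : NNReal)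
    (hL : LipschitzWith L G) (t : ℝ) (ht : 0 ≤ t) (htL : t * L < 1)
    (ρ : EuclideanSpace ℝ (Fin d) → ℝ) :
    ∫ y in Metric.closedBall 0 r, (ContinuousLinearMap.id ℝ _ + t • fderiv ℝ G y).det * ρ (y + t • G y)
      = ∫ y in Metric.closedBall 0 r, ρ y := by
  have hinj : Function.Injective (fun y => y + t • G y) := by
    intro a b hab
    simp only at hab
    have h1 : a - b = t • (G b - G a) := by
      rw [smul_sub]; rw [sub_eq_sub_iff_add_eq_add]; rw [hab, add_comm]
    have h2 : ‖a - b‖ ≤ t * L * ‖a - b‖ := by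
      conv_lhs => rw [h1, norm_smul, Real.norm_eq_abs, abs_of_nonneg ht]
      rw [mul_assoc]
      apply mul_le_mul_of_nonneg_left _ ht
      have := hL.dist_le_mul b a
      rwa [dist_eq_norm, dist_eq_norm, norm_sub_rev b a] at this
    have h3 : ‖a - b‖ = 0 := by
      nlinarith [norm_nonneg (a-b)]
    exact sub_eq_zero.mp (norm_eq_zero.mp h3)
  have hsurj : ∀ z, ∃ y, y + t • G y = z := by
    intro z
    have : ContractingWith (Real.toNNReal t * L) (fun y => z - t • G y) := by
      constructor
      · rw [← NNReal.coe_lt_coe]; simpa [ht] using htL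
      · apply LipschitzWith.of_dist_le_mul
        intro a b
        have := hL.dist_le_mul a b
        rw [dist_eq_norm] at this ⊢
        have h1 : z - t • G a - (z - t • G b) = -(t • (G a - G b)) := by rw [smul_sub]; abel
        rw [h1, norm_neg, norm_smul, Real.norm_eq_abs, abs_of_nonneg ht]
        simp only [NNReal.coe_mul, Real.coe_toNNReal t ht, mul_assoc]
        exact mul_le_mul_of_nonneg_left this ht
    refine ⟨ContractingWith.fixedPoint _ this, ?_⟩
    have h := this.fixedPoint_isFixedPt
    have h' : z - t • G (ContractingWith.fixedPoint _ this) = ContractingWith.fixedPoint _ this := h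
    exact (sub_eq_iff_eq_add.mp h').symm
  have himg : (fun y => y + t • G y) '' Metric.closedBall 0 r = Metric.closedBall 0 r := by
    ext z
    simp only [Set.mem_image, mem_closedBall_zero_iff]
    constructor
    · rintro ⟨y, hy, rfl⟩
      by_contra hcon
      push Not at hcon
      have h1 := hr _ hcon
      have h2 : (y + t • G y) = y := by
        apply hinj
        simp only [h1, smul_zero, add_zero]
      rw [h2] at hcon
      linarith
    · intro hz
      obtain ⟨y, hy⟩ := hsurj z
      refine ⟨y, ?_, hy⟩
      by_contra hcon
      push Not at hcon
      rw [hr y hcon, smul_zero, add_zero] at hy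
      rw [hy] at hcon
      linarith
  have hd : ∀ y ∈ Metric.closedBall (0 : EuclideanSpace ℝ (Fin d)) r, HasFDerivWithinAt (fun y => y + t • G y)
      (ContinuousLinearMap.id ℝ _ + t • fderiv ℝ G y) (Metric.closedBall 0 r) y := by
    intro y _
    apply HasFDerivAt.hasFDerivWithinAt
    exact (hasFDerivAt_id y).add (((hG.differentiable one_ne_zero) y).hasFDerivAt.const_smul t)
  have key := MeasureTheory.integral_image_eq_integral_abs_det_fderiv_smul volume
    (Metric.isClosed_closedBall.measurableSet) hd hinj.injOn ρ
  rw [himg] at key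
  rw [key]
  congr 1
  ext y
  rw [smul_eq_mul, abs_of_pos]
  apply det_pos_of_small _ _ ht
  refine lt_of_le_of_lt (mul_le_mul_of_nonneg_left ?_ ht) htL
  exact norm_fderiv_le_of_lipschitz ℝ hL

theorem poly_exists {d : ℕ} (A : EuclideanSpace ℝ (Fin d) →L[ℝ] EuclideanSpace ℝ (Fin d))
    (y g : EuclideanSpace ℝ (Fin d)) (K : ℝ) (k : ℕ) :
    ∃ P : Polynomial ℝ, P.natDegree ≤ d + k * 2 ∧ ∀ t : ℝ, P.eval t =
      (ContinuousLinearMap.id ℝ _ + t • A).det * (K ^ 2 - ‖y + t • g‖ ^ 2) ^ k := by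
  classical
  let b := (EuclideanSpace.basisFun (Fin d) ℝ).toBasis
  let M := LinearMap.toMatrix b b (A : EuclideanSpace ℝ (Fin d) →ₗ[ℝ] EuclideanSpace ℝ (Fin d))
  let P1 : Polynomial ℝ := ((Polynomial.X : Polynomial ℝ) • M.map Polynomial.C + (1 : Matrix (Fin d) (Fin d) ℝ).map Polynomial.C).det
  let P2 : Polynomial ℝ := Polynomial.C (-(‖g‖ ^ 2)) * Polynomial.X ^ 2 + Polynomial.C (-(2 * inner ℝ y g)) * Polynomial.X
    + Polynomial.C (K ^ 2 - ‖y‖ ^ 2)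
  refine ⟨P1 * P2 ^ k, ?_, ?_⟩
  · refine Polynomial.natDegree_mul_le.trans (add_le_add ?_ ?_)
    · exact (Polynomial.natDegree_det_X_add_C_le M 1).trans (by simp)
    · exact Polynomial.natDegree_pow_le.trans (Nat.mul_le_mul_left _ Polynomial.natDegree_quadratic_le)
  · intro t
    rw [Polynomial.eval_mul, Polynomial.eval_pow]
    congr 1
    · change Polynomial.evalRingHom t _ = LinearMap.det _
      rw [RingHom.map_det, ← LinearMap.det_toMatrix b]
      congr 1
      ext i j
      simp [M, Matrix.one_apply]
      have : (Polynomial.eval t (if i = j then 1 else 0 : Polynomial ℝ)) = if i = j then 1 else 0 := by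
        split_ifs <;> simp
      linarith
    · congr 1
      simp only [P2, Polynomial.eval_add, Polynomial.eval_mul, Polynomial.eval_C, Polynomial.eval_pow, Polynomial.eval_X]
      rw [norm_add_sq_real, norm_smul, inner_smul_right, Real.norm_eq_abs, mul_pow, sq_abs]
      ring
end PachAux

namespace PachAux

open MeasureTheory

theorem integrand_cont {d : ℕ} (G : EuclideanSpace ℝ (Fin d) → EuclideanSpace ℝ (Fin d))
    (hG : ContDiff ℝ 1 G) (K : ℝ) (k : ℕ) (t : ℝ) :
    Continuous (fun y => (ContinuousLinearMap.id ℝ _ + t • fderiv ℝ G y).det * (K ^ 2 - ‖y + t • G y‖ ^ 2) ^ k) := by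
  have h1 : Continuous (fderiv ℝ G) := hG.continuous_fderiv one_ne_zero
  have h2 : Continuous G := hG.continuous
  have h3 : Continuous (fun y => (ContinuousLinearMap.id ℝ _ + t • fderiv ℝ G y).det) := by
    apply ContinuousLinearMap.continuous_det.comp
    fun_prop
  fun_prop

theorem integral_one {d : ℕ} (G : EuclideanSpace ℝ (Fin d) → EuclideanSpace ℝ (Fin d))
    (hG : ContDiff ℝ 1 G) (r : ℝ) (hr : ∀ y, r < ‖y‖ → G y = 0) (L : NNReal)
    (hL : LipschitzWith L G) (K : ℝ) (k : ℕ) :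
    ∫ y in Metric.closedBall 0 r, (ContinuousLinearMap.id ℝ _ + (1:ℝ) • fderiv ℝ G y).det * (K ^ 2 - ‖y + (1:ℝ) • G y‖ ^ 2) ^ k
      = ∫ y in Metric.closedBall (0 : EuclideanSpace ℝ (Fin d)) r, (K ^ 2 - ‖y‖ ^ 2) ^ k := by
  classical
  set N := d + k * 2 with hN
  let τ : ℝ := 1 / ((L + 1) * (N + 1))
  have hτ : 0 < τ := by positivity
  let v : ℕ → ℝ := fun j => τ * j
  have hvinj : Set.InjOn v (Finset.range (N+1)) := by
    intro a _ b _ hab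
    have := mul_left_cancel₀ hτ.ne' hab
    exact_mod_cast this
  have hv0 : ∀ j, 0 ≤ v j := fun j => by positivity
  have hvL : ∀ j ∈ Finset.range (N+1), v j * L < 1 := by
    intro j hj
    have hj' : (j : ℝ) < N + 1 := by exact_mod_cast Finset.mem_range.mp hj
    have : v j * L = (j * L) / ((L + 1) * (N + 1)) := by simp only [v, τ]; ring
    rw [this, div_lt_one (by positivity)]
    have hL0 : (0:ℝ) ≤ L := L.2
    nlinarith
  let bb : ℕ → ℝ := fun j => (Lagrange.basis (Finset.range (N+1)) v j).eval 1
  have hbb : ∑ j ∈ Finset.range (N+1), bb j = 1 := by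
    have := Lagrange.sum_basis hvinj (by simp)
    have h2 := congrArg (Polynomial.eval (1:ℝ)) this
    rwa [Polynomial.eval_finsetSum, Polynomial.eval_one] at h2
  have hpt : ∀ y, (ContinuousLinearMap.id ℝ _ + (1:ℝ) • fderiv ℝ G y).det * (K ^ 2 - ‖y + (1:ℝ) • G y‖ ^ 2) ^ k
      = ∑ j ∈ Finset.range (N+1), bb j * ((ContinuousLinearMap.id ℝ _ + v j • fderiv ℝ G y).det * (K ^ 2 - ‖y + v j • G y‖ ^ 2) ^ k) := by
    intro y
    obtain ⟨P, hP, hPe⟩ := poly_exists (fderiv ℝ G y) y (G y) K k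
    have hdeg : P.degree < (Finset.range (N+1)).card := by
      rw [Finset.card_range]
      refine lt_of_le_of_lt Polynomial.degree_le_natDegree ?_
      exact_mod_cast Nat.lt_succ_of_le hP
    have h := Lagrange.eq_interpolate hvinj hdeg
    have h2 := congrArg (Polynomial.eval (1:ℝ)) h
    rw [Lagrange.interpolate_apply, Polynomial.eval_finsetSum, hPe] at h2
    rw [h2]
    apply Finset.sum_congr rfl
    intro j _
    rw [Polynomial.eval_mul, Polynomial.eval_C, hPe, mul_comm]
  simp_rw [hpt]
  rw [integral_finsetSum]
  · have : ∀ j ∈ Finset.range (N+1), ∫ y in Metric.closedBall 0 r, bb j * ((ContinuousLinearMap.id ℝ _ + v j • fderiv ℝ G y).det * (K ^ 2 - ‖y + v j • G y‖ ^ 2) ^ k) = bb j * ∫ y in Metric.closedBall (0 : EuclideanSpace ℝ (Fin d)) r, (K ^ 2 - ‖y‖ ^ 2) ^ k := by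
      intro j hj
      rw [integral_const_mul]
      congr 1
      exact change_small G hG r hr L hL (v j) (hv0 j) (hvL j hj) (fun z => (K ^ 2 - ‖z‖ ^ 2) ^ k)
    rw [Finset.sum_congr rfl this, ← Finset.sum_mul, hbb, one_mul]
  · intro j _
    apply Integrable.const_mul
    exact (integrand_cont G hG K k (v j)).continuousOn.integrableOn_compact (isCompact_closedBall _ _)

theorem core_zero {d : ℕ} (G : EuclideanSpace ℝ (Fin d) → EuclideanSpace ℝ (Fin d))
    (hG : ContDiff ℝ 1 G) (hs : HasCompactSupport G) : ∃ y, y + G y = 0 := by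
  by_contra hcon
  push Not at hcon
  obtain ⟨L, hL⟩ := hG.lipschitzWith_of_hasCompactSupport hs one_ne_zero
  obtain ⟨r0, hr0⟩ := hs.isCompact.isBounded.subset_closedBall (0 : EuclideanSpace ℝ (Fin d))
  set r := max r0 1
  have hrpos : 0 < r := lt_of_lt_of_le one_pos (le_max_right _ _)
  have hr : ∀ y, r < ‖y‖ → G y = 0 := by
    intro y hy
    by_contra h
    have := hr0 (subset_tsupport G h)
    rw [mem_closedBall_zero_iff] at this
    exact absurd (this.trans (le_max_left _ _)) (not_le.mpr hy)
  set B := Metric.closedBall (0 : EuclideanSpace ℝ (Fin d)) r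
  have hBc : IsCompact B := isCompact_closedBall _ _
  have hBne : B.Nonempty := ⟨0, by simp [B, hrpos.le]⟩
  have hFc : Continuous (fun y => ‖y + G y‖) := (continuous_id.add hG.continuous).norm
  obtain ⟨y0, hy0, hmin⟩ := hBc.exists_isMinOn hBne hFc.continuousOn
  obtain ⟨y1, hy1, hmax⟩ := hBc.exists_isMaxOn hBne hFc.continuousOn
  set m := ‖y0 + G y0‖
  have hm : 0 < m := norm_pos_iff.mpr (hcon y0)
  set K := max ‖y1 + G y1‖ r
  have hmK : m ≤ K := (isMaxOn_iff.mp hmax y0 hy0).trans (le_max_left _ _)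
  have hrK : r ≤ K := le_max_right _ _
  set q := min (m / 2) r
  have hq : 0 < q := lt_min (by linarith) hrpos
  set V := volume.real (Metric.closedBall (0 : EuclideanSpace ℝ (Fin d)) q)
  have hV : 0 < V := by
    apply ENNReal.toReal_pos
    · exact (Metric.measure_closedBall_pos volume _ hq).ne'
    · exact measure_closedBall_lt_top.ne
  set D := ∫ y in B, |(ContinuousLinearMap.id ℝ _ + (1:ℝ) • fderiv ℝ G y).det|
  set a := K^2 - m^2
  set b := K^2 - m^2/4
  have ha : 0 ≤ a := by simp only [a]; nlinarith
  have hab : a < b := by simp only [a, b]; nlinarith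
  have hdetc : Continuous (fun y => (ContinuousLinearMap.id ℝ _ + (1:ℝ) • fderiv ℝ G y).det) := by
    have h1 : Continuous (fderiv ℝ G) := hG.continuous_fderiv one_ne_zero
    apply ContinuousLinearMap.continuous_det.comp
    fun_prop
  have hmain : ∀ k : ℕ, b ^ k * V ≤ a ^ k * D := by
    intro k
    have h1 := integral_one G hG r hr L hL K k
    have h2 : ∫ y in B, (ContinuousLinearMap.id ℝ _ + (1:ℝ) • fderiv ℝ G y).det * (K ^ 2 - ‖y + (1:ℝ) • G y‖ ^ 2) ^ k ≤ a ^ k * D := by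
      simp only [D]
      rw [← integral_const_mul]
      apply setIntegral_mono_on
      · exact (integrand_cont G hG K k 1).continuousOn.integrableOn_compact hBc
      · exact ((hdetc.abs).const_mul (a^k)).continuousOn.integrableOn_compact hBc
      · exact Metric.isClosed_closedBall.measurableSet
      · intro y hy
        rw [one_smul ℝ (G y)]
        have hlo : m ≤ ‖y + G y‖ := isMinOn_iff.mp hmin y hy
        have hhi : ‖y + G y‖ ≤ K := (isMaxOn_iff.mp hmax y hy).trans (le_max_left _ _)
        have h3 : 0 ≤ K ^ 2 - ‖y + G y‖ ^ 2 := by nlinarith [norm_nonneg (y + G y)]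
        have h4 : K ^ 2 - ‖y + G y‖ ^ 2 ≤ a := by simp only [a]; nlinarith
        rw [mul_comm (a^k)]
        exact mul_le_mul (le_abs_self _) (pow_le_pow_left₀ h3 h4 k) (pow_nonneg h3 k) (abs_nonneg _)
    have hc : Continuous (fun y : EuclideanSpace ℝ (Fin d) => (K ^ 2 - ‖y‖ ^ 2) ^ k) := by fun_prop
    have h3 : b ^ k * V ≤ ∫ y in B, (K ^ 2 - ‖y‖ ^ 2) ^ k := by
      have h5 : ∫ y in Metric.closedBall (0 : EuclideanSpace ℝ (Fin d)) q, (K ^ 2 - ‖y‖ ^ 2) ^ k ≤ ∫ y in B, (K ^ 2 - ‖y‖ ^ 2) ^ k := by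
        apply setIntegral_mono_set
        · exact hc.continuousOn.integrableOn_compact hBc
        · rw [Filter.EventuallyLE, ae_restrict_iff' Metric.isClosed_closedBall.measurableSet]
          refine Filter.Eventually.of_forall fun y hy => ?_
          have hy' : ‖y‖ ≤ r := by simpa [B] using hy
          simp only [Pi.zero_apply]
          apply pow_nonneg
          nlinarith [norm_nonneg y]
        · exact (Metric.closedBall_subset_closedBall (min_le_right _ _)).eventuallyLE
      refine le_trans ?_ h5
      have h6 : b ^ k * V = ∫ y in Metric.closedBall (0 : EuclideanSpace ℝ (Fin d)) q, b ^ k := by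
        rw [setIntegral_const, smul_eq_mul, mul_comm]
      rw [h6]
      apply setIntegral_mono_on
      · exact continuousOn_const.integrableOn_compact (isCompact_closedBall _ _)
      · exact hc.continuousOn.integrableOn_compact (isCompact_closedBall _ _)
      · exact Metric.isClosed_closedBall.measurableSet
      · intro y hy
        rw [mem_closedBall_zero_iff] at hy
        have : ‖y‖ ≤ m / 2 := hy.trans (min_le_left _ _)
        apply pow_le_pow_left₀ (ha.trans hab.le)
        simp only [b]
        nlinarith [norm_nonneg y]
    exact h3.trans (h1 ▸ h2)
  have hb : 0 < b := lt_of_le_of_lt ha hab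
  have hlim : Filter.Tendsto (fun k : ℕ => (a / b) ^ k * D) Filter.atTop (nhds (0 * D)) :=
    (tendsto_pow_atTop_nhds_zero_of_lt_one (div_nonneg ha hb.le) ((div_lt_one hb).mpr hab)).mul_const D
  have : V ≤ 0 * D := by
    apply ge_of_tendsto' hlim
    intro k
    have := hmain k
    rw [div_pow, div_mul_eq_mul_div, le_div_iff₀ (pow_pos hb k), mul_comm]
    exact this
  rw [zero_mul] at this
  linarith

theorem brouwer {d : ℕ} (f : EuclideanSpace ℝ (Fin d) → EuclideanSpace ℝ (Fin d))
    (hf : Continuous f) (R : ℝ) (hR : ∀ y, ‖f y‖ ≤ R) : ∃ y, f y = y := by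
  by_contra hcon
  push Not at hcon
  have hR0 : 0 ≤ R := (norm_nonneg _).trans (hR 0)
  have hBc : IsCompact (Metric.closedBall (0 : EuclideanSpace ℝ (Fin d)) (R+1)) := isCompact_closedBall _ _
  obtain ⟨y0, hy0, hmin⟩ := hBc.exists_isMinOn ⟨0, by simp; linarith⟩ ((hf.sub continuous_id).norm.continuousOn)
  set m := ‖f y0 - y0‖ with hm
  have hmpos : 0 < m := norm_pos_iff.mpr (sub_ne_zero.mpr (hcon y0))
  set e := min m 1 with he
  have hepos : 0 < e := lt_min hmpos one_pos
  obtain ⟨g, hg, hgf, -⟩ := hf.exists_contDiff_approx 1 (ε := fun _ => e) continuous_const (fun _ => hepos)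
  have hgR : ∀ y, ‖g y‖ ≤ R + 1 := by
    intro y
    have h1 := hgf y
    rw [dist_eq_norm] at h1
    have h2 : ‖g y‖ ≤ ‖g y - f y‖ + ‖f y‖ := by simpa using norm_add_le (g y - f y) (f y)
    have := min_le_right m 1
    linarith [hR y]
  let κ : ContDiffBump (0 : EuclideanSpace ℝ (Fin d)) := ⟨R + 2, R + 3, by linarith, by linarith⟩
  obtain ⟨y, hy⟩ := core_zero (fun y => -(κ y • g y)) (by
      have : ContDiff ℝ 1 κ := κ.contDiff
      have hg' : ContDiff ℝ 1 g := by exact_mod_cast hg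
      exact (this.smul hg').neg) (by
      have : HasCompactSupport (fun y => κ y • g y) := κ.hasCompactSupport.smul_right
      exact HasCompactSupport.comp_left (g := fun z => -z) this neg_zero)
  have hy1 : y = κ y • g y := by
    rwa [← sub_eq_add_neg, sub_eq_zero] at hy
  have hyR : ‖y‖ ≤ R + 1 := by
    rw [hy1, norm_smul, Real.norm_eq_abs, abs_of_nonneg κ.nonneg]
    calc κ y * ‖g y‖ ≤ 1 * ‖g y‖ := mul_le_mul_of_nonneg_right κ.le_one (norm_nonneg _)
      _ ≤ R + 1 := by rw [one_mul]; exact hgR y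
  have hk1 : κ y = 1 := by
    apply κ.one_of_mem_closedBall
    rw [mem_closedBall_zero_iff]
    change ‖y‖ ≤ R + 2
    linarith
  rw [hk1, one_smul] at hy1
  have h1 := hgf y
  rw [← hy1, dist_eq_norm, norm_sub_rev] at h1
  have h2 := isMinOn_iff.mp hmin y (by simpa using hyR)
  have := min_le_left m 1
  change m ≤ ‖f y - y‖ at h2
  linarith
end PachAux

namespace PachAux

theorem greedy {W T : Type*} {r n : ℕ} (hn : 0 < n) (u : T → Fin r → W)
    (F : T → Finset (Fin r → Fin n)) (L m : ℕ) (hF : ∀ τ, (F τ).card ≤ m)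
    (hLm : L ^ r * m < n ^ r)
    (hS : ∀ i w, ∃ S : Finset T, S.card ≤ L ∧ ∀ τ, u τ i = w → τ ∈ S) :
    ∃ a : Fin r → W → Fin n, ∀ τ, (fun i => a i (u τ i)) ∉ F τ := by
  classical
  have key : ∀ k ≤ r, ∃ a : Fin r → W → Fin n, ∀ τ,
      ((F τ).filter (fun s => ∀ i : Fin r, i.val < k → s i = a i (u τ i))).card * n ^ k ≤ L ^ k * m := by
    intro k
    induction k with
    | zero =>
      intro _
      refine ⟨fun _ _ => ⟨0, hn⟩, fun τ => ?_⟩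
      simpa using hF τ
    | succ k ih =>
      intro hk
      obtain ⟨a, ha⟩ := ih (by omega)
      let i0 : Fin r := ⟨k, by omega⟩
      choose S hSc hSm using hS i0
      let val : W → Fin n → ℕ := fun w c => ∑ τ ∈ S w,
        ((F τ).filter (fun s => (∀ i : Fin r, i.val < k → s i = a i (u τ i)) ∧ s i0 = c)).card
      have hmin : ∀ w, ∃ c, ∀ c', val w c ≤ val w c' := by
        intro w
        obtain ⟨c, _, hc⟩ := Finset.exists_min_image Finset.univ (val w) ⟨⟨0, hn⟩, Finset.mem_univ _⟩
        exact ⟨c, fun c' => hc c' (Finset.mem_univ _)⟩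
      choose c hc using hmin
      have hsum : ∀ w, ∑ c', val w c' = ∑ τ ∈ S w, ((F τ).filter (fun s => ∀ i : Fin r, i.val < k → s i = a i (u τ i))).card := by
        intro w
        simp only [val]
        rw [Finset.sum_comm]
        apply Finset.sum_congr rfl
        intro τ _
        rw [Finset.card_eq_sum_card_fiberwise (f := fun s => s i0) (t := Finset.univ) (by intro _ _; simp)]
        apply Finset.sum_congr rfl
        intro c' _
        rw [Finset.filter_filter]
      have hval : ∀ w, val w (c w) * n ^ (k+1) ≤ L ^ (k+1) * m := by
        intro w
        have h1 : n * val w (c w) ≤ ∑ c', val w c' := by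
          have := Finset.card_nsmul_le_sum Finset.univ (val w) (val w (c w)) (fun c' _ => hc w c')
          simpa using this
        have h2 : (∑ c', val w c') * n ^ k ≤ L * (L ^ k * m) := by
          rw [hsum, Finset.sum_mul]
          calc _ ≤ ∑ τ ∈ S w, L ^ k * m := Finset.sum_le_sum (fun τ _ => ha τ)
            _ = (S w).card * (L ^ k * m) := by rw [Finset.sum_const, smul_eq_mul]
            _ ≤ _ := Nat.mul_le_mul_right _ (hSc w)
        calc val w (c w) * n ^ (k+1) = (n * val w (c w)) * n ^ k := by ring
          _ ≤ (∑ c', val w c') * n ^ k := Nat.mul_le_mul_right _ h1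
          _ ≤ _ := h2
          _ = _ := by ring
      refine ⟨Function.update a i0 c, fun τ => ?_⟩
      refine le_trans (Nat.mul_le_mul_right _ ?_) (hval (u τ i0))
      have h3 : ((F τ).filter (fun s => (∀ i : Fin r, i.val < k → s i = a i (u τ i)) ∧ s i0 = c (u τ i0))).card ≤ val (u τ i0) (c (u τ i0)) :=
        Finset.single_le_sum (f := fun τ' => ((F τ').filter (fun s => (∀ i : Fin r, i.val < k → s i = a i (u τ' i)) ∧ s i0 = c (u τ i0))).card) (fun _ _ => Nat.zero_le _) (hSm _ τ rfl)
      refine le_trans (Finset.card_le_card ?_) h3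
      intro s hs
      rw [Finset.mem_filter] at hs ⊢
      refine ⟨hs.1, ?_, ?_⟩
      · intro i hi
        have := hs.2 i (by omega)
        rwa [Function.update_of_ne] at this
        intro h
        rw [h] at hi
        exact lt_irrefl _ hi
      · have := hs.2 i0 (Nat.lt_succ_self k)
        rwa [Function.update_self] at this
  obtain ⟨a, ha⟩ := key r le_rfl
  refine ⟨a, fun τ hτ => ?_⟩
  have h1 := (ha τ).trans_lt hLm
  have h2 : 0 < ((F τ).filter (fun s => ∀ i : Fin r, i.val < r → s i = a i (u τ i))).card :=
    Finset.card_pos.mpr ⟨_, Finset.mem_filter.mpr ⟨hτ, fun _ _ => rfl⟩⟩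
  exact absurd h1 (not_lt.mpr (Nat.le_mul_of_pos_left _ h2))
end PachAux

namespace PachAux

/-- offset vector cast to integers -/
def offs {d : ℕ} (o : Fin d → Fin 2) : Fin d → ℤ := fun i => ((o i : ℕ) : ℤ)

theorem hat_functions (d : ℕ) : ∃ (φ : (Fin d → ℤ) → (Fin d → ℝ) → ℝ) (κ : (Fin d → ℤ) → Fin (d+1)),
    (∀ u, Continuous (φ u)) ∧ (∀ u y, 0 ≤ φ u y) ∧ (∀ y, 0 < φ (fun i => ⌊y i⌋) y) ∧
    ∀ y : Fin d → ℝ, ∃ o : Fin (d+1) → Fin d → Fin 2, ∀ u, 0 < φ u y → u = (fun i => ⌊y i⌋) + offs (o (κ u)) := by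
  classical
  let φ : (Fin d → ℤ) → (Fin d → ℝ) → ℝ := fun u y => ∏ i, ∏ j,
    max 0 (1 - max 0 (y i - u i) - max 0 (u j - y j))
  let κ : (Fin d → ℤ) → Fin (d+1) := fun u =>
    ⟨((∑ i, u i) % ((d:ℤ)+1)).toNat, by
      have h1 := Int.emod_nonneg (∑ i, u i) (show (d:ℤ)+1 ≠ 0 by omega)
      have h2 := Int.emod_lt_of_pos (∑ i, u i) (show 0 < (d:ℤ)+1 by omega)
      omega⟩
  have hκ : ∀ u u', κ u = κ u' → ((d:ℤ)+1) ∣ ∑ i, (u i - u' i) := by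
    intro u u' h
    have h0 : ((∑ i, u i) % ((d:ℤ)+1)).toNat = ((∑ i, u' i) % ((d:ℤ)+1)).toNat := congrArg Fin.val h
    have h1 := Int.emod_nonneg (∑ i, u i) (show (d:ℤ)+1 ≠ 0 by omega)
    have h2 := Int.emod_nonneg (∑ i, u' i) (show (d:ℤ)+1 ≠ 0 by omega)
    have h3 : (∑ i, u i) % ((d:ℤ)+1) = (∑ i, u' i) % ((d:ℤ)+1) := by omega
    rw [Finset.sum_sub_distrib]
    exact Int.dvd_of_emod_eq_zero (Int.emod_eq_emod_iff_emod_sub_eq_zero.mp h3)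
  have hpos : ∀ u y, 0 < φ u y → ∀ i j, max 0 (y i - u i) + max 0 (u j - y j) < 1 := by
    intro u y h i j
    by_contra hcon
    have : φ u y = 0 := by
      apply Finset.prod_eq_zero (Finset.mem_univ i)
      apply Finset.prod_eq_zero (Finset.mem_univ j)
      apply max_eq_left
      linarith
    linarith
  have hpos' : ∀ u y, 0 < φ u y → ∀ i j, (y i - u i) + (u j - y j) < 1 ∧ y i - u i < 1 ∧ u i - y i < 1 := by
    intro u y h i j
    have h1 := hpos u y h i j
    have h2 := hpos u y h j i
    have := le_max_left 0 (y i - u i)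
    have := le_max_right 0 (y i - u i)
    have := le_max_left 0 (u j - y j)
    have := le_max_right 0 (u j - y j)
    have := le_max_left 0 (u i - y i)
    have := le_max_right 0 (u i - y i)
    have := le_max_left 0 (y j - u j)
    refine ⟨?_, ?_, ?_⟩ <;> linarith
  have huniq : ∀ u u' y, 0 < φ u y → 0 < φ u' y → κ u = κ u' → u = u' := by
    intro u u' y hu hu' hk
    have hab : ∀ i, u i - u' i ≤ 1 ∧ -1 ≤ u i - u' i := by
      intro i
      have h1 := hpos' u y hu i i
      have h2 := hpos' u' y hu' i i
      have h3 : ((u i - u' i : ℤ) : ℝ) < 2 := by push_cast; linarith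
      have h4 : ((-2 : ℤ) : ℝ) < ((u i - u' i : ℤ) : ℝ) := by push_cast; linarith
      have h5 : (u i - u' i) < 2 := by exact_mod_cast h3
      have h6 : -2 < (u i - u' i) := by exact_mod_cast h4
      omega
    have hsame : ¬ ∃ i j, 1 ≤ u i - u' i ∧ u j - u' j ≤ -1 := by
      rintro ⟨i, j, hi, hj⟩
      have h1 := (hpos' u y hu j i).1
      have h2 := (hpos' u' y hu' i j).1
      have hi' : (1:ℝ) ≤ u i - u' i := by exact_mod_cast hi
      have hj' : (u j : ℝ) - u' j ≤ -1 := by exact_mod_cast hj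
      linarith
    push Not at hsame
    have hdvd := hκ u u' hk
    have hzero : ∑ i, (u i - u' i) = 0 := by
      apply Int.eq_zero_of_abs_lt_dvd hdvd
      refine lt_of_le_of_lt (Finset.abs_sum_le_sum_abs _ _) ?_
      refine lt_of_le_of_lt (Finset.sum_le_card_nsmul _ _ 1 (fun i _ => ?_)) ?_
      · rw [abs_le]; have := hab i; omega
      · simp
    by_cases hex : ∃ i, 1 ≤ u i - u' i
    · obtain ⟨i, hi⟩ := hex
      have hnn : ∀ j ∈ Finset.univ, 0 ≤ u j - u' j := fun j _ => by have := hsame i j hi; omega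
      have := (Finset.sum_eq_zero_iff_of_nonneg hnn).mp hzero i (Finset.mem_univ _)
      omega
    · push Not at hex
      have hnn : ∀ j ∈ Finset.univ, u j - u' j ≤ 0 := fun j _ => by have := hex j; omega
      ext i
      have := (Finset.sum_eq_zero_iff_of_nonpos hnn).mp hzero i (Finset.mem_univ _)
      omega
  have hfl : ∀ u y, 0 < φ u y → ∀ i, u i = ⌊y i⌋ ∨ u i = ⌊y i⌋ + 1 := by
    intro u y hu i
    have h1 := hpos' u y hu i i
    have h2 := Int.floor_le (y i)
    have h3 := Int.lt_floor_add_one (y i)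
    have h4 : (u i : ℝ) < ((⌊y i⌋ + 2 : ℤ) : ℝ) := by push_cast; linarith
    have h5 : ((⌊y i⌋ - 1 : ℤ) : ℝ) < u i := by push_cast; linarith
    have h6 : u i < ⌊y i⌋ + 2 := by exact_mod_cast h4
    have h7 : ⌊y i⌋ - 1 < u i := by exact_mod_cast h5
    omega
  refine ⟨φ, κ, ?_, ?_, ?_, ?_⟩
  · intro u
    simp only [φ]
    fun_prop
  · intro u y
    exact Finset.prod_nonneg fun i _ => Finset.prod_nonneg fun j _ => le_max_left _ _
  · intro y
    apply Finset.prod_pos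
    intro i _
    apply Finset.prod_pos
    intro j _
    have h2 := Int.floor_le (y i)
    have h3 := Int.lt_floor_add_one (y i)
    have h4 := Int.floor_le (y j)
    rw [max_eq_left (by linarith : (⌊y j⌋ : ℝ) - y j ≤ 0), max_eq_right (by linarith : 0 ≤ y i - ⌊y i⌋)]
    apply lt_max_of_lt_right
    linarith
  · intro y
    have : ∀ c : Fin (d+1), ∃ o : Fin d → Fin 2, ∀ u, κ u = c → 0 < φ u y → u = (fun i => ⌊y i⌋) + offs o := by
      intro c
      by_cases hex : ∃ u, κ u = c ∧ 0 < φ u y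
      · obtain ⟨u, hu, hup⟩ := hex
        refine ⟨fun i => if u i = ⌊y i⌋ then 0 else 1, fun u' hu' hup' => ?_⟩
        have := huniq u u' y hup hup' (hu.trans hu'.symm)
        subst this
        ext i
        rcases hfl u y hup i with h | h <;> simp [offs, h]
      · push Not at hex
        refine ⟨fun _ => 0, fun u hu hup => ?_⟩
        exact absurd hup (not_lt.mpr (hex u hu))
    choose o ho using this
    exact ⟨o, fun u hu => ho (κ u) u rfl hu⟩

end PachAux

namespace PachAux

theorem lebesgue_count {d : ℕ} {S : Type*} [Fintype S] (K : S → Set (EuclideanSpace ℝ (Fin d)))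
    (hK : ∀ s, IsClosed (K s)) (m : ℕ) (hm : ∀ p, ∀ A : Finset S, (∀ s ∈ A, p ∈ K s) → A.card ≤ m) (R : ℝ) :
    ∃ η > 0, ∀ q ∈ Metric.closedBall (0 : EuclideanSpace ℝ (Fin d)) R, ∀ A : Finset S,
      (∀ s ∈ A, (K s ∩ Metric.ball q η).Nonempty) → A.card ≤ m := by
  let U : EuclideanSpace ℝ (Fin d) → Set (EuclideanSpace ℝ (Fin d)) := fun q => ⋂ s : {s : S // q ∉ K s}, (K s.1)ᶜ
  have hU : ∀ q, IsOpen (U q) := fun q => isOpen_iInter_of_finite fun s => (hK s.1).isOpen_compl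
  have hqU : ∀ q, q ∈ U q := fun q => Set.mem_iInter.mpr fun s => s.2
  obtain ⟨η, hη, h⟩ := lebesgue_number_lemma_of_metric (isCompact_closedBall (0 : EuclideanSpace ℝ (Fin d)) R) hU
    (fun q _ => Set.mem_iUnion.mpr ⟨q, hqU q⟩)
  refine ⟨η, hη, fun q hq A hA => ?_⟩
  obtain ⟨q', hq'⟩ := h q hq
  refine hm q' A fun s hs => ?_
  by_contra hcon
  obtain ⟨z, hz, hz'⟩ := hA s hs
  have := Set.mem_iInter.mp (hq' hz') ⟨s, hcon⟩
  exact this hz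

theorem selection (d : ℕ) : ∃ δ : ℝ, 0 < δ ∧ ∀ n : ℕ, 0 < n →
    ∀ x : Fin (d+1) → Fin n → EuclideanSpace ℝ (Fin d),
    ∃ p, ∃ A : Finset (Fin (d+1) → Fin n), δ * (n:ℝ) ^ (d+1) ≤ A.card ∧
      ∀ s ∈ A, p ∈ convexHull ℝ (Set.range fun i => x i (s i)) := by
  classical
  set L := Fintype.card (Fin (d+1) → Fin d → Fin 2) with hL
  have hLpos : 0 < L := Fintype.card_pos
  refine ⟨1 / (L:ℝ) ^ (d+1), by positivity, ?_⟩
  intro n hn x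
  by_contra hcon
  push Not at hcon
  set K : (Fin (d+1) → Fin n) → Set (EuclideanSpace ℝ (Fin d)) := fun s => convexHull ℝ (Set.range fun i => x i (s i)) with hKdef
  have hKclosed : ∀ s, IsClosed (K s) := fun s => (Set.finite_range _).isClosed_convexHull ℝ
  set m := (n ^ (d+1) - 1) / L ^ (d+1) with hm
  have hnp : 0 < n ^ (d+1) := Nat.pow_pos hn
  have hmL : L ^ (d+1) * m < n ^ (d+1) := by
    have := Nat.mul_div_le (n ^ (d+1) - 1) (L ^ (d+1))
    rw [← hm] at this
    omega
  have hcount : ∀ p, ∀ A : Finset (Fin (d+1) → Fin n), (∀ s ∈ A, p ∈ K s) → A.card ≤ m := by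
    intro p A hA
    have h1 : (A.card : ℝ) < 1 / (L:ℝ) ^ (d+1) * (n:ℝ) ^ (d+1) := by
      by_contra h
      obtain ⟨s, hs, hs'⟩ := hcon p A (not_lt.mp h)
      exact hs' (hA s hs)
    rw [one_div, inv_mul_eq_div, lt_div_iff₀ (by positivity)] at h1
    have h2 : A.card * L ^ (d+1) < n ^ (d+1) := by exact_mod_cast h1
    rw [hm, Nat.le_div_iff_mul_le (Nat.pow_pos hLpos)]
    omega
  set R : ℝ := ∑ i, ∑ j, ‖x i j‖ with hR
  have hxR : ∀ i j, ‖x i j‖ ≤ R := by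
    intro i j
    refine le_trans ?_ (Finset.single_le_sum (f := fun i => ∑ j, ‖x i j‖) (fun i _ => Finset.sum_nonneg fun j _ => norm_nonneg _) (Finset.mem_univ i))
    exact Finset.single_le_sum (f := fun j => ‖x i j‖) (fun j _ => norm_nonneg _) (Finset.mem_univ j)
  have hR0 : 0 ≤ R := Finset.sum_nonneg fun i _ => Finset.sum_nonneg fun j _ => norm_nonneg _
  have hKR : ∀ s, K s ⊆ Metric.closedBall 0 R := by
    intro s
    apply convexHull_min _ (convex_closedBall _ _)
    rintro _ ⟨i, rfl⟩
    rw [mem_closedBall_zero_iff]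
    exact hxR _ _
  obtain ⟨η, hη, hηc⟩ := lebesgue_count K hKclosed m hcount R
  set h : ℝ := η / (4 * (d+1)) with hh
  have hhpos : 0 < h := by positivity
  let pt : (Fin d → ℤ) → EuclideanSpace ℝ (Fin d) := fun v => WithLp.toLp 2 (fun i => h * (v i : ℝ))
  let F : (Fin d → ℤ) × (Fin (d+1) → Fin d → Fin 2) → Finset (Fin (d+1) → Fin n) := fun τ =>
    Finset.univ.filter fun s => (K s ∩ Metric.ball (pt τ.1) (η/2)).Nonempty
  obtain ⟨a, ha⟩ := greedy hn (fun (τ : (Fin d → ℤ) × (Fin (d+1) → Fin d → Fin 2)) (i : Fin (d+1)) => τ.1 + offs (τ.2 i)) F L m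
    (by
      intro τ
      by_cases hne : (F τ).Nonempty
      · obtain ⟨s, hs⟩ := hne
        obtain ⟨q, hq, hq'⟩ := (Finset.mem_filter.mp hs).2
        refine hηc q (hKR s hq) _ ?_
        intro s' hs'
        obtain ⟨q2, hq2, hq2'⟩ := (Finset.mem_filter.mp hs').2
        refine ⟨q2, hq2, ?_⟩
        rw [Metric.mem_ball] at *
        have := dist_triangle_right q2 q (pt τ.1)
        linarith
      · rw [Finset.not_nonempty_iff_eq_empty] at hne
        rw [hne]; simp) hmL
    (by
      intro i w
      refine ⟨Finset.univ.image fun o => (w - offs (o i), o), ?_, ?_⟩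
      · exact Finset.card_image_le.trans (by simp [hL])
      · rintro ⟨v, o⟩ h
        simp only at h
        rw [Finset.mem_image]
        exact ⟨o, Finset.mem_univ _, by rw [← h]; simp⟩)
  obtain ⟨φ, κ, hφc, hφ0, hφf, hφo⟩ := hat_functions d
  let M : ℤ := ⌈R / h⌉ + 1
  let Q : Finset (Fin d → ℤ) := Fintype.piFinset fun _ => Finset.Icc (-M) M
  let sc : EuclideanSpace ℝ (Fin d) → Fin d → ℝ := fun y i => y i / h
  have hscc : Continuous sc := by fun_prop
  let Φ : EuclideanSpace ℝ (Fin d) → ℝ := fun y => ∑ u ∈ Q, φ u (sc y)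
  have hΦc : Continuous Φ := continuous_finsetSum _ fun u _ => (hφc u).comp hscc
  have hΦ0 : ∀ y, 0 ≤ Φ y := fun y => Finset.sum_nonneg fun u _ => hφ0 u _
  have hΦpos : ∀ y ∈ Metric.closedBall (0 : EuclideanSpace ℝ (Fin d)) R, 0 < Φ y := by
    intro y hy
    rw [mem_closedBall_zero_iff] at hy
    refine lt_of_lt_of_le (hφf (sc y)) (Finset.single_le_sum (f := fun u => φ u (sc y)) (fun u _ => hφ0 u _) ?_)
    rw [Fintype.mem_piFinset]
    intro i
    rw [Finset.mem_Icc]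
    have h1 : |y i| ≤ R := (PiLp.norm_apply_le y i).trans hy
    have h2 : |sc y i| ≤ R / h := by
      simp only [sc]
      rw [abs_div, abs_of_pos hhpos]
      gcongr
    have h3 := abs_le.mp h2
    have h4 := Int.le_ceil (R / h)
    have h5 := Int.floor_le (sc y i)
    have h6 := Int.lt_floor_add_one (sc y i)
    have h7 : ((⌊sc y i⌋ : ℤ) : ℝ) ≤ (M : ℤ) := by simp only [M]; push_cast; linarith
    have h8 : ((-M : ℤ) : ℝ) ≤ ⌊sc y i⌋ := by simp only [M]; push_cast; linarith
    exact ⟨by exact_mod_cast h8, by exact_mod_cast h7⟩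
  obtain ⟨y0, hy0, hmin⟩ := (isCompact_closedBall (0 : EuclideanSpace ℝ (Fin d)) R).exists_isMinOn
    ⟨0, by simp [hR0]⟩ hΦc.continuousOn
  have hm0 := hΦpos y0 hy0
  let X : (Fin d → ℤ) → EuclideanSpace ℝ (Fin d) := fun u => x (κ u) (a (κ u) u)
  let f : EuclideanSpace ℝ (Fin d) → EuclideanSpace ℝ (Fin d) := fun y =>
    (max (Φ y0) (Φ y))⁻¹ • ∑ u ∈ Q, φ u (sc y) • X u
  have hmaxpos : ∀ y, 0 < max (Φ y0) (Φ y) := fun y => lt_max_of_lt_left hm0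
  have hfc : Continuous f := by
    refine Continuous.smul (f := fun y => (max (Φ y0) (Φ y))⁻¹) (g := fun y => ∑ u ∈ Q, φ u (sc y) • X u) ?_ ?_
    · exact (continuous_const.max hΦc).inv₀ fun y => (hmaxpos y).ne'
    · exact continuous_finsetSum _ fun u _ => ((hφc u).comp hscc).smul continuous_const
  have hfR : ∀ y, ‖f y‖ ≤ R := by
    intro y
    simp only [f]
    rw [norm_smul, norm_inv, Real.norm_eq_abs, abs_of_pos (hmaxpos y), inv_mul_le_iff₀ (hmaxpos y)]
    calc _ ≤ ∑ u ∈ Q, ‖φ u (sc y) • X u‖ := norm_sum_le _ _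
      _ ≤ ∑ u ∈ Q, φ u (sc y) * R := by
        apply Finset.sum_le_sum
        intro u _
        rw [norm_smul, Real.norm_eq_abs, abs_of_nonneg (hφ0 _ _)]
        exact mul_le_mul_of_nonneg_left (hxR _ _) (hφ0 _ _)
      _ = Φ y * R := by rw [← Finset.sum_mul]
      _ ≤ _ := mul_le_mul_of_nonneg_right (le_max_right _ _) hR0
  obtain ⟨y, hy⟩ := brouwer f hfc R hfR
  have hyR : y ∈ Metric.closedBall (0 : EuclideanSpace ℝ (Fin d)) R := by
    rw [mem_closedBall_zero_iff, ← hy]; exact hfR y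
  have hmax : max (Φ y0) (Φ y) = Φ y := max_eq_right (isMinOn_iff.mp hmin y hyR)
  have hΦy := hΦpos y hyR
  obtain ⟨o, ho⟩ := hφo (sc y)
  set v : Fin d → ℤ := fun i => ⌊sc y i⌋ with hv
  refine ha (v, o) ?_
  simp only [F, Finset.mem_filter, Finset.mem_univ, true_and]
  refine ⟨y, ?_, ?_⟩
  · have hyeq : y = ∑ u ∈ Q.filter (fun u => 0 < φ u (sc y)), (φ u (sc y) / Φ y) • X u := by
      conv_lhs => rw [← hy]
      simp only [f]
      rw [hmax, Finset.smul_sum]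
      rw [Finset.sum_filter_of_ne]
      · apply Finset.sum_congr rfl
        intro u _
        rw [smul_smul, div_eq_inv_mul]
      · intro u _ hne
        refine lt_of_le_of_ne (hφ0 _ _) fun h0 => hne ?_
        rw [← h0, zero_div, zero_smul]
    rw [hyeq]
    apply Convex.sum_mem (convex_convexHull ℝ _)
    · intro u _
      exact div_nonneg (hφ0 _ _) hΦy.le
    · rw [← Finset.sum_div]
      rw [Finset.sum_filter_of_ne]
      · exact div_self hΦy.ne'
      · intro u _ hne
        exact lt_of_le_of_ne (hφ0 _ _) (Ne.symm hne)
    · intro u hu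
      apply subset_convexHull
      refine ⟨κ u, ?_⟩
      have := ho u (Finset.mem_filter.mp hu).2
      simp only [X]
      conv_rhs => rw [this]
      rw [← this]
  · rw [Metric.mem_ball, dist_eq_norm, EuclideanSpace.norm_eq]
    have hb : ∀ i, ‖(y - pt v) i‖ ^ 2 ≤ h ^ 2 := by
      intro i
      have h2 := Int.floor_le (sc y i)
      have h3 := Int.lt_floor_add_one (sc y i)
      have h4 : (y - pt v) i = h * (sc y i - ⌊sc y i⌋) := by
        simp only [pt, sc, hv, PiLp.sub_apply]
        field_simp
      rw [Real.norm_eq_abs, sq_abs, h4]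
      apply pow_le_pow_left₀
      · apply mul_nonneg hhpos.le; linarith
      · nlinarith
    have hle : Real.sqrt (∑ i, ‖(y - pt v) i‖ ^ 2) ≤ η / 4 := by
      apply Real.sqrt_le_iff.mpr
      refine ⟨by positivity, ?_⟩
      calc _ ≤ ∑ i : Fin d, h ^ 2 := Finset.sum_le_sum fun i _ => hb i
        _ = d * h ^ 2 := by simp
        _ ≤ ((d+1) * h) ^ 2 := by
          have : (0:ℝ) ≤ d := Nat.cast_nonneg d
          have hh2 : 0 ≤ h ^ 2 := by positivity
          nlinarith
        _ = (η/4)^2 := by rw [hh]; field_simp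
    linarith
end PachAux

namespace PachAux

theorem median_pairs {κ : Type} (f : κ → ℝ) : ∀ (N : ℕ) (Y : Finset κ), Y.card = N →
    ∃ (t : ℝ) (P : Finset (κ × κ)), Y.card ≤ 2 * P.card ∧ Set.InjOn Prod.fst (P : Set (κ × κ)) ∧
      Set.InjOn Prod.snd (P : Set (κ × κ)) ∧ (∀ p ∈ P, p.1 ∈ Y ∧ p.2 ∈ Y ∧ f p.1 ≤ t ∧ t ≤ f p.2) ∧
      (Y.Nonempty → ∃ z ∈ Y, f z = t) := by
  classical
  intro N
  induction N using Nat.strong_induction_on with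
  | _ N ih =>
    intro Y hY
    rcases Y.eq_empty_or_nonempty with rfl | hne
    · exact ⟨0, ∅, by simp⟩
    obtain ⟨a, haY, ha⟩ := Finset.exists_min_image Y f hne
    rcases (Y.erase a).eq_empty_or_nonempty with h1 | h1
    · have hYa : Y = {a} := by
        rw [← Finset.insert_erase haY, h1]; rfl
      refine ⟨f a, {(a, a)}, ?_, ?_, ?_, ?_, ?_⟩
      · rw [hYa]; simp
      · simp
      · simp
      · simp [hYa]
      · intro _; exact ⟨a, haY, rfl⟩
    obtain ⟨b, hbY, hb⟩ := Finset.exists_max_image (Y.erase a) f h1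
    have hbY' := Finset.mem_of_mem_erase hbY
    have hba := Finset.ne_of_mem_erase hbY
    set Z := (Y.erase a).erase b with hZ
    have hZc : Z.card + 2 = Y.card := by
      have e1 := Finset.card_erase_of_mem haY
      have e2 := Finset.card_erase_of_mem hbY
      have e3 := Finset.card_pos.mpr hne
      have e4 := Finset.card_pos.mpr h1
      rw [hZ]; omega
    have hZY : ∀ z ∈ Z, z ∈ Y ∧ z ≠ a ∧ z ≠ b := by
      intro z hz
      simp only [hZ, Finset.mem_erase] at hz
      tauto
    obtain ⟨t, P, hP1, hP2, hP3, hP4, hP5⟩ := ih Z.card (by omega) Z rfl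
    have habm : ∀ t', (∃ z ∈ Y, f z = t') → f a ≤ t' := by
      rintro _ ⟨z, hz, rfl⟩; exact ha z hz
    have hex : ∃ t', (∃ z ∈ Y, f z = t') ∧ t' ≤ f b ∧ ∀ p ∈ P, f p.1 ≤ t' ∧ t' ≤ f p.2 := by
      rcases Z.eq_empty_or_nonempty with h2 | h2
      · refine ⟨f a, ⟨a, haY, rfl⟩, ha b hbY', ?_⟩
        intro p hp
        have := (hP4 p hp).1
        rw [h2] at this
        exact absurd this (Finset.notMem_empty _)
      · obtain ⟨z, hz, hzt⟩ := hP5 h2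
        refine ⟨t, ⟨z, (hZY z hz).1, hzt⟩, ?_, fun p hp => (hP4 p hp).2.2⟩
        rw [← hzt]
        exact hb z (Finset.mem_of_mem_erase hz)
    obtain ⟨t', ht1, ht2, ht3⟩ := hex
    have hnot : (a, b) ∉ P := fun h => (hZY _ (hP4 _ h).1).2.1 rfl
    refine ⟨t', insert (a, b) P, ?_, ?_, ?_, ?_, fun _ => ht1⟩
    · rw [Finset.card_insert_of_notMem hnot]; omega
    · rw [Finset.coe_insert, Set.injOn_insert (by simpa using hnot)]
      refine ⟨hP2, ?_⟩
      rintro ⟨p, hp, hpa⟩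
      exact (hZY _ (hP4 p hp).1).2.1 hpa
    · rw [Finset.coe_insert, Set.injOn_insert (by simpa using hnot)]
      refine ⟨hP3, ?_⟩
      rintro ⟨p, hp, hpa⟩
      exact (hZY _ (hP4 p hp).2.1).2.2 hpa
    · intro p hp
      rcases Finset.mem_insert.mp hp with rfl | hp
      · exact ⟨haY, hbY', habm t' ht1, ht2⟩
      · exact ⟨(hZY _ (hP4 p hp).1).1, (hZY _ (hP4 p hp).2.1).1, ht3 p hp⟩

/-- every function of the family can be sign-homogenized with ratio `c` -/
def HomC {k : ℕ} {ι : Type} (c : ℝ) (G : Submodule ℝ ((Fin k → ι) → ℝ)) : Prop :=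
  ∀ g ∈ G, ∀ B : Fin k → Finset ι, ∃ B' : Fin k → Finset ι,
    (∀ i, B' i ⊆ B i ∧ c * (B i).card ≤ (B' i).card) ∧
    ∃ σ : SignType, ∀ s, (∀ i, s i ∈ B' i) → SignType.sign (g s) = σ

theorem sign_case1 {w z s : ℝ} (hs : s < 0) (hw : SignType.sign w = 0) :
    SignType.sign (w + s * z) = - SignType.sign z := by
  rw [sign_eq_zero_iff] at hw
  rw [hw, zero_add, sign_mul, sign_neg hs]
  simp

theorem sign_case2 {w z s : ℝ} (hs : 0 ≤ s) (hw : SignType.sign z = SignType.sign w) :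
    SignType.sign (w + s * z) = SignType.sign w := by
  rcases lt_trichotomy w 0 with h | h | h
  · rw [sign_neg h, sign_eq_neg_one_iff] at hw
    rw [sign_neg h, sign_eq_neg_one_iff]; nlinarith
  · rw [h, sign_zero, sign_eq_zero_iff] at hw
    rw [h, hw]; simp
  · rw [sign_pos h, sign_eq_one_iff] at hw
    rw [sign_pos h, sign_eq_one_iff]; nlinarith

theorem sign_case3 {w z s : ℝ} (hs : s < 0) (hw : SignType.sign w ≠ 0) (hwz : SignType.sign z ≠ SignType.sign w) :
    SignType.sign (w + s * z) = SignType.sign w := by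
  rcases lt_trichotomy w 0 with h | h | h
  · rw [sign_neg h, Ne, sign_eq_neg_one_iff, not_lt] at hwz
    rw [sign_neg h, sign_eq_neg_one_iff]; nlinarith
  · rw [h, sign_zero] at hw; exact absurd rfl hw
  · rw [sign_pos h, Ne, sign_eq_one_iff, not_lt] at hwz
    rw [sign_pos h, sign_eq_one_iff]; nlinarith

theorem affine_hom (m : ℕ) : ∀ c : ℝ, 0 < c → ∃ c' : ℝ, 0 < c' ∧ c' ≤ 1 ∧
    ∀ (k : ℕ) (ι : Type) (G : Submodule ℝ ((Fin k → ι) → ℝ)), HomC c G →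
    ∀ (κ : Type) (Y : Finset κ) (y : κ → Fin m → ℝ) (g0 : (Fin k → ι) → ℝ) (g : Fin m → (Fin k → ι) → ℝ),
    g0 ∈ G → (∀ i, g i ∈ G) → ∀ B : Fin k → Finset ι,
    ∃ Y' ⊆ Y, c' * Y.card ≤ (Y'.card : ℝ) ∧ ∃ B' : Fin k → Finset ι,
      (∀ i, B' i ⊆ B i ∧ c' * (B i).card ≤ (B' i).card) ∧
      ∃ σ : SignType, ∀ j ∈ Y', ∀ s, (∀ i, s i ∈ B' i) → SignType.sign (g0 s + ∑ i, y j i * g i s) = σ := by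
  classical
  induction m with
  | zero =>
    intro c hc
    refine ⟨min c 1, lt_min hc one_pos, min_le_right _ _, ?_⟩
    intro k ι G hG κ Y y g0 g hg0 hg B
    obtain ⟨B', hB', σ, hσ⟩ := hG g0 hg0 B
    refine ⟨Y, subset_rfl, ?_, B', fun i => ⟨(hB' i).1, ?_⟩, σ, ?_⟩
    · exact (mul_le_mul_of_nonneg_right (min_le_right _ _) (Nat.cast_nonneg _)).trans (by rw [one_mul])
    · exact (mul_le_mul_of_nonneg_right (min_le_left _ _) (Nat.cast_nonneg _)).trans (hB' i).2
    · intro j _ s hs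
      simpa using hσ s hs
  | succ m ih =>
    intro c hc
    obtain ⟨e, he, he1, ihe⟩ := ih c hc
    refine ⟨e * e / 4, by positivity, by nlinarith, ?_⟩
    intro k ι G hG κ Y y g0 g hg0 hg B
    obtain ⟨t, P, hPc, hPi1, hPi2, hP, -⟩ := median_pairs (fun j => y j (Fin.last m)) _ Y rfl
    let S : κ × κ → ℝ := fun p => y p.1 (Fin.last m) - t
    let S' : κ × κ → ℝ := fun p => y p.2 (Fin.last m) - t
    let z : κ × κ → Fin m → ℝ := fun p i => (y p.2 i.castSucc - y p.1 i.castSucc) / (S' p - S p)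
    let w : κ × κ → Fin m → ℝ := fun p i => y p.1 i.castSucc - S p * z p i
    let h0 := g0 + t • g (Fin.last m)
    have hh0 : h0 ∈ G := G.add_mem hg0 (G.smul_mem _ (hg _))
    obtain ⟨P1, hP1s, hP1c, B1, hB1, σw, hσw⟩ := ihe k ι G hG (κ × κ) P w h0 (fun i => g i.castSucc) hh0 (fun i => hg _) B
    obtain ⟨P2, hP2s, hP2c, B2, hB2, σz, hσz⟩ := ihe k ι G hG (κ × κ) P1 z (g (Fin.last m)) (fun i => g i.castSucc) (hg _) (fun i => hg _) B1
    have hP2P : P2 ⊆ P := hP2s.trans hP1s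
    have hBB : ∀ i, B2 i ⊆ B i ∧ e * e / 4 * (B i).card ≤ (B2 i).card := by
      intro i
      refine ⟨(hB2 i).1.trans (hB1 i).1, ?_⟩
      have h1 := (hB1 i).2
      have h2 := (hB2 i).2
      have h3 := mul_le_mul_of_nonneg_left h1 he.le
      have : (0:ℝ) ≤ (B i).card := Nat.cast_nonneg _
      have : 0 ≤ e * e * ((B i).card : ℝ) := by positivity
      nlinarith
    have hf1 : ∀ p s, g0 s + ∑ i, y p.1 i * g i s = (h0 s + ∑ i, w p i * g i.castSucc s) +
        S p * (g (Fin.last m) s + ∑ i, z p i * g i.castSucc s) := by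
      intro p s
      rw [Fin.sum_univ_castSucc]
      simp only [h0, w, Pi.add_apply, Pi.smul_apply, smul_eq_mul, sub_mul, Finset.sum_sub_distrib, mul_add, Finset.mul_sum, S]
      simp only [mul_assoc]
      ring
    have hf2 : ∀ p s, S p ≠ S' p → g0 s + ∑ i, y p.2 i * g i s = (h0 s + ∑ i, w p i * g i.castSucc s) +
        S' p * (g (Fin.last m) s + ∑ i, z p i * g i.castSucc s) := by
      intro p s hne
      have hz : ∀ i, y p.2 i.castSucc = w p i + S' p * z p i := by
        intro i
        have : S' p - S p ≠ 0 := sub_ne_zero.mpr (Ne.symm hne)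
        simp only [w, z]
        field_simp
        ring
      rw [Fin.sum_univ_castSucc]
      simp only [hz, add_mul, Finset.sum_add_distrib, mul_add, Finset.mul_sum]
      simp only [h0, Pi.add_apply, Pi.smul_apply, smul_eq_mul, S', mul_assoc]
      ring
    -- pigeonhole
    have hcard : e * e / 2 * Y.card ≤ (P2.card : ℝ) := by
      have h1 : (Y.card : ℝ) ≤ 2 * P.card := by exact_mod_cast hPc
      have h3 := mul_le_mul_of_nonneg_left hP1c he.le
      have h4 := mul_le_mul_of_nonneg_left h1 (by positivity : 0 ≤ e * e)
      nlinarith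
    have hSle : ∀ p ∈ P2, S p ≤ 0 ∧ 0 ≤ S' p := by
      intro p hp
      have := (hP p (hP2P hp)).2.2
      simp only [S, S']
      constructor <;> linarith
    have hfst : ∀ P3 ⊆ P2, P3.image Prod.fst ⊆ Y ∧ (P3.image Prod.fst).card = P3.card := by
      intro P3 hP3
      constructor
      · intro j hj
        obtain ⟨p, hp, rfl⟩ := Finset.mem_image.mp hj
        exact (hP p (hP2P (hP3 hp))).1
      · exact Finset.card_image_of_injOn (hPi1.mono (by exact_mod_cast hP3.trans hP2P))
    have hsnd : ∀ P3 ⊆ P2, P3.image Prod.snd ⊆ Y ∧ (P3.image Prod.snd).card = P3.card := by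
      intro P3 hP3
      constructor
      · intro j hj
        obtain ⟨p, hp, rfl⟩ := Finset.mem_image.mp hj
        exact (hP p (hP2P (hP3 hp))).2.1
      · exact Finset.card_image_of_injOn (hPi2.mono (by exact_mod_cast hP3.trans hP2P))
    have hsplit := Finset.card_filter_add_card_filter_not (s := P2) (fun p => S p = 0)
    by_cases hbig : e * e / 4 * Y.card ≤ ((P2.filter (fun p => S p = 0)).card : ℝ)
    · obtain ⟨hs1, hs2⟩ := hfst _ (Finset.filter_subset (fun p => S p = 0) P2)
      refine ⟨_, hs1, by rw [hs2]; exact hbig, B2, hBB, σw, ?_⟩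
      intro j hj s hs
      obtain ⟨p, hp, rfl⟩ := Finset.mem_image.mp hj
      obtain ⟨hp1, hp2⟩ := Finset.mem_filter.mp hp
      rw [hf1, hp2, zero_mul, add_zero]
      exact hσw p (hP2s hp1) s fun i => (hB2 i).1 (hs i)
    · have hbig2 : e * e / 4 * Y.card ≤ ((P2.filter (fun p => ¬ S p = 0)).card : ℝ) := by
        have : (((P2.filter (fun p => S p = 0)).card : ℝ)) + ((P2.filter (fun p => ¬ S p = 0)).card : ℝ) = P2.card := by
          exact_mod_cast hsplit
        linarith
      set P3 := P2.filter (fun p => ¬ S p = 0) with hP3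
      have hP3s : P3 ⊆ P2 := Finset.filter_subset _ _
      have hneg : ∀ p ∈ P3, S p < 0 := fun p hp =>
        lt_of_le_of_ne (hSle p (hP3s hp)).1 (Finset.mem_filter.mp hp).2
      have hw : ∀ p ∈ P3, ∀ s, (∀ i, s i ∈ B2 i) → SignType.sign (h0 s + ∑ i, w p i * g i.castSucc s) = σw :=
        fun p hp s hs => hσw p (hP2s (hP3s hp)) s fun i => (hB2 i).1 (hs i)
      have hz : ∀ p ∈ P3, ∀ s, (∀ i, s i ∈ B2 i) → SignType.sign (g (Fin.last m) s + ∑ i, z p i * g i.castSucc s) = σz :=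
        fun p hp s hs => hσz p (hP3s hp) s hs
      obtain ⟨hs1, hs2⟩ := hfst _ hP3s
      obtain ⟨hs3, hs4⟩ := hsnd _ hP3s
      by_cases hw0 : σw = 0
      · refine ⟨_, hs1, by rw [hs2]; exact hbig2, B2, hBB, -σz, ?_⟩
        intro j hj s hs
        obtain ⟨p, hp, rfl⟩ := Finset.mem_image.mp hj
        rw [hf1, sign_case1 (hneg p hp) ((hw p hp s hs).trans hw0), hz p hp s hs]
      · by_cases hwz : σz = σw
        · refine ⟨_, hs3, by rw [hs4]; exact hbig2, B2, hBB, σw, ?_⟩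
          intro j hj s hs
          obtain ⟨p, hp, rfl⟩ := Finset.mem_image.mp hj
          have := (hSle p (hP3s hp)).2
          have := hneg p hp
          rw [hf2 p s (by linarith), sign_case2 (hSle p (hP3s hp)).2 ((hz p hp s hs).trans (hwz.trans (hw p hp s hs).symm)), hw p hp s hs]
        · refine ⟨_, hs1, by rw [hs2]; exact hbig2, B2, hBB, σw, ?_⟩
          intro j hj s hs
          obtain ⟨p, hp, rfl⟩ := Finset.mem_image.mp hj
          rw [hf1, sign_case3 (hneg p hp) (by rw [hw p hp s hs]; exact hw0) (by rw [hw p hp s hs, hz p hp s hs]; exact hwz), hw p hp s hs]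

end PachAux

namespace PachAux

/-- functions affine in each of `k` vector arguments separately -/
def MA (m k : ℕ) : Submodule ℝ ((Fin k → Fin m → ℝ) → ℝ) where
  carrier := {f | ∀ i x y, f (Function.update x i y) = f (Function.update x i 0) +
    ∑ j, y j * (f (Function.update x i (Pi.single j 1)) - f (Function.update x i 0))}
  add_mem' := by
    intro f g hf hg i x y
    simp only [Pi.add_apply]
    rw [hf i x y, hg i x y, add_add_add_comm, ← Finset.sum_add_distrib]
    congr 1
    apply Finset.sum_congr rfl
    intro j _
    ring
  zero_mem' := by
    intro i x y
    simp
  smul_mem' := by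
    intro c f hf i x y
    simp only [Pi.smul_apply, smul_eq_mul]
    rw [hf i x y, mul_add, Finset.mul_sum]
    congr 1
    apply Finset.sum_congr rfl
    intro j _
    ring

theorem MA_hom (m : ℕ) : ∀ k : ℕ, ∃ c : ℝ, 0 < c ∧ c ≤ 1 ∧ ∀ (ι : Type) (pts : Fin k → ι → Fin m → ℝ),
    HomC c ((MA m k).map (LinearMap.funLeft ℝ ℝ (fun (s : Fin k → ι) i => pts i (s i)))) := by
  intro k
  induction k with
  | zero =>
    refine ⟨1, one_pos, le_rfl, ?_⟩
    intro ι pts g _ B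
    refine ⟨B, fun i => i.elim0, SignType.sign (g Fin.elim0), ?_⟩
    intro s _
    rw [Subsingleton.elim s Fin.elim0]
  | succ k ih =>
    obtain ⟨c, hc, hc1, ih⟩ := ih
    obtain ⟨e, he, he1, h⟩ := affine_hom m c hc
    refine ⟨e, he, he1, ?_⟩
    rintro ι pts _ ⟨f, hf, rfl⟩ B
    have hcons : ∀ y0 : Fin m → ℝ, (fun x : Fin k → Fin m → ℝ => f (Fin.cons y0 x)) ∈ MA m k := by
      intro y0 i x y
      simp only [Fin.cons_update]
      exact hf _ _ _
    have hG : ∀ q ∈ MA m k, (fun s : Fin k → ι => q (fun i => pts i.succ (s i))) ∈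
        (MA m k).map (LinearMap.funLeft ℝ ℝ (fun (s : Fin k → ι) i => pts i.succ (s i))) :=
      fun q hq => ⟨q, hq, rfl⟩
    obtain ⟨Y', hY', hYc, B', hB', σ, hσ⟩ := h k ι _ (ih ι (fun i => pts i.succ)) ι (B 0) (pts 0)
      _ (fun j => _) (hG _ (hcons 0)) (fun j => hG _ ((MA m k).sub_mem (hcons (Pi.single j 1)) (hcons 0)))
      (fun i => B i.succ)
    refine ⟨Fin.cons Y' B', ?_, σ, ?_⟩
    · intro i
      refine Fin.cases ⟨hY', hYc⟩ (fun i => ?_) i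
      simpa using hB' i
    · intro s hs
      have h0 := hs 0
      have h1 : ∀ i : Fin k, s i.succ ∈ B' i := fun i => hs i.succ
      rw [← hσ (s 0) h0 (fun i => s i.succ) h1]
      congr 1
      have h2 := hf 0 (fun i => pts i (s i)) (pts 0 (s 0))
      have h3 : ∀ y0, Function.update (fun i => pts i (s i)) 0 y0 = Fin.cons y0 (fun i : Fin k => pts i.succ (s i.succ)) := by
        intro y0
        ext i
        refine Fin.cases ?_ (fun i => ?_) i <;> simp
      simp only [Function.update_eq_self] at h2
      simp only [h3] at h2
      exact h2

theorem list_hom (m k : ℕ) : ∀ N : ℕ, ∃ c : ℝ, 0 < c ∧ c ≤ 1 ∧ ∀ (ι : Type) (pts : Fin k → ι → Fin m → ℝ)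
    (f : Fin N → (Fin k → Fin m → ℝ) → ℝ), (∀ j, f j ∈ MA m k) → ∀ B : Fin k → Finset ι,
    ∃ B' : Fin k → Finset ι, (∀ i, B' i ⊆ B i ∧ c * (B i).card ≤ (B' i).card) ∧
      ∃ σ : Fin N → SignType, ∀ s : Fin k → ι, (∀ i, s i ∈ B' i) → ∀ j, SignType.sign (f j (fun i => pts i (s i))) = σ j := by
  obtain ⟨c0, hc0, hc01, h0⟩ := MA_hom m k
  intro N
  induction N with
  | zero =>
    refine ⟨1, one_pos, le_rfl, fun ι pts f _ B => ⟨B, fun i => ⟨subset_rfl, by rw [one_mul]⟩, Fin.elim0, fun s _ j => j.elim0⟩⟩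
  | succ N ih =>
    obtain ⟨c, hc, hc1, ih⟩ := ih
    refine ⟨c0 * c, by positivity, by nlinarith, ?_⟩
    intro ι pts f hf B
    obtain ⟨B1, hB1, σ1, h1⟩ := ih ι pts (fun j => f j.succ) (fun j => hf _) B
    obtain ⟨B2, hB2, σ2, h2⟩ := h0 ι pts _ ⟨f 0, hf 0, rfl⟩ B1
    refine ⟨B2, fun i => ⟨(hB2 i).1.trans (hB1 i).1, ?_⟩, Fin.cons σ2 σ1, ?_⟩
    · refine le_trans ?_ (hB2 i).2
      rw [mul_assoc]
      exact mul_le_mul_of_nonneg_left (hB1 i).2 hc0.le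
    · intro s hs j
      refine Fin.cases ?_ (fun j => ?_) j
      · exact h2 s hs
      · exact h1 s (fun i => (hB2 i).1 (hs i)) j

theorem MA_det (k : ℕ) : (fun x : Fin k → Fin k → ℝ => Matrix.det (Matrix.of x)) ∈ MA k k := by
  intro i x y
  let ℓ : (Fin k → ℝ) →ₗ[ℝ] ℝ := (Matrix.detRowAlternating (n := Fin k) (R := ℝ)).toMultilinearMap.toLinearMap x i
  have hl : ∀ z, Matrix.det (Matrix.of (Function.update x i z)) = ℓ z := fun z => rfl
  simp only [hl, map_zero, sub_zero, zero_add]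
  conv_lhs => rw [LinearMap.pi_apply_eq_sum_univ ℓ y]
  apply Finset.sum_congr rfl
  intro j _
  rw [smul_eq_mul]
  congr 2
  ext l
  simp [Pi.single_apply, eq_comm]

theorem MA_det_update (k : ℕ) (p : Fin k → ℝ) (a : Fin k) :
    (fun x : Fin k → Fin k → ℝ => Matrix.det (Matrix.of (Function.update x a p))) ∈ MA k k := by
  intro i x y
  by_cases h : i = a
  · subst h
    simp
  · simp only [Function.update_comm h]
    exact MA_det k i _ y
end PachAux

namespace PachAux

/-- homogeneous coordinates -/
def hat {d : ℕ} (x : EuclideanSpace ℝ (Fin d)) : Fin (d+1) → ℝ := Fin.cons 1 (fun i => x i)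

theorem conv_weights {d k : ℕ} {x : Fin k → EuclideanSpace ℝ (Fin d)} {p : EuclideanSpace ℝ (Fin d)}
    (hp : p ∈ convexHull ℝ (Set.range x)) : ∃ w : Fin k → ℝ, (∀ i, 0 ≤ w i) ∧ ∑ i, w i = 1 ∧ ∑ i, w i • x i = p := by
  rw [convexHull_range_eq_exists_affineCombination] at hp
  obtain ⟨s, w, hw0, hw1, hwp⟩ := hp
  rw [Finset.affineCombination_eq_linear_combination _ _ _ hw1] at hwp
  refine ⟨fun i => if i ∈ s then w i else 0, ?_, ?_, ?_⟩
  · intro i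
    simp only
    split_ifs with h
    · exact hw0 i h
    · exact le_rfl
  · simpa using hw1
  · simpa [ite_smul] using hwp

theorem mem_conv_iff {d : ℕ} (x : Fin (d+1) → EuclideanSpace ℝ (Fin d)) (p : EuclideanSpace ℝ (Fin d))
    (hdet : Matrix.det (Matrix.of fun i => hat (x i)) ≠ 0) :
    p ∈ convexHull ℝ (Set.range x) ↔
      ∀ i, 0 ≤ Matrix.det (Matrix.of (Function.update (fun i => hat (x i)) i (hat p))) / Matrix.det (Matrix.of fun i => hat (x i)) := by
  set A := Matrix.of fun i => hat (x i) with hA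
  have hup : ∀ i v, Matrix.of (Function.update (fun i => hat (x i)) i v) = A.updateRow i v := fun i v => rfl
  simp only [hup]
  constructor
  · intro hp i
    obtain ⟨w', hw0, h1, h2⟩ := conv_weights hp
    have h3 : hat p = ∑ k, w' k • A k := by
      ext j
      rw [Finset.sum_apply]
      simp only [Pi.smul_apply, hA, Matrix.of_apply, smul_eq_mul]
      refine Fin.cases ?_ (fun j => ?_) j
      · simp [hat, h1]
      · simp [hat, ← h2]
    rw [h3, Matrix.det_updateRow_sum, smul_eq_mul, mul_div_assoc, div_self hdet, mul_one]
    exact hw0 i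
  · intro h
    set w : Fin (d+1) → ℝ := fun i => (A.updateRow i (hat p)).det / A.det with hw
    have hcr : ∀ j, ∑ i, w i * A i j = hat p j := by
      intro j
      have := congrFun (Matrix.mulVec_cramer A.transpose (hat p)) j
      simp only [Matrix.mulVec, dotProduct, Matrix.transpose_apply, Matrix.cramer_apply, Matrix.det_transpose, Pi.smul_apply, smul_eq_mul] at this
      simp only [Matrix.updateCol_transpose, Matrix.det_transpose] at this
      rw [← mul_right_inj' hdet, ← this, Finset.mul_sum]
      apply Finset.sum_congr rfl
      intro i _
      simp only [hw]
      field_simp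
    have hsum : ∑ i, w i = 1 := by
      have := hcr 0
      simpa [hA, hat] using this
    have hp : p = ∑ i, w i • x i := by
      ext j
      have := hcr j.succ
      simp only [hA, hat, Matrix.of_apply, Fin.cons_succ] at this
      simp [← this]
    rw [hp]
    exact (convex_convexHull ℝ _).sum_mem (fun i _ => h i) hsum (fun i _ => subset_convexHull ℝ _ ⟨i, rfl⟩)

theorem sign_div (a b : ℝ) : 0 ≤ a / b ↔ 0 ≤ ((SignType.sign a : SignType) * SignType.sign b) := by
  rw [← sign_mul, sign_nonneg_iff, div_nonneg_iff, mul_nonneg_iff]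

theorem all_or_none (d : ℕ) : ∃ c : ℝ, 0 < c ∧ c ≤ 1 ∧ ∀ (ι : Type) (x : Fin (d+1) → ι → EuclideanSpace ℝ (Fin d)),
    (∀ s : Fin (d+1) → ι, Matrix.det (Matrix.of fun i => hat (x i (s i))) ≠ 0) →
    ∀ (p : EuclideanSpace ℝ (Fin d)) (B : Fin (d+1) → Finset ι), ∃ B' : Fin (d+1) → Finset ι,
      (∀ i, B' i ⊆ B i ∧ c * (B i).card ≤ (B' i).card) ∧
      ((∀ s : Fin (d+1) → ι, (∀ i, s i ∈ B' i) → p ∈ convexHull ℝ (Set.range fun i => x i (s i))) ∨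
       (∀ s : Fin (d+1) → ι, (∀ i, s i ∈ B' i) → p ∉ convexHull ℝ (Set.range fun i => x i (s i)))) := by
  obtain ⟨c, hc, hc1, h⟩ := list_hom (d+1) (d+1) (d+1+1)
  refine ⟨c, hc, hc1, fun ι x hx p B => ?_⟩
  obtain ⟨B', hB', σ, hσ⟩ := h ι (fun i j => hat (x i j))
    (Fin.cons (fun x => Matrix.det (Matrix.of x)) (fun a x => Matrix.det (Matrix.of (Function.update x a (hat p)))))
    (fun j => Fin.cases (MA_det (d+1)) (fun a => MA_det_update (d+1) (hat p) a) j) B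
  refine ⟨B', hB', ?_⟩
  have key : ∀ s : Fin (d+1) → ι, (∀ i, s i ∈ B' i) → (p ∈ convexHull ℝ (Set.range fun i => x i (s i)) ↔
      ∀ i : Fin (d+1), 0 ≤ σ i.succ * σ 0) := by
    intro s hs
    rw [mem_conv_iff _ _ (hx s)]
    apply forall_congr'
    intro i
    have h0 := hσ s hs 0
    have h1 := hσ s hs i.succ
    simp only [Fin.cons_zero, Fin.cons_succ] at h0 h1
    rw [sign_div, h0, h1]
  by_cases hall : ∀ i : Fin (d+1), 0 ≤ σ i.succ * σ 0
  · exact Or.inl fun s hs => (key s hs).mpr hall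
  · exact Or.inr fun s hs hp => hall ((key s hs).mp hp)

end PachAux

namespace PachAux
open Classical in
/-- number of transversals of the box with the property -/
noncomputable def cnt {r : ℕ} {ι : Type} (P : (Fin r → ι) → Prop) (B : Fin r → Finset ι) : ℕ :=
  ((Fintype.piFinset B).filter P).card

theorem cnt_split {r : ℕ} {ι : Type} [DecidableEq ι] (P : (Fin r → ι) → Prop) (E : Fin r → Finset ι) (i : Fin r)
    (D : Finset ι) (hD : D ⊆ E i) :
    cnt P E = cnt P (Function.update E i D) + cnt P (Function.update E i (E i \ D)) := by
  classical
  unfold cnt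
  rw [← Finset.card_filter_add_card_filter_not (s := (Fintype.piFinset E).filter P) (fun s => s i ∈ D)]
  congr 2
  · ext s
    simp only [Finset.mem_filter, Fintype.mem_piFinset]
    constructor
    · rintro ⟨⟨h1, h2⟩, h3⟩
      refine ⟨fun l => ?_, h2⟩
      by_cases hl : l = i
      · subst hl; simpa using h3
      · simpa [hl] using h1 l
    · rintro ⟨h1, h2⟩
      have h3 : s i ∈ D := by simpa using h1 i
      refine ⟨⟨fun l => ?_, h2⟩, h3⟩
      by_cases hl : l = i
      · subst hl; exact hD h3
      · simpa [hl] using h1 l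
  · ext s
    simp only [Finset.mem_filter, Fintype.mem_piFinset]
    constructor
    · rintro ⟨⟨h1, h2⟩, h3⟩
      refine ⟨fun l => ?_, h2⟩
      by_cases hl : l = i
      · subst hl; simpa using ⟨h1 l, h3⟩
      · simpa [hl] using h1 l
    · rintro ⟨h1, h2⟩
      have h3 : s i ∈ E i \ D := by simpa using h1 i
      rw [Finset.mem_sdiff] at h3
      refine ⟨⟨fun l => ?_, h2⟩, h3.2⟩
      by_cases hl : l = i
      · subst hl; exact h3.1
      · simpa [hl] using h1 l

theorem cnt_true {r : ℕ} {ι : Type} (B : Fin r → Finset ι) : cnt (fun _ => True) B = ∏ i, (B i).card := by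
  classical
  simp [cnt, Fintype.card_piFinset]

theorem cnt_le {r : ℕ} {ι : Type} (P : (Fin r → ι) → Prop) (B : Fin r → Finset ι) :
    cnt P B ≤ cnt (fun _ => True) B := by
  classical
  unfold cnt
  apply Finset.card_le_card
  intro s
  simp only [Finset.mem_filter]
  tauto

theorem telescoping {r : ℕ} {ι : Type} [DecidableEq ι] (P : (Fin r → ι) → Prop) (B D : Fin r → Finset ι)
    (hD : ∀ i, D i ⊆ B i) (δ : ℝ) (hcon : ∀ X : Fin r → Finset ι, ∀ i, (∀ l, l ≠ i → X l = D l ∨ X l = B l) → X i = B i \ D i →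
      (cnt P X : ℝ) ≤ δ * cnt (fun _ => True) X) :
    (cnt P B : ℝ) - δ * cnt (fun _ => True) B ≤ cnt P D - δ * cnt (fun _ => True) D := by
  let E : ℕ → Fin r → Finset ι := fun k l => if l.val < k then D l else B l
  have key : ∀ k ≤ r, (cnt P B : ℝ) - δ * cnt (fun _ => True) B ≤ cnt P (E k) - δ * cnt (fun _ => True) (E k) := by
    intro k
    induction k with
    | zero =>
      intro _
      have : E 0 = B := by ext l; simp [E]
      rw [this]
    | succ k ih =>
      intro hk
      refine (ih (by omega)).trans ?_
      let i : Fin r := ⟨k, by omega⟩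
      have hEi : E k i = B i := by simp [E, i]
      have hup : E (k+1) = Function.update (E k) i (D i) := by
        funext l
        by_cases hl : l = i
        · subst hl; simp [E, i]
        · have : l.val ≠ k := fun h => hl (Fin.ext h)
          rw [Function.update_of_ne hl]
          simp only [E]
          congr 1
          apply propext
          omega
      have h1 := cnt_split P (E k) i (D i) (by rw [hEi]; exact hD i)
      have h2 := cnt_split (fun _ => True) (E k) i (D i) (by rw [hEi]; exact hD i)
      rw [← hup, hEi] at h1 h2
      have h3 := hcon (Function.update (E k) i (B i \ D i)) i (by
        intro l hl
        rw [Function.update_of_ne hl]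
        simp only [E]
        split_ifs
        · exact Or.inl rfl
        · exact Or.inr rfl) (by simp)
      rw [h1, h2]
      push_cast
      linarith
  have : E r = D := by
    funext l
    simp [E]
  rw [← this]
  exact key r le_rfl

theorem increment {r : ℕ} (c : ℝ) (hc : 0 < c) (hc3 : c ≤ 1/3) : ∀ j : ℕ, ∃ c' : ℝ, 0 < c' ∧ c' ≤ 1 ∧
    ∀ (ι : Type) (P : (Fin r → ι) → Prop),
    (∀ B : Fin r → Finset ι, ∃ B' : Fin r → Finset ι, (∀ i, B' i ⊆ B i ∧ c * (B i).card ≤ (B' i).card) ∧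
      ((∀ s, (∀ i, s i ∈ B' i) → P s) ∨ (∀ s, (∀ i, s i ∈ B' i) → ¬ P s))) →
    ∀ B : Fin r → Finset ι, (1 - c ^ r) ^ j * cnt (fun _ => True) B < cnt P B →
      ∃ B' : Fin r → Finset ι, (∀ i, B' i ⊆ B i ∧ c' * (B i).card ≤ (B' i).card) ∧
        (∀ s, (∀ i, s i ∈ B' i) → P s) := by
  classical
  intro j
  induction j with
  | zero =>
    refine ⟨1, one_pos, le_rfl, fun ι P _ B hB => ?_⟩
    rw [pow_zero, one_mul] at hB
    have : (cnt P B : ℝ) ≤ cnt (fun _ => True) B := by exact_mod_cast cnt_le P B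
    linarith
  | succ j ih =>
    obtain ⟨e, he, he1, ih⟩ := ih
    refine ⟨c * e, by positivity, by nlinarith, fun ι P hP B hB => ?_⟩
    obtain ⟨B0, hB0, hor⟩ := hP B
    have hDex : ∀ i, ∃ D ⊆ B0 i, D.card = ⌈c * (B i).card⌉₊ := fun i =>
      Finset.exists_subset_card_eq (Nat.ceil_le.mpr (hB0 i).2)
    choose D hDB hDc using hDex
    have hDsub : ∀ i, D i ⊆ B i := fun i => (hDB i).trans (hB0 i).1
    have hDge : ∀ i, c * (B i).card ≤ (D i).card := fun i => by rw [hDc]; exact Nat.le_ceil _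
    rcases hor with hall | hnone
    · refine ⟨D, fun i => ⟨hDsub i, ?_⟩, fun s hs => hall s fun i => hDB i (hs i)⟩
      refine le_trans ?_ (hDge i)
      apply mul_le_mul_of_nonneg_right _ (Nat.cast_nonneg _)
      nlinarith
    · have hc1 : c ^ r ≤ 1 := pow_le_one₀ hc.le (by linarith)
      set δ := (1 - c ^ r) ^ j with hδ
      have hδ0 : 0 ≤ δ := pow_nonneg (by linarith) _
      have hex : ∃ X : Fin r → Finset ι, ∃ i, (∀ l, l ≠ i → X l = D l ∨ X l = B l) ∧ X i = B i \ D i ∧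
          δ * cnt (fun _ => True) X < cnt P X := by
        by_contra hcon
        push Not at hcon
        have h1 := telescoping P B D hDsub δ hcon
        have h2 : cnt P D = 0 := by
          unfold cnt
          rw [Finset.card_eq_zero, Finset.filter_eq_empty_iff]
          intro s hs
          rw [Fintype.mem_piFinset] at hs
          exact hnone s fun i => hDB i (hs i)
        have h3 : c ^ r * cnt (fun _ => True) B ≤ cnt (fun _ => True) D := by
          rw [cnt_true, cnt_true]
          push_cast
          have : c ^ r = ∏ i : Fin r, c := by simp
          rw [this, ← Finset.prod_mul_distrib]
          apply Finset.prod_le_prod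
          · intro i _; positivity
          · intro i _; exact hDge i
        rw [pow_succ] at hB
        rw [h2] at h1
        have := mul_le_mul_of_nonneg_left h3 hδ0
        push_cast at h1
        nlinarith
      obtain ⟨X, i, hX1, hX2, hX3⟩ := hex
      obtain ⟨B', hB', hB'P⟩ := ih ι P hP X hX3
      have hXne : (X i).card ≠ 0 := by
        intro h0
        have : cnt (fun _ => True) X = 0 := by
          rw [cnt_true]; exact Finset.prod_eq_zero (Finset.mem_univ i) h0
        have h5 := cnt_le P X
        have h6 : cnt P X = 0 := by omega
        rw [this, h6] at hX3
        simp at hX3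
      have hXl : ∀ l, X l ⊆ B l ∧ c * (B l).card ≤ (X l).card := by
        intro l
        by_cases hl : l = i
        · subst hl
          refine ⟨by rw [hX2]; exact Finset.sdiff_subset, ?_⟩
          have h1 : (X l).card + (D l).card = (B l).card := by
            rw [hX2]; exact Finset.card_sdiff_add_card_eq_card (hDsub l)
          have h2 : ((X l).card : ℝ) + (D l).card = (B l).card := by exact_mod_cast h1
          have h3 : ((D l).card : ℝ) < c * (B l).card + 1 := by
            rw [hDc]; exact Nat.ceil_lt_add_one (by positivity)
          have h4 : (1:ℝ) ≤ (X l).card := by exact_mod_cast Nat.one_le_iff_ne_zero.mpr hXne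
          have h5 : c * (B l).card ≤ 1/3 * (B l).card := mul_le_mul_of_nonneg_right hc3 (Nat.cast_nonneg _)
          linarith
        · rcases hX1 l hl with h | h
          · rw [h]; exact ⟨hDsub l, hDge l⟩
          · rw [h]; refine ⟨subset_rfl, ?_⟩
            have : (0:ℝ) ≤ (B l).card := Nat.cast_nonneg _
            nlinarith
      refine ⟨B', fun l => ⟨(hB' l).1.trans (hXl l).1, ?_⟩, hB'P⟩
      refine le_trans ?_ (hB' l).2
      rw [mul_comm c e, mul_assoc]
      exact mul_le_mul_of_nonneg_left (hXl l).2 he.le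

theorem increment_final {r : ℕ} (c : ℝ) (hc : 0 < c) (hc3 : c ≤ 1/3) (δ : ℝ) (hδ : 0 < δ) : ∃ c' : ℝ, 0 < c' ∧
    ∀ (ι : Type) (P : (Fin r → ι) → Prop),
    (∀ B : Fin r → Finset ι, ∃ B' : Fin r → Finset ι, (∀ i, B' i ⊆ B i ∧ c * (B i).card ≤ (B' i).card) ∧
      ((∀ s, (∀ i, s i ∈ B' i) → P s) ∨ (∀ s, (∀ i, s i ∈ B' i) → ¬ P s))) →
    ∀ B : Fin r → Finset ι, 0 < ∏ i, (B i).card → δ * ((∏ i, (B i).card : ℕ) : ℝ) ≤ cnt P B →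
      ∃ B' : Fin r → Finset ι, (∀ i, B' i ⊆ B i ∧ c' * (B i).card ≤ (B' i).card) ∧
        (∀ s, (∀ i, s i ∈ B' i) → P s) := by
  have hcr : 0 < c ^ r := pow_pos hc r
  obtain ⟨j, hj⟩ := exists_pow_lt_of_lt_one hδ (show 1 - c ^ r < 1 by linarith)
  obtain ⟨c', hc', _, h⟩ := increment (r := r) c hc hc3 j
  refine ⟨c', hc', fun ι P hP B hB0 hB => h ι P hP B (lt_of_lt_of_le ?_ hB)⟩
  rw [cnt_true]
  apply mul_lt_mul_of_pos_right hj
  exact_mod_cast hB0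
end PachAux

namespace PachAux

open Filter Topology

theorem generic_case (d : ℕ) : ∃ c : ℝ, 0 < c ∧ ∀ n : ℕ, 0 < n →
    ∀ x : Fin (d+1) → Fin n → EuclideanSpace ℝ (Fin d),
    (∀ s : Fin (d+1) → Fin n, Matrix.det (Matrix.of fun i => hat (x i (s i))) ≠ 0) →
    ∃ (p : EuclideanSpace ℝ (Fin d)) (D : Fin (d+1) → Finset (Fin n)), (∀ i, c * n ≤ (D i).card) ∧
      ∀ s : Fin (d+1) → Fin n, (∀ i, s i ∈ D i) → p ∈ convexHull ℝ (Set.range fun i => x i (s i)) := by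
  classical
  obtain ⟨δ, hδ, hsel⟩ := selection d
  obtain ⟨c0, hc0, _, haon⟩ := all_or_none d
  obtain ⟨c, hc, hinc⟩ := increment_final (r := d+1) (min c0 (1/3)) (lt_min hc0 (by norm_num)) (min_le_right _ _) δ hδ
  refine ⟨c, hc, fun n hn x hx => ?_⟩
  obtain ⟨p, A, hA, hAp⟩ := hsel n hn x
  obtain ⟨B', hB', hB'P⟩ := hinc (Fin n) (fun s => p ∈ convexHull ℝ (Set.range fun i => x i (s i)))
    (by
      intro B
      obtain ⟨B', hB', hor⟩ := haon (Fin n) x hx p B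
      refine ⟨B', fun i => ⟨(hB' i).1, le_trans ?_ (hB' i).2⟩, hor⟩
      exact mul_le_mul_of_nonneg_right (min_le_left _ _) (Nat.cast_nonneg _))
    (fun _ => Finset.univ) (by simp [hn]) (by
      simp only [Finset.card_univ, Fintype.card_fin, Finset.prod_const]
      push_cast
      refine hA.trans ?_
      unfold cnt
      norm_cast
      apply Finset.card_le_card
      intro s hs
      simp only [Finset.mem_filter, Fintype.mem_piFinset, Finset.mem_univ, implies_true, true_and]
      exact hAp s hs)
  have hBc : ∀ i, c * n ≤ ((B' i).card : ℝ) := fun i => by simpa using (hB' i).2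
  exact ⟨p, B', hBc, fun s hs => by exact hB'P s hs⟩

/-- vertices of the standard simplex with the origin -/
noncomputable def simp0 (d : ℕ) : Fin (d+1) → EuclideanSpace ℝ (Fin d) :=
  Fin.cons 0 (fun i => EuclideanSpace.single i 1)

theorem simp0_det (d : ℕ) : Matrix.det (Matrix.of fun i => hat (simp0 d i)) ≠ 0 := by
  rw [Matrix.det_of_isLowerTriangular]
  · rw [Finset.prod_eq_one]
    · exact one_ne_zero
    · intro i _
      refine Fin.cases ?_ (fun i => ?_) i
      · simp [hat]
      · simp [hat, simp0]
  · intro i j hij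
    have hij' : i < j := hij
    revert hij'
    refine Fin.cases ?_ (fun i => ?_) i
    · refine Fin.cases ?_ (fun j => ?_) j
      · intro h; exact absurd h (lt_irrefl _)
      · intro _; simp [hat, simp0]
    · refine Fin.cases ?_ (fun j => ?_) j
      · intro h; exact absurd h (by simp)
      · intro h
        have : j ≠ i := by
          rintro rfl; exact lt_irrefl _ h
        simp [hat, simp0, this]

theorem det_eventually {d : ℕ} (x : Fin (d+1) → EuclideanSpace ℝ (Fin d)) :
    ∀ᶠ t in 𝓝[≠] (0:ℝ), Matrix.det (Matrix.of fun i => hat ((1 - t) • x i + t • simp0 d i)) ≠ 0 := by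
  let A := Matrix.of fun i => hat (x i)
  let V := Matrix.of fun i => hat (simp0 d i)
  let q : Polynomial ℝ := ((Polynomial.X : Polynomial ℝ) • (V - A).map Polynomial.C + A.map Polynomial.C).det
  have hq : ∀ t, q.eval t = Matrix.det (Matrix.of fun i => hat ((1 - t) • x i + t • simp0 d i)) := by
    intro t
    change Polynomial.evalRingHom t _ = _
    rw [RingHom.map_det]
    congr 1
    ext i j
    simp only [RingHom.mapMatrix_apply, Matrix.map_apply, Matrix.add_apply, Matrix.smul_apply, smul_eq_mul, Matrix.sub_apply,
      Polynomial.coe_evalRingHom, Polynomial.eval_add, Polynomial.eval_mul, Polynomial.eval_X, Polynomial.eval_C, V, A, Matrix.of_apply]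
    refine Fin.cases ?_ (fun j => ?_) j
    · simp [hat]
    · simp [hat]; ring
  have hq0 : q ≠ 0 := by
    intro h
    have h1 := hq 1
    rw [h, Polynomial.eval_zero] at h1
    apply simp0_det d
    rw [h1]
    simp
  have hfin : {t | q.eval t = 0}.Finite := by
    refine (q.roots.toFinset.finite_toSet).subset ?_
    intro t ht
    simp only [Finset.mem_coe, Multiset.mem_toFinset, Polynomial.mem_roots hq0]
    exact ht
  have := nhdsNE_le_cofinite (0:ℝ) hfin.compl_mem_cofinite
  filter_upwards [this] with t ht
  rw [← hq]
  exact ht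

theorem conv_limit {d k : ℕ} (U : Ultrafilter ℝ) (p : ℝ → EuclideanSpace ℝ (Fin d))
    (z : ℝ → Fin k → EuclideanSpace ℝ (Fin d)) (z0 : Fin k → EuclideanSpace ℝ (Fin d))
    (hz : ∀ i, Tendsto (fun t => z t i) U (𝓝 (z0 i)))
    (hp : ∀ᶠ t in (U : Filter ℝ), p t ∈ convexHull ℝ (Set.range (z t))) :
    ∃ p0 ∈ convexHull ℝ (Set.range z0), Tendsto p U (𝓝 p0) := by
  classical
  have hex : ∀ t, ∃ w : Fin k → ℝ, p t ∈ convexHull ℝ (Set.range (z t)) → 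
      w ∈ stdSimplex ℝ (Fin k) ∧ ∑ i, w i • z t i = p t := by
    intro t
    by_cases h : p t ∈ convexHull ℝ (Set.range (z t))
    · obtain ⟨w, h1, h2, h3⟩ := conv_weights h
      exact ⟨w, fun _ => ⟨⟨h1, h2⟩, h3⟩⟩
    · exact ⟨0, fun h' => absurd h' h⟩
  choose w hw using hex
  have hmem : ∀ᶠ t in (U : Filter ℝ), w t ∈ stdSimplex ℝ (Fin k) := hp.mono fun t ht => (hw t ht).1
  obtain ⟨w0, hw0, hlim⟩ := (isCompact_stdSimplex ℝ (Fin k)).ultrafilter_le_nhds (U.map w) (by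
    rw [Ultrafilter.coe_map, le_principal_iff]
    exact hmem)
  have hlim' : Tendsto w U (𝓝 w0) := hlim
  refine ⟨∑ i, w0 i • z0 i, ?_, ?_⟩
  · exact (convex_convexHull ℝ _).sum_mem (fun i _ => hw0.1 i) hw0.2 (fun i _ => subset_convexHull ℝ _ ⟨i, rfl⟩)
  · have : Tendsto (fun t => ∑ i, w t i • z t i) U (𝓝 (∑ i, w0 i • z0 i)) :=
      tendsto_finsetSum _ fun i _ => ((tendsto_pi_nhds.mp hlim' i).smul (hz i))
    exact this.congr' (hp.mono fun t ht => (hw t ht).2)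

theorem index_case (d : ℕ) : ∃ c : ℝ, 0 < c ∧ ∀ n : ℕ, 0 < n →
    ∀ x : Fin (d+1) → Fin n → EuclideanSpace ℝ (Fin d),
    ∃ (p : EuclideanSpace ℝ (Fin d)) (D : Fin (d+1) → Finset (Fin n)), (∀ i, c * n ≤ (D i).card) ∧
      ∀ s : Fin (d+1) → Fin n, (∀ i, s i ∈ D i) → p ∈ convexHull ℝ (Set.range fun i => x i (s i)) := by
  classical
  obtain ⟨c, hc, hgen⟩ := generic_case d
  refine ⟨c, hc, fun n hn x => ?_⟩
  let X : ℝ → Fin (d+1) → Fin n → EuclideanSpace ℝ (Fin d) := fun t i j => (1 - t) • x i j + t • simp0 d i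
  have hX : ∀ i j, Tendsto (fun t => X t i j) (𝓝 0) (𝓝 (x i j)) := by
    intro i j
    have : Continuous (fun t => X t i j) := by fun_prop
    simpa [X] using this.tendsto 0
  have hev : ∀ᶠ t in 𝓝[≠] (0:ℝ), ∀ s : Fin (d+1) → Fin n, Matrix.det (Matrix.of fun i => hat (X t i (s i))) ≠ 0 :=
    eventually_all.mpr fun s => det_eventually fun i => x i (s i)
  let U : Ultrafilter ℝ := Ultrafilter.of (𝓝[≠] (0:ℝ))
  have hU : (U : Filter ℝ) ≤ 𝓝[≠] 0 := Ultrafilter.of_le _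
  have hU0 : (U : Filter ℝ) ≤ 𝓝 0 := hU.trans nhdsWithin_le_nhds
  have hex : ∀ t, ∃ pD : EuclideanSpace ℝ (Fin d) × (Fin (d+1) → Finset (Fin n)),
      (∀ s : Fin (d+1) → Fin n, Matrix.det (Matrix.of fun i => hat (X t i (s i))) ≠ 0) →
      (∀ i, c * n ≤ (pD.2 i).card) ∧
      ∀ s : Fin (d+1) → Fin n, (∀ i, s i ∈ pD.2 i) → pD.1 ∈ convexHull ℝ (Set.range fun i => X t i (s i)) := by
    intro t
    by_cases h : ∀ s : Fin (d+1) → Fin n, Matrix.det (Matrix.of fun i => hat (X t i (s i))) ≠ 0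
    · obtain ⟨p, D, h1⟩ := hgen n hn (X t) h
      exact ⟨(p, D), fun _ => h1⟩
    · exact ⟨(0, fun _ => ∅), fun h' => absurd h' h⟩
  choose pD hpD using hex
  have hgood := hU hev
  obtain ⟨D, hD⟩ := Ultrafilter.eq_pure_of_finite (U.map fun t => (pD t).2)
  have hDev : ∀ᶠ t in (U : Filter ℝ), (pD t).2 = D := by
    have : {D} ∈ U.map fun t => (pD t).2 := by rw [hD]; exact Ultrafilter.mem_pure.mpr rfl
    exact this
  have hcard : ∀ i, c * n ≤ (D i).card := by
    obtain ⟨t, h1, h2⟩ := (hDev.and hgood).exists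
    have := (hpD t h2).1
    rwa [h1] at this
  have hlim : ∀ s : Fin (d+1) → Fin n, (∀ i, s i ∈ D i) → ∃ p0 ∈ convexHull ℝ (Set.range fun i => x i (s i)),
      Tendsto (fun t => (pD t).1) U (𝓝 p0) := by
    intro s hs
    apply conv_limit U (fun t => (pD t).1) (fun t i => X t i (s i)) (fun i => x i (s i))
    · intro i
      exact (hX i (s i)).mono_left hU0
    · filter_upwards [hDev, hgood] with t h1 h2
      exact (hpD t h2).2 s fun i => by rw [h1]; exact hs i
  have hne : ∀ i, (D i).Nonempty := by
    intro i
    rw [← Finset.card_pos]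
    have : 0 < c * (n:ℝ) := by positivity
    exact_mod_cast this.trans_le (hcard i)
  choose s0 hs0 using hne
  obtain ⟨p0, _, hp0⟩ := hlim s0 hs0
  refine ⟨p0, D, hcard, fun s hs => ?_⟩
  obtain ⟨p1, hp1, hp1'⟩ := hlim s hs
  rw [tendsto_nhds_unique hp0 hp1']
  exact hp1

end PachAux

/-- **Pach's homogeneous selection theorem.** For every `d ≥ 1` there is `c(d) > 0` such
that for any `d+1` finite sets `C 0, …, C d` in `ℝ^d`, each of size `n`, there are a point
`p` and subsets `D i ⊆ C i`, each of size at least `c(d)·n`, such that the convex hull of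
every transversal of `D 0, …, D d` contains `p`. -/
theorem pach_selection (d : ℕ) (hd : 1 ≤ d) :
    ∃ c : ℝ, 0 < c ∧
      ∀ (n : ℕ) (C : Fin (d + 1) → Finset (EuclideanSpace ℝ (Fin d))),
        (∀ i, (C i).card = n) →
        ∃ (p : EuclideanSpace ℝ (Fin d))
          (D : Fin (d + 1) → Finset (EuclideanSpace ℝ (Fin d))),
          (∀ i, D i ⊆ C i) ∧ (∀ i, c * n ≤ ((D i).card : ℝ)) ∧
          ∀ x : Fin (d + 1) → EuclideanSpace ℝ (Fin d),
            (∀ i, x i ∈ D i) → p ∈ convexHull ℝ (Set.range x) := by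
  classical
  obtain ⟨c, hc, h⟩ := PachAux.index_case d
  refine ⟨c, hc, fun n C hC => ?_⟩
  rcases Nat.eq_zero_or_pos n with rfl | hn
  · refine ⟨0, fun _ => ∅, fun i => Finset.empty_subset _, fun i => by simp, fun x hx => ?_⟩
    exact absurd (hx 0) (Finset.notMem_empty _)
  · let e : ∀ i, Fin n ≃ C i := fun i => ((C i).equivFinOfCardEq (hC i)).symm
    obtain ⟨p, D, hD, hp⟩ := h n hn (fun i j => (e i j : EuclideanSpace ℝ (Fin d)))
    refine ⟨p, fun i => (D i).image fun j => (e i j : EuclideanSpace ℝ (Fin d)), ?_, ?_, ?_⟩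
    · intro i y hy
      obtain ⟨j, _, rfl⟩ := Finset.mem_image.mp hy
      exact (e i j).2
    · intro i
      have hci := Finset.card_image_of_injective (D i) (Subtype.val_injective.comp (e i).injective)
      refine (hD i).trans (le_of_eq ?_)
      exact_mod_cast hci.symm
    · intro x hx
      have : ∀ i, ∃ j ∈ D i, (e i j : EuclideanSpace ℝ (Fin d)) = x i := fun i => Finset.mem_image.mp (hx i)
      choose s hs hsx using this
      have := hp s hs
      simpa only [hsx] using this
end
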